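/- Suppose Q_{12} and Q_{21} coincide almost everywhere with functions that are continuous at the endpoints 0 and 1, and suppose J_{32} = J_{42} = J_{13} = 0, J_{14} ≠ 0 and Q_{12}(0) Q_{21}(1) ≠ 0 (values taken via the continuous representatives). Then the system of root functions of the boundary value problem is complete in L²([0,1];ℂ²). -/

import Mathlib

open MeasureTheory Set Filter

noncomputable section

/-- The unit interval `[0,1]` as a subset of `ℝ`. -/
def I01 : Set ℝ := Set.Icc 0 1

/-- Lebesgue measure restricted to `[0,1]`. -/
def mu01 : MeasureTheory.Measure ℝ := MeasureTheory.volume.restrict I01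

/-- `f ∈ W^n_1[0,1]`: the derivatives of `f` up to order `n-1` exist and are continuous on
`[0,1]`, and the `(n-1)`-st derivative is absolutely continuous, i.e. an indefinite integral
of an integrable function (its a.e.-derivative `f⁽ⁿ⁾ ∈ L¹[0,1]`). -/
def MemW1 (n : ℕ) (f : ℝ → ℂ) : Prop :=
  ContDiffOn ℝ (n - 1 : ℕ) f I01 ∧
  ∃ g : ℝ → ℂ, MeasureTheory.IntegrableOn g I01 ∧
    ∀ x ∈ I01, iteratedDerivWithin (n - 1) f I01 x
      = iteratedDerivWithin (n - 1) f I01 0 + ∫ t in (0:ℝ)..x, g t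

/-- `Jdet a j k` is the minor `J_{(j+1)(k+1)} = a_{1,j} a_{2,k} - a_{1,k} a_{2,j}` of the
boundary coefficient matrix (`0`-based indices). -/
def Jdet (a : Fin 2 → Fin 4 → ℂ) (j k : Fin 4) : ℂ := a 0 j * a 1 k - a 0 k * a 1 j

/-- `y` satisfies the two-point boundary conditions `U_j(y) = 0`, `j = 1, 2`. -/
def SatisfiesBC (a : Fin 2 → Fin 4 → ℂ) (y : ℝ → ℂ × ℂ) : Prop :=
  ∀ j : Fin 2, a j 0 * (y 0).1 + a j 1 * (y 0).2 + a j 2 * (y 1).1 + a j 3 * (y 1).2 = 0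

/-- `y` is absolutely continuous on `[0,1]` (an indefinite integral of an integrable `g`,
which is then its a.e. derivative) and satisfies `-i B⁻¹ y' + Q y = rhs` a.e. on `[0,1]`. -/
def SolvesDirac (b₁ b₂ : ℝ) (Q12 Q21 : ℝ → ℂ) (y rhs : ℝ → ℂ × ℂ) : Prop :=
  ∃ g : ℝ → ℂ × ℂ, MeasureTheory.IntegrableOn g I01 ∧
    (∀ x ∈ I01, y x = y 0 + ∫ t in (0:ℝ)..x, g t) ∧
    (∀ᵐ x ∂mu01,
      (-Complex.I) * (b₁ : ℂ)⁻¹ * (g x).1 + Q12 x * (y x).2 = (rhs x).1 ∧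
      (-Complex.I) * (b₂ : ℂ)⁻¹ * (g x).2 + Q21 x * (y x).1 = (rhs x).2)

/-- `y` is a root function of the boundary value problem: a member of a chain
`ch 0, …, ch m` of absolutely continuous functions satisfying the boundary conditions,
with `ch 0 ≠ 0`, `L (ch 0) = λ • ch 0` a.e. and `L (ch j) = λ • ch j + ch (j-1)` a.e. -/
def IsRootFunction (b₁ b₂ : ℝ) (Q12 Q21 : ℝ → ℂ) (a : Fin 2 → Fin 4 → ℂ)
    (y : ℝ → ℂ × ℂ) : Prop :=
  ∃ (lam : ℂ) (m : ℕ) (ch : ℕ → ℝ → ℂ × ℂ),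
    (∀ j ≤ m, SatisfiesBC a (ch j)) ∧
    (∃ x ∈ I01, ch 0 x ≠ 0) ∧
    SolvesDirac b₁ b₂ Q12 Q21 (ch 0) (fun x => lam • ch 0 x) ∧
    (∀ j, 1 ≤ j → j ≤ m →
      SolvesDirac b₁ b₂ Q12 Q21 (ch j) (fun x => lam • ch j x + ch (j - 1) x)) ∧
    ∃ j ≤ m, y = ch j

/-- Completeness of the system of root functions in `L²([0,1]; ℂ²)`: the closed linear
span of (the `L²`-classes of) all root functions is the whole space. -/
def RootSystemComplete (b₁ b₂ : ℝ) (Q12 Q21 : ℝ → ℂ) (a : Fin 2 → Fin 4 → ℂ) : Prop :=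
  (Submodule.span ℂ {g : MeasureTheory.Lp (ℂ × ℂ) 2 mu01 |
    ∃ y : ℝ → ℂ × ℂ, IsRootFunction b₁ b₂ Q12 Q21 a y ∧
      (g : ℝ → ℂ × ℂ) =ᵐ[mu01] y}).topologicalClosure = ⊤

/-- The indefinite integral of an integrable complex function is absolutely continuous. -/
theorem absolutelyContinuousOnInterval_integral_complex {f : ℝ → ℂ} {a b : ℝ}
    (hf : IntervalIntegrable f volume a b) :
    AbsolutelyContinuousOnInterval (fun x ↦ ∫ t in a..x, f t) a b := by
  have hre : IntervalIntegrable (fun t ↦ (f t).re) volume a b := ⟨hf.1.re, hf.2.re⟩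
  have him : IntervalIntegrable (fun t ↦ (f t).im) volume a b := ⟨hf.1.im, hf.2.im⟩
  have h1 := (hre.absolutelyContinuousOnInterval_intervalIntegral left_mem_uIcc).fun_smul
    (LipschitzOnWith.absolutelyContinuousOnInterval (K := 0)
      (f := fun _ : ℝ ↦ (1 : ℂ)) (by simp [LipschitzOnWith]))
  have h2 := (him.absolutelyContinuousOnInterval_intervalIntegral left_mem_uIcc).fun_smul
    (LipschitzOnWith.absolutelyContinuousOnInterval (K := 0)
      (f := fun _ : ℝ ↦ Complex.I) (by simp [LipschitzOnWith]))
  have hC : AbsolutelyContinuousOnInterval (fun x ↦ (∫ t in a..b, f t)) a b :=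
    LipschitzOnWith.absolutelyContinuousOnInterval (K := 0) (by simp [LipschitzOnWith])
  have h12 := h1.add h2
  refine Tendsto.congr' ?_ h12
  rw [EventuallyEq]
  refine eventually_inf_principal.2 (Eventually.of_forall fun E hE ↦ ?_)
  have key : ∀ x ∈ uIcc a b, ((fun x ↦ (∫ t in a..x, (f t).re) • (1 : ℂ)) +
      (fun x ↦ (∫ t in a..x, (f t).im) • Complex.I)) x = ∫ t in a..x, f t := by
    intro x hx
    have hfx : IntervalIntegrable f volume a x := hf.mono_set (uIcc_subset_uIcc_left hx)
    have e1 := Complex.reCLM.intervalIntegral_comp_comm hfx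
    have e2 := Complex.imCLM.intervalIntegral_comp_comm hfx
    simp only [Complex.reCLM_apply, Complex.imCLM_apply] at e1 e2
    simp only [Pi.add_apply, e1, e2]
    apply Complex.ext <;> simp
  refine Finset.sum_congr rfl fun i hi ↦ ?_
  have hmem := hE.1 i hi
  rw [key _ hmem.1, key _ hmem.2]

/-- Product rule for indefinite integrals. -/
theorem mul_eq_integral_of_eq_integral {F G f g : ℝ → ℂ}
    (hf : IntervalIntegrable f volume 0 1) (hg : IntervalIntegrable g volume 0 1)
    (hF : ∀ x ∈ Icc (0 : ℝ) 1, F x = F 0 + ∫ t in (0 : ℝ)..x, f t)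
    (hG : ∀ x ∈ Icc (0 : ℝ) 1, G x = G 0 + ∫ t in (0 : ℝ)..x, g t) :
    ∀ x ∈ Icc (0 : ℝ) 1, F x * G x = F 0 * G 0 + ∫ t in (0 : ℝ)..x, (f t * G t + F t * g t) := by
  have hu : uIcc (0 : ℝ) 1 = Icc 0 1 := uIcc_of_le zero_le_one
  have hconst : ∀ c : ℂ, AbsolutelyContinuousOnInterval (fun _ ↦ c) 0 1 := fun c ↦
    LipschitzOnWith.absolutelyContinuousOnInterval (K := 0) (by simp [LipschitzOnWith])
  set F' : ℝ → ℂ := fun x ↦ F 0 + ∫ t in (0 : ℝ)..x, f t with hF'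
  set G' : ℝ → ℂ := fun x ↦ G 0 + ∫ t in (0 : ℝ)..x, g t with hG'
  have aF : AbsolutelyContinuousOnInterval F' 0 1 :=
    (hconst _).fun_add (absolutelyContinuousOnInterval_integral_complex hf)
  have aG : AbsolutelyContinuousOnInterval G' 0 1 :=
    (hconst _).fun_add (absolutelyContinuousOnInterval_integral_complex hg)
  have hk : IntervalIntegrable (fun t ↦ f t * G' t + F' t * g t) volume 0 1 :=
    (hf.mul_continuousOn aG.continuousOn).add (hg.continuousOn_mul aF.continuousOn)
  have ah : AbsolutelyContinuousOnInterval
      (fun x ↦ F' x * G' x - ∫ t in (0 : ℝ)..x, (f t * G' t + F' t * g t)) 0 1 :=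
    (aF.fun_smul aG).fun_sub (absolutelyContinuousOnInterval_integral_complex hk)
  obtain ⟨C, hC⟩ := ah.const_of_ae_hasDerivAt_zero (by
    filter_upwards [hf.ae_hasDerivAt_integral, hg.ae_hasDerivAt_integral,
      hk.ae_hasDerivAt_integral] with x h1 h2 h3 hx
    have d1 := (h1 hx 0 left_mem_uIcc).const_add (F 0)
    have d2 := (h2 hx 0 left_mem_uIcc).const_add (G 0)
    have d3 := h3 hx 0 left_mem_uIcc
    exact ((d1.mul d2).sub d3).congr_deriv (by simp [hF', hG']))
  intro x hx
  have e0 := hC 0 left_mem_uIcc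
  have ex := hC x (hu ▸ hx)
  have e1 : ∫ t in (0 : ℝ)..x, (f t * G t + F t * g t)
      = ∫ t in (0 : ℝ)..x, (f t * G' t + F' t * g t) := by
    refine intervalIntegral.integral_congr fun t ht ↦ ?_
    rw [uIcc_of_le hx.1] at ht
    have ht' : t ∈ Icc (0 : ℝ) 1 := ⟨ht.1, ht.2.trans hx.2⟩
    simp only [hF', hG', ← hF t ht', ← hG t ht']
  have e2 : F' x = F x := (hF x hx).symm
  have e3 : G' x = G x := (hG x hx).symm
  rw [e1, ← e2, ← e3]
  have hF0 : F' 0 = F 0 := by simp [hF']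
  have hG0 : G' 0 = G 0 := by simp [hG']
  simp only [intervalIntegral.integral_same, sub_zero] at e0
  rw [sub_eq_iff_eq_add] at ex
  rw [ex, ← e0, hF0, hG0, add_comm]

theorem exp_mul_eq_integral (c : ℂ) (x : ℝ) :
    Complex.exp (c * x) = Complex.exp (c * (0 : ℝ))
      + ∫ t in (0 : ℝ)..x, c * Complex.exp (c * t) := by
  have h : ∀ t ∈ uIcc 0 x,
      HasDerivAt (fun s : ℝ ↦ Complex.exp (c * s)) (c * Complex.exp (c * t)) t := by
    intro t _
    have := ((hasDerivAt_id t).ofReal_comp.const_mul c).cexp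
    exact this.congr_deriv (by simp [mul_comm])
  rw [intervalIntegral.integral_eq_sub_of_hasDerivAt h
    (Continuous.intervalIntegrable (by fun_prop) _ _)]
  ring

/-- Variation of constants on `[0,1]`, starting from the left endpoint. -/
theorem eq_exp_mul_add_integral {c : ℂ} {y h : ℝ → ℂ} (hy : ContinuousOn y (Icc 0 1))
    (hh : IntervalIntegrable h volume 0 1)
    (hyh : ∀ x ∈ Icc (0 : ℝ) 1, y x = y 0 + ∫ t in (0 : ℝ)..x, (c * y t + h t)) :
    ∀ x ∈ Icc (0 : ℝ) 1, y x = Complex.exp (c * x) * y 0 +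
      ∫ t in (0 : ℝ)..x, Complex.exp (c * (x - t)) * h t := by
  intro x hx
  have hy' : IntervalIntegrable (fun t ↦ c * y t + h t) volume 0 1 :=
    (ContinuousOn.intervalIntegrable (by rw [uIcc_of_le zero_le_one]; fun_prop)).add hh
  have := mul_eq_integral_of_eq_integral (F := fun t : ℝ ↦ Complex.exp (-c * t))
    (f := fun t : ℝ ↦ -c * Complex.exp (-c * t))
    (Continuous.intervalIntegrable (by fun_prop) _ _) hy' (fun x _ ↦ exp_mul_eq_integral (-c) x)
    hyh x hx
  have e : ∀ t : ℝ, -c * Complex.exp (-c * t) * y t + Complex.exp (-c * t) * (c * y t + h t)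
    = Complex.exp (-c * t) * h t := fun t ↦ by ring
  simp only [e] at this
  have e2 : Complex.exp (c * x) * Complex.exp (-c * x) = 1 := by
    rw [← Complex.exp_add]; simp
  calc y x = Complex.exp (c * x) * (Complex.exp (-c * x) * y x) := by
        rw [← mul_assoc, e2, one_mul]
    _ = _ := by
      rw [this, mul_add, ← intervalIntegral.integral_const_mul]
      congr 1
      · simp
      · refine intervalIntegral.integral_congr fun t _ ↦ ?_
        rw [← mul_assoc, ← Complex.exp_add]
        congr 2
        ring

/-- Variation of constants on `[0,1]`, starting from the right endpoint. -/
theorem eq_exp_mul_sub_integral {c : ℂ} {y h : ℝ → ℂ} (hy : ContinuousOn y (Icc 0 1))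
    (hh : IntervalIntegrable h volume 0 1)
    (hyh : ∀ x ∈ Icc (0 : ℝ) 1, y x = y 0 + ∫ t in (0 : ℝ)..x, (c * y t + h t)) :
    ∀ x ∈ Icc (0 : ℝ) 1, y x = Complex.exp (c * (x - 1)) * y 1 -
      ∫ t in x..1, Complex.exp (c * (x - t)) * h t := by
  intro x hx
  have hi : ∀ a b : ℝ, a ∈ Icc (0 : ℝ) 1 → b ∈ Icc (0 : ℝ) 1 →
      IntervalIntegrable (fun t : ℝ ↦ Complex.exp (c * (x - t)) * h t) volume a b := by
    intro a b ha hb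
    refine IntervalIntegrable.continuousOn_mul (hh.mono_set ?_) (by fun_prop)
    rw [uIcc_of_le zero_le_one]
    exact uIcc_subset_Icc ha hb
  have h1 := eq_exp_mul_add_integral hy hh hyh 1 (by simp)
  rw [eq_exp_mul_add_integral hy hh hyh x hx, h1, mul_add, ← mul_assoc, ← Complex.exp_add,
    ← intervalIntegral.integral_const_mul]
  have e : ∀ t : ℝ, Complex.exp (c * (x - 1)) * (Complex.exp (c * ((1 : ℝ) - t)) * h t) =
      Complex.exp (c * (x - t)) * h t := by
    intro t
    rw [← mul_assoc, ← Complex.exp_add]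
    congr 2
    push_cast
    ring
  simp only [e]
  rw [← intervalIntegral.integral_add_adjacent_intervals (hi 0 x (by simp) hx)
    (hi x 1 hx (by simp))]
  have : c * (x - 1) + c * ((1 : ℝ) : ℂ) = c * x := by push_cast; ring
  rw [this]
  ring

theorem integral_exp_neg_mul_abs_sub_le {κ : ℝ} (hκ : 0 < κ) (x : ℝ) :
    ∫ t in Icc (0 : ℝ) 1, Real.exp (-κ * |x - t|) ≤ 2 / κ := by
  have hI : Integrable (fun t : ℝ ↦ Real.exp (-κ * |t|)) := by
    have h1 : IntegrableOn (fun t : ℝ ↦ Real.exp (-κ * |t|)) (Ioi 0) :=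
      (integrableOn_exp_mul_Ioi (a := -κ) (by linarith) 0).congr_fun
        (fun t (ht : 0 < t) ↦ by simp [abs_of_pos ht]) measurableSet_Ioi
    have h2 : IntegrableOn (fun t : ℝ ↦ Real.exp (-κ * |t|)) (Iic 0) :=
      (integrableOn_exp_mul_Iic (a := κ) hκ 0).congr_fun
        (fun t (ht : t ≤ 0) ↦ by simp [abs_of_nonpos ht]) measurableSet_Iic
    rw [← integrableOn_univ, ← Iic_union_Ioi (a := (0 : ℝ))]
    exact h2.union h1
  have hI' : Integrable (fun t : ℝ ↦ Real.exp (-κ * |x - t|)) := hI.comp_sub_left x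
  calc _ ≤ ∫ t, Real.exp (-κ * |x - t|) :=
        setIntegral_le_integral hI' (Eventually.of_forall fun t ↦ (Real.exp_pos _).le)
    _ = ∫ t : ℝ, Real.exp (-κ * |t|) := integral_sub_left_eq_self (fun t ↦ Real.exp (-κ * |t|)) _ x
    _ = 2 * ∫ t in Ioi (0 : ℝ), Real.exp (-κ * t) :=
      integral_comp_abs (f := fun t ↦ Real.exp (-κ * t))
    _ = 2 / κ := by
      rw [integral_exp_mul_Ioi (by linarith)]
      simp
      field_simp

/-- Exponential kernels of rate `κ` act on a fixed integrable function with norm tending to `0`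
as `κ → ∞`, uniformly in the base point. -/
theorem exists_forall_integral_exp_neg_mul_abs_le {g : ℝ → ℂ} (hg : IntegrableOn g (Icc 0 1))
    {ε : ℝ} (hε : 0 < ε) :
    ∃ K > 0, ∀ κ ≥ K, ∀ x : ℝ, ∫ t in Icc (0 : ℝ) 1, Real.exp (-κ * |x - t|) * ‖g t‖ ≤ ε := by
  have hlim : Tendsto (fun n : ℕ ↦ ∫ t in Icc (0 : ℝ) 1, max (‖g t‖ - n) 0) atTop
      (nhds (∫ t in Icc (0 : ℝ) 1, (0 : ℝ))) := by
    refine tendsto_integral_of_dominated_convergence (fun t ↦ ‖g t‖) (fun n ↦ ?_) hg.norm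
      (fun n ↦ Eventually.of_forall fun t ↦ ?_) (Eventually.of_forall fun t ↦ ?_)
    · exact ((hg.aestronglyMeasurable.norm.sub aestronglyMeasurable_const).sup
        aestronglyMeasurable_const)
    · rw [Real.norm_of_nonneg (le_max_right _ _)]
      exact max_le (by simp) (norm_nonneg _)
    · refine tendsto_const_nhds.congr' ?_
      obtain ⟨N, hN⟩ := exists_nat_ge ‖g t‖
      filter_upwards [eventually_ge_atTop N] with n hn
      have : (N : ℝ) ≤ n := by exact_mod_cast hn
      rw [max_eq_right (by linarith)]
  rw [integral_zero] at hlim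
  obtain ⟨n, hn⟩ := (hlim.eventually (gt_mem_nhds (half_pos hε))).exists
  refine ⟨4 * (n + 1) / ε, by positivity, fun κ hκ x ↦ ?_⟩
  have hκ0 : 0 < κ := lt_of_lt_of_le (by positivity) hκ
  have hm : Integrable (fun t ↦ max (‖g t‖ - n) 0) (volume.restrict (Icc (0 : ℝ) 1)) := by
    refine (hg.norm).mono' ((hg.aestronglyMeasurable.norm.sub aestronglyMeasurable_const).sup
        aestronglyMeasurable_const) (Eventually.of_forall fun t ↦ ?_)
    rw [Real.norm_of_nonneg (le_max_right _ _)]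
    exact max_le (by simp) (norm_nonneg _)
  have he : IntegrableOn (fun t ↦ Real.exp (-κ * |x - t|)) (Icc (0 : ℝ) 1) :=
    Continuous.integrableOn_Icc (by fun_prop)
  have hle : ∀ t, Real.exp (-κ * |x - t|) ≤ 1 := fun t ↦ by
    rw [Real.exp_le_one_iff]
    have := mul_nonneg hκ0.le (abs_nonneg (x - t))
    linarith
  calc ∫ t in Icc (0 : ℝ) 1, Real.exp (-κ * |x - t|) * ‖g t‖
      ≤ ∫ t in Icc (0 : ℝ) 1, (n * Real.exp (-κ * |x - t|) + max (‖g t‖ - n) 0) := by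
        refine integral_mono_of_nonneg (Eventually.of_forall fun t ↦ by positivity)
          ((he.const_mul _).add hm) (Eventually.of_forall fun t ↦ ?_)
        have h1 := le_max_left (‖g t‖ - n) 0
        have h2 := le_max_right (‖g t‖ - n) 0
        have h3 := Real.exp_pos (-κ * |x - t|)
        have h4 := hle t
        simp only
        nlinarith
    _ = n * (∫ t in Icc (0 : ℝ) 1, Real.exp (-κ * |x - t|)) +
          ∫ t in Icc (0 : ℝ) 1, max (‖g t‖ - n) 0 := by
        rw [integral_add (he.const_mul _) hm, integral_const_mul]
    _ ≤ n * (2 / κ) + ε / 2 := by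
        gcongr
        exact integral_exp_neg_mul_abs_sub_le hκ0 x
    _ ≤ ε / 2 + ε / 2 := by
        gcongr
        rw [ge_iff_le, div_le_iff₀ hε] at hκ
        rw [mul_div_assoc', div_le_iff₀ hκ0]
        nlinarith
    _ = ε := by ring

/-- `(u, v)` solves the system `u' = c₁ u + p v + f`, `v' = c₂ v + q u + g` on `[0,1]`,
in integrated form. -/
def SolvesSystem (c₁ c₂ : ℂ) (p q f g u v : ℝ → ℂ) : Prop :=
  ContinuousOn u (Icc 0 1) ∧ ContinuousOn v (Icc 0 1) ∧
  (∀ x ∈ Icc (0 : ℝ) 1, u x = u 0 + ∫ t in (0 : ℝ)..x, (c₁ * u t + (p t * v t + f t))) ∧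
  ∀ x ∈ Icc (0 : ℝ) 1, v x = v 0 + ∫ t in (0 : ℝ)..x, (c₂ * v t + (q t * u t + g t))

theorem SolvesSystem.swap {c₁ c₂ : ℂ} {p q f g u v : ℝ → ℂ}
    (h : SolvesSystem c₁ c₂ p q f g u v) : SolvesSystem c₂ c₁ q p g f v u :=
  ⟨h.2.1, h.1, h.2.2.2, h.2.2.1⟩

theorem continuousOn_comp_one_sub {u : ℝ → ℂ} (hu : ContinuousOn u (Icc 0 1)) :
    ContinuousOn (fun x ↦ u (1 - x)) (Icc 0 1) :=
  hu.comp (by fun_prop) fun x hx ↦ ⟨by linarith [hx.2], by linarith [hx.1]⟩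

theorem eq_integral_comp_one_sub {u h : ℝ → ℂ} (hh : IntervalIntegrable h volume 0 1)
    (hu : ∀ x ∈ Icc (0 : ℝ) 1, u x = u 0 + ∫ t in (0 : ℝ)..x, h t) :
    ∀ x ∈ Icc (0 : ℝ) 1, u (1 - x) = u (1 - 0) + ∫ t in (0 : ℝ)..x, -h (1 - t) := by
  intro x hx
  have hx' : 1 - x ∈ Icc (0 : ℝ) 1 := ⟨by linarith [hx.2], by linarith [hx.1]⟩
  have hi1 : IntervalIntegrable h volume 0 (1 - x) :=
    hh.mono_set (uIcc_subset_uIcc_left (by rwa [uIcc_of_le zero_le_one]))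
  have hi2 : IntervalIntegrable h volume (1 - x) 1 :=
    hh.mono_set (uIcc_subset_uIcc_right (by rwa [uIcc_of_le zero_le_one]))
  rw [intervalIntegral.integral_neg, intervalIntegral.integral_comp_sub_left (fun t ↦ h t) 1,
    hu _ hx', sub_zero, hu 1 (by simp), ← intervalIntegral.integral_add_adjacent_intervals hi1 hi2]
  ring

theorem intervalIntegrable_of_integrableOn_Icc {f : ℝ → ℂ} (hf : IntegrableOn f (Icc 0 1)) :
    IntervalIntegrable f volume 0 1 :=
  (intervalIntegrable_iff_integrableOn_Icc_of_le zero_le_one).2 hf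

theorem SolvesSystem.intervalIntegrable {p f v : ℝ → ℂ} (hv : ContinuousOn v (Icc 0 1))
    (hp : IntegrableOn p (Icc 0 1)) (hf : IntegrableOn f (Icc 0 1)) :
    IntervalIntegrable (fun t ↦ p t * v t + f t) volume 0 1 :=
  ((intervalIntegrable_of_integrableOn_Icc hp).mul_continuousOn
    (by rwa [uIcc_of_le zero_le_one])).add (intervalIntegrable_of_integrableOn_Icc hf)

theorem SolvesSystem.reflect {c₁ c₂ : ℂ} {p q f g u v : ℝ → ℂ}
    (h : SolvesSystem c₁ c₂ p q f g u v) (hp : IntegrableOn p (Icc 0 1))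
    (hq : IntegrableOn q (Icc 0 1)) (hf : IntegrableOn f (Icc 0 1))
    (hg : IntegrableOn g (Icc 0 1)) :
    SolvesSystem (-c₁) (-c₂) (fun x ↦ -p (1 - x)) (fun x ↦ -q (1 - x)) (fun x ↦ -f (1 - x))
      (fun x ↦ -g (1 - x)) (fun x ↦ u (1 - x)) (fun x ↦ v (1 - x)) := by
  have hc : ∀ {c : ℂ} {w : ℝ → ℂ}, ContinuousOn w (Icc 0 1) →
      IntervalIntegrable (fun t ↦ c * w t) volume 0 1 := fun {c w} hw ↦
    ContinuousOn.intervalIntegrable (by rw [uIcc_of_le zero_le_one]; fun_prop)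
  refine ⟨continuousOn_comp_one_sub h.1, continuousOn_comp_one_sub h.2.1, fun x hx ↦ ?_,
    fun x hx ↦ ?_⟩
  · beta_reduce
    rw [eq_integral_comp_one_sub ((hc h.1).add (SolvesSystem.intervalIntegrable h.2.1 hp hf))
      h.2.2.1 x hx]
    congr 2
    ext t
    ring
  · beta_reduce
    rw [eq_integral_comp_one_sub ((hc h.2.1).add (SolvesSystem.intervalIntegrable h.1 hq hg))
      h.2.2.2 x hx]
    congr 2
    ext t
    ring

theorem integrableOn_comp_one_sub {f : ℝ → ℂ} (hf : IntegrableOn f (Icc 0 1)) :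
    IntegrableOn (fun x ↦ f (1 - x)) (Icc 0 1) := by
  have := (intervalIntegrable_of_integrableOn_Icc hf).comp_sub_left 1
  simp only [sub_zero, sub_self] at this
  exact (intervalIntegrable_iff_integrableOn_Icc_of_le zero_le_one).1 this.symm

/-- A weighted Gronwall-type bound for a system whose two components are propagated
in opposite directions. -/
theorem norm_le_two_mul_of_integral_le {κ : ℝ} {u v P R : ℝ → ℂ} {W : ℝ → ℝ} (hκ : 0 ≤ κ)
    (hP : IntegrableOn P (Icc 0 1)) (hR : IntegrableOn R (Icc 0 1))
    (hu : ContinuousOn u (Icc 0 1)) (hv : ContinuousOn v (Icc 0 1))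
    (hW : ContinuousOn W (Icc 0 1)) (hW0 : ∀ x ∈ Icc (0 : ℝ) 1, 0 ≤ W x)
    (hWe : ∀ x ∈ Icc (0 : ℝ) 1, ∀ t ∈ Icc (0 : ℝ) 1, Real.exp (-κ * |x - t|) * W t ≤ W x)
    (hPκ : ∀ x, ∫ t in Icc (0 : ℝ) 1, Real.exp (-κ * |x - t|) * ‖P t‖ ≤ 1 / 2)
    (hRκ : ∀ x, ∫ t in Icc (0 : ℝ) 1, Real.exp (-κ * |x - t|) * ‖R t‖ ≤ 1 / 2)
    (hu' : ∀ x ∈ Icc (0 : ℝ) 1,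
      ‖u x‖ ≤ W x + ∫ t in Icc (0 : ℝ) 1, Real.exp (-(2 * κ) * |x - t|) * (‖P t‖ * ‖v t‖))
    (hv' : ∀ x ∈ Icc (0 : ℝ) 1,
      ‖v x‖ ≤ W x + ∫ t in Icc (0 : ℝ) 1, Real.exp (-(2 * κ) * |x - t|) * (‖R t‖ * ‖u t‖)) :
    ∀ x ∈ Icc (0 : ℝ) 1, ‖u x‖ ≤ 2 * W x ∧ ‖v x‖ ≤ 2 * W x := by
  suffices H : ∀ ε > 0, ∀ x ∈ Icc (0 : ℝ) 1, ‖u x‖ ≤ 2 * (W x + ε) ∧ ‖v x‖ ≤ 2 * (W x + ε) by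
    intro x hx
    constructor <;> refine le_of_forall_pos_le_add fun ε hε ↦ ?_
    · have := (H (ε / 2) (half_pos hε) x hx).1
      linarith
    · have := (H (ε / 2) (half_pos hε) x hx).2
      linarith
  intro ε hε
  have hpos : ∀ x ∈ Icc (0 : ℝ) 1, 0 < W x + ε := fun x hx ↦ by linarith [hW0 x hx]
  have hcont : ContinuousOn (fun x ↦ max ‖u x‖ ‖v x‖ / (W x + ε)) (Icc 0 1) :=
    (hu.norm.sup hv.norm).div (hW.add continuousOn_const) fun x hx ↦ (hpos x hx).ne'
  obtain ⟨x₀, hx₀, hmax⟩ := isCompact_Icc.exists_isMaxOn (nonempty_Icc.2 zero_le_one) hcont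
  set m := max ‖u x₀‖ ‖v x₀‖ / (W x₀ + ε) with hm
  have hm0 : 0 ≤ m := div_nonneg (le_max_of_le_left (norm_nonneg _)) (hpos x₀ hx₀).le
  have hmle : ∀ x ∈ Icc (0 : ℝ) 1, max ‖u x‖ ‖v x‖ ≤ m * (W x + ε) := fun x hx ↦ by
    have := hmax hx
    rwa [mem_ofPred_eq, div_le_iff₀ (hpos x hx)] at this
  have key : ∀ S w : ℝ → ℂ, IntegrableOn S (Icc 0 1) →
      (∀ x, ∫ t in Icc (0 : ℝ) 1, Real.exp (-κ * |x - t|) * ‖S t‖ ≤ 1 / 2) →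
      (∀ t ∈ Icc (0 : ℝ) 1, ‖w t‖ ≤ m * (W t + ε)) → ∀ x ∈ Icc (0 : ℝ) 1,
      ∫ t in Icc (0 : ℝ) 1, Real.exp (-(2 * κ) * |x - t|) * (‖S t‖ * ‖w t‖) ≤
        m * (W x + ε) / 2 := by
    intro S w hS hSκ hw x hx
    have hint : IntegrableOn (fun t ↦ Real.exp (-κ * |x - t|) * ‖S t‖) (Icc 0 1) :=
      IntegrableOn.continuousOn_mul (by fun_prop) hS.norm isCompact_Icc
    calc _ ≤ ∫ t in Icc (0 : ℝ) 1, (m * (W x + ε)) * (Real.exp (-κ * |x - t|) * ‖S t‖) := by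
          refine integral_mono_of_nonneg (Eventually.of_forall fun t ↦ by positivity)
            (hint.const_mul _) ((ae_restrict_iff' measurableSet_Icc).2
              (Eventually.of_forall fun t ht ↦ ?_))
          have h1 := hw t ht
          have h2 := hWe x hx t ht
          have h3 : Real.exp (-κ * |x - t|) ≤ 1 := by
            rw [Real.exp_le_one_iff]
            have := mul_nonneg hκ (abs_nonneg (x - t))
            linarith
          have h4 : Real.exp (-κ * |x - t|) * (W t + ε) ≤ W x + ε := by nlinarith
          have e : -(2 * κ) * |x - t| = -κ * |x - t| + -κ * |x - t| := by ring
          simp only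
          rw [e, Real.exp_add]
          calc _ = Real.exp (-κ * |x - t|) * ‖S t‖ * (Real.exp (-κ * |x - t|) * ‖w t‖) := by ring
            _ ≤ Real.exp (-κ * |x - t|) * ‖S t‖ *
                (Real.exp (-κ * |x - t|) * (m * (W t + ε))) := by gcongr
            _ = Real.exp (-κ * |x - t|) * ‖S t‖ *
                (m * (Real.exp (-κ * |x - t|) * (W t + ε))) := by ring
            _ ≤ Real.exp (-κ * |x - t|) * ‖S t‖ * (m * (W x + ε)) := by gcongr
            _ = _ := by ring
      _ = (m * (W x + ε)) * ∫ t in Icc (0 : ℝ) 1, Real.exp (-κ * |x - t|) * ‖S t‖ :=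
          integral_const_mul _ _
      _ ≤ (m * (W x + ε)) * (1 / 2) := by
          have := mul_nonneg hm0 (hpos x hx).le
          gcongr
          exact hSκ x
      _ = _ := by ring
  have k1 := key P v hP hPκ (fun t ht ↦ (le_max_right _ _).trans (hmle t ht)) x₀ hx₀
  have k2 := key R u hR hRκ (fun t ht ↦ (le_max_left _ _).trans (hmle t ht)) x₀ hx₀
  have hm2 : m ≤ 2 := by
    have h1 : max ‖u x₀‖ ‖v x₀‖ ≤ (W x₀ + ε) + m * (W x₀ + ε) / 2 :=
      max_le (by linarith [hu' x₀ hx₀]) (by linarith [hv' x₀ hx₀])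
    have h2 : max ‖u x₀‖ ‖v x₀‖ = m * (W x₀ + ε) := by
      rw [hm, div_mul_cancel₀ _ (hpos x₀ hx₀).ne']
    have := hpos x₀ hx₀
    nlinarith
  intro x hx
  have h1 : max ‖u x‖ ‖v x‖ ≤ 2 * (W x + ε) :=
    (hmle x hx).trans (mul_le_mul_of_nonneg_right hm2 (hpos x hx).le)
  exact ⟨(le_max_left _ _).trans h1, (le_max_right _ _).trans h1⟩

section WeightedBounds

theorem integrableOn_exp_neg_mul_abs_mul {ρ x : ℝ} {h : ℝ → ℝ} (hh : IntegrableOn h (Icc 0 1)) :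
    IntegrableOn (fun t ↦ Real.exp (-ρ * |x - t|) * h t) (Icc 0 1) :=
  IntegrableOn.continuousOn_mul (by fun_prop) hh isCompact_Icc

theorem norm_integral_exp_mul_le {c : ℂ} {ρ x a b : ℝ} {h : ℝ → ℂ}
    (hh : IntegrableOn h (Icc 0 1)) (ha : 0 ≤ a) (hab : a ≤ b) (hb : b ≤ 1)
    (hc : ∀ t ∈ Ioc a b, c.re * (x - t) ≤ -ρ * |x - t|) :
    ‖∫ t in a..b, Complex.exp (c * (x - t)) * h t‖ ≤
      ∫ t in Icc (0 : ℝ) 1, Real.exp (-ρ * |x - t|) * ‖h t‖ := by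
  have hsub : Ioc a b ⊆ Icc 0 1 := fun t ht ↦ ⟨ha.trans ht.1.le, ht.2.trans hb⟩
  have hi := integrableOn_exp_neg_mul_abs_mul (ρ := ρ) (x := x) hh.norm
  rw [intervalIntegral.integral_of_le hab]
  calc _ ≤ ∫ t in Ioc a b, Real.exp (-ρ * |x - t|) * ‖h t‖ := by
        refine norm_integral_le_of_norm_le (hi.mono_set hsub)
          ((ae_restrict_iff' measurableSet_Ioc).2 (Eventually.of_forall fun t ht ↦ ?_))
        rw [norm_mul, Complex.norm_exp]
        gcongr
        have : (c * (x - t)).re = c.re * (x - t) := by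
          rw [← Complex.ofReal_sub, Complex.re_mul_ofReal]
        rw [this]
        exact hc t ht
    _ ≤ _ := setIntegral_mono_set hi (Eventually.of_forall fun t ↦ by positivity)
        hsub.eventuallyLE

theorem norm_sub_exp_mul_le {c : ℂ} {ρ : ℝ} {y h : ℝ → ℂ} (hc : c.re ≤ -ρ)
    (hy : ContinuousOn y (Icc 0 1)) (hh : IntegrableOn h (Icc 0 1))
    (hyh : ∀ x ∈ Icc (0 : ℝ) 1, y x = y 0 + ∫ t in (0 : ℝ)..x, (c * y t + h t)) :
    ∀ x ∈ Icc (0 : ℝ) 1, ‖y x - Complex.exp (c * x) * y 0‖ ≤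
      ∫ t in Icc (0 : ℝ) 1, Real.exp (-ρ * |x - t|) * ‖h t‖ := by
  intro x hx
  rw [eq_exp_mul_add_integral hy (intervalIntegrable_of_integrableOn_Icc hh) hyh x hx,
    add_sub_cancel_left]
  refine norm_integral_exp_mul_le hh le_rfl hx.1 hx.2 fun t ht ↦ ?_
  rw [abs_of_nonneg (sub_nonneg.2 ht.2)]
  exact mul_le_mul_of_nonneg_right hc (sub_nonneg.2 ht.2)

theorem norm_sub_exp_mul_le' {c : ℂ} {ρ : ℝ} {y h : ℝ → ℂ} (hc : ρ ≤ c.re)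
    (hy : ContinuousOn y (Icc 0 1)) (hh : IntegrableOn h (Icc 0 1))
    (hyh : ∀ x ∈ Icc (0 : ℝ) 1, y x = y 0 + ∫ t in (0 : ℝ)..x, (c * y t + h t)) :
    ∀ x ∈ Icc (0 : ℝ) 1, ‖y x - Complex.exp (c * (x - 1)) * y 1‖ ≤
      ∫ t in Icc (0 : ℝ) 1, Real.exp (-ρ * |x - t|) * ‖h t‖ := by
  intro x hx
  rw [eq_exp_mul_sub_integral hy (intervalIntegrable_of_integrableOn_Icc hh) hyh x hx,
    sub_sub_cancel_left, norm_neg]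
  refine norm_integral_exp_mul_le hh hx.1 hx.2 le_rfl fun t ht ↦ ?_
  rw [abs_of_neg (sub_neg.2 ht.1)]
  nlinarith [ht.1]

theorem norm_exp_mul_le {c : ℂ} {ρ x : ℝ} (hc : c.re ≤ -ρ) (hx : 0 ≤ x) :
    ‖Complex.exp (c * x)‖ ≤ Real.exp (-ρ * x) := by
  rw [Complex.norm_exp, Complex.re_mul_ofReal]
  gcongr

theorem norm_exp_mul_le' {c : ℂ} {ρ x : ℝ} (hc : ρ ≤ c.re) (hx : x ≤ 1) :
    ‖Complex.exp (c * (x - 1))‖ ≤ Real.exp (-ρ * (1 - x)) := by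
  have := norm_exp_mul_le (c := -c) (ρ := ρ) (x := 1 - x) (by simpa using hc) (by linarith)
  convert this using 3
  push_cast
  ring

variable {c₁ c₂ : ℂ} {p q f g u v : ℝ → ℂ} {κ : ℝ}

theorem integrableOn_mul_continuousOn (hp : IntegrableOn p (Icc 0 1))
    (hv : ContinuousOn v (Icc 0 1)) : IntegrableOn (fun t ↦ p t * v t) (Icc 0 1) :=
  hp.mul_continuousOn hv isCompact_Icc

/-- A priori bound for the homogeneous system in terms of the values at the stable endpoints. -/
theorem SolvesSystem.norm_le (h : SolvesSystem c₁ c₂ p q 0 0 u v) (hκ : 0 ≤ κ)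
    (h₁ : 2 * κ ≤ c₁.re) (h₂ : c₂.re ≤ -(2 * κ))
    (hp : IntegrableOn p (Icc 0 1)) (hq : IntegrableOn q (Icc 0 1))
    (hpκ : ∀ x, ∫ t in Icc (0 : ℝ) 1, Real.exp (-κ * |x - t|) * ‖p t‖ ≤ 1 / 2)
    (hqκ : ∀ x, ∫ t in Icc (0 : ℝ) 1, Real.exp (-κ * |x - t|) * ‖q t‖ ≤ 1 / 2) :
    ∀ x ∈ Icc (0 : ℝ) 1,
      ‖u x‖ ≤ 2 * (Real.exp (-κ * (1 - x)) * ‖u 1‖ + Real.exp (-κ * x) * ‖v 0‖) ∧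
      ‖v x‖ ≤ 2 * (Real.exp (-κ * (1 - x)) * ‖u 1‖ + Real.exp (-κ * x) * ‖v 0‖) := by
  obtain ⟨hu, hv, hu', hv'⟩ := h
  simp only [Pi.zero_apply, add_zero] at hu' hv'
  refine norm_le_two_mul_of_integral_le hκ hp hq hu hv (by fun_prop) (fun x hx ↦ by positivity)
    (fun x hx t ht ↦ ?_) hpκ hqκ (fun x hx ↦ ?_) (fun x hx ↦ ?_)
  · rw [mul_add, ← mul_assoc, ← mul_assoc, ← Real.exp_add, ← Real.exp_add]
    gcongr
    · nlinarith [neg_abs_le (x - t)]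
    · nlinarith [le_abs_self (x - t)]
  · have h3 := norm_sub_exp_mul_le' h₁ hu (integrableOn_mul_continuousOn hp hv) hu' x hx
    have h4 := norm_exp_mul_le' h₁ hx.2
    have h5 : ‖u x‖ ≤ ‖Complex.exp (c₁ * (x - 1)) * u 1‖ +
      ‖u x - Complex.exp (c₁ * (x - 1)) * u 1‖ := by
      simpa using norm_add_le (Complex.exp (c₁ * (x - 1)) * u 1)
        (u x - Complex.exp (c₁ * (x - 1)) * u 1)
    have h6 : Real.exp (-(2 * κ) * (1 - x)) ≤ Real.exp (-κ * (1 - x)) := by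
      gcongr
      · linarith [hx.2]
      · linarith
    have h7 : ‖Complex.exp (c₁ * (x - 1)) * u 1‖ ≤ Real.exp (-κ * (1 - x)) * ‖u 1‖ := by
      rw [norm_mul]
      gcongr
      exact h4.trans h6
    simp only [norm_mul] at h3
    have : 0 ≤ Real.exp (-κ * x) * ‖v 0‖ := by positivity
    rw [norm_mul] at h5 h7
    linarith
  · have h3 := norm_sub_exp_mul_le h₂ hv (integrableOn_mul_continuousOn hq hu) hv' x hx
    have h4 := norm_exp_mul_le h₂ hx.1
    have h5 : ‖v x‖ ≤ ‖Complex.exp (c₂ * x) * v 0‖ + ‖v x - Complex.exp (c₂ * x) * v 0‖ := by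
      simpa using norm_add_le (Complex.exp (c₂ * x) * v 0) (v x - Complex.exp (c₂ * x) * v 0)
    have h6 : Real.exp (-(2 * κ) * x) ≤ Real.exp (-κ * x) := by
      gcongr
      · exact hx.1
      · linarith
    have h7 : ‖Complex.exp (c₂ * x) * v 0‖ ≤ Real.exp (-κ * x) * ‖v 0‖ := by
      rw [norm_mul]
      gcongr
      exact h4.trans h6
    simp only [norm_mul] at h3
    have : 0 ≤ Real.exp (-κ * (1 - x)) * ‖u 1‖ := by positivity
    rw [norm_mul] at h5 h7
    linarith

/-- A priori bound for the inhomogeneous system vanishing at the stable endpoints. -/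
theorem SolvesSystem.norm_le_of_eq_zero {ε : ℝ} (h : SolvesSystem c₁ c₂ p q f g u v) (hκ : 0 ≤ κ)
    (h₁ : 2 * κ ≤ c₁.re) (h₂ : c₂.re ≤ -(2 * κ))
    (hp : IntegrableOn p (Icc 0 1)) (hq : IntegrableOn q (Icc 0 1))
    (hf : IntegrableOn f (Icc 0 1)) (hg : IntegrableOn g (Icc 0 1)) (hε : 0 ≤ ε)
    (hpκ : ∀ x, ∫ t in Icc (0 : ℝ) 1, Real.exp (-κ * |x - t|) * ‖p t‖ ≤ 1 / 2)
    (hqκ : ∀ x, ∫ t in Icc (0 : ℝ) 1, Real.exp (-κ * |x - t|) * ‖q t‖ ≤ 1 / 2)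
    (hfκ : ∀ x, ∫ t in Icc (0 : ℝ) 1, Real.exp (-κ * |x - t|) * ‖f t‖ ≤ ε)
    (hgκ : ∀ x, ∫ t in Icc (0 : ℝ) 1, Real.exp (-κ * |x - t|) * ‖g t‖ ≤ ε)
    (hu1 : u 1 = 0) (hv0 : v 0 = 0) :
    ∀ x ∈ Icc (0 : ℝ) 1, ‖u x‖ ≤ 2 * ε ∧ ‖v x‖ ≤ 2 * ε := by
  obtain ⟨hu, hv, hu', hv'⟩ := h
  have key : ∀ a b w : ℝ → ℂ, IntegrableOn a (Icc 0 1) → IntegrableOn b (Icc 0 1) →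
      ContinuousOn w (Icc 0 1) →
      (∀ x, ∫ t in Icc (0 : ℝ) 1, Real.exp (-κ * |x - t|) * ‖b t‖ ≤ ε) → ∀ x,
      ∫ t in Icc (0 : ℝ) 1, Real.exp (-(2 * κ) * |x - t|) * ‖a t * w t + b t‖ ≤
      ε + ∫ t in Icc (0 : ℝ) 1, Real.exp (-(2 * κ) * |x - t|) * (‖a t‖ * ‖w t‖) := by
    intro a b w ha hb hw hbκ x
    have i0 := (integrableOn_mul_continuousOn ha hw).norm
    simp only [norm_mul] at i0
    have i1 := integrableOn_exp_neg_mul_abs_mul (ρ := κ) (x := x) hb.norm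
    have i2 := integrableOn_exp_neg_mul_abs_mul (ρ := 2 * κ) (x := x) i0
    calc _ ≤ ∫ t in Icc (0 : ℝ) 1, (Real.exp (-κ * |x - t|) * ‖b t‖ +
          Real.exp (-(2 * κ) * |x - t|) * (‖a t‖ * ‖w t‖)) := by
          refine integral_mono_of_nonneg (Eventually.of_forall fun t ↦ by positivity)
            (i1.add i2) (Eventually.of_forall fun t ↦ ?_)
          have h6 : Real.exp (-(2 * κ) * |x - t|) ≤ Real.exp (-κ * |x - t|) := by
            gcongr
            linarith
          have h7 := norm_add_le (a t * w t) (b t)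
          rw [norm_mul] at h7
          calc _ ≤ Real.exp (-(2 * κ) * |x - t|) * (‖a t‖ * ‖w t‖ + ‖b t‖) :=
              mul_le_mul_of_nonneg_left h7 (Real.exp_pos _).le
            _ ≤ (Real.exp (-κ * |x - t|) * ‖b t‖) +
              Real.exp (-(2 * κ) * |x - t|) * (‖a t‖ * ‖w t‖) := by
              nlinarith [norm_nonneg (b t)]
      _ = _ := integral_add i1 i2
      _ ≤ _ := add_le_add (hbκ x) le_rfl
  refine norm_le_two_mul_of_integral_le (W := fun _ ↦ ε) hκ hp hq hu hv (by fun_prop)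
    (fun x hx ↦ hε) (fun x hx t ht ↦ ?_) hpκ hqκ (fun x hx ↦ ?_) (fun x hx ↦ ?_)
  · refine mul_le_of_le_one_left hε ?_
    rw [Real.exp_le_one_iff]
    nlinarith [abs_nonneg (x - t)]
  · have h3 := norm_sub_exp_mul_le' h₁ hu ((integrableOn_mul_continuousOn hp hv).add hf) hu' x hx
    rw [hu1, mul_zero, sub_zero] at h3
    exact h3.trans (key p f v hp hf hv hfκ x)
  · have h3 := norm_sub_exp_mul_le h₂ hv ((integrableOn_mul_continuousOn hq hu).add hg) hv' x hx
    rw [hv0, mul_zero, sub_zero] at h3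
    exact h3.trans (key q g u hq hg hu hgκ x)

end WeightedBounds

theorem exists_forall_mul_exp_neg_mul_le (N : ℝ) {δ ε : ℝ} (hδ : 0 < δ) (hε : 0 < ε) :
    ∃ K > 0, ∀ κ ≥ K, N * Real.exp (-κ * δ) ≤ ε / κ := by
  have h := (Real.tendsto_pow_mul_exp_neg_atTop_nhds_zero 1).comp
    (tendsto_id.const_mul_atTop hδ : Tendsto (fun κ : ℝ ↦ δ * κ) atTop atTop)
  have h2 := (h.const_mul (N / δ)).eventually_le_const (u := ε) (by simpa using hε)
  obtain ⟨K, hK⟩ := eventually_atTop.1 h2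
  refine ⟨max K 1, by positivity, fun κ hκ ↦ ?_⟩
  have hκ0 : 0 < κ := lt_of_lt_of_le one_pos ((le_max_right _ _).trans hκ)
  have := hK κ ((le_max_left _ _).trans hκ)
  rw [le_div_iff₀ hκ0]
  simp only [Function.comp, pow_one] at this
  refine le_trans (le_of_eq ?_) this
  rw [show -κ * δ = -(δ * κ) by ring]
  field_simp

theorem exists_forall_integral_exp_neg_mul_sub_le {P R : ℝ → ℂ} (hP : IntegrableOn P (Icc 0 1))
    (hPR : P =ᵐ[volume.restrict (Icc 0 1)] R) (hR : ContinuousWithinAt R (Icc 0 1) 0)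
    {ε : ℝ} (hε : 0 < ε) :
    ∃ K > 0, ∀ κ ≥ K, ∫ t in Icc (0 : ℝ) 1, Real.exp (-κ * |0 - t|) * ‖P t - R 0‖ ≤ ε / κ := by
  obtain ⟨δ, hδ, hδR⟩ := Metric.continuousWithinAt_iff.1 hR (ε / 4) (by positivity)
  set N := ∫ t in Icc (0 : ℝ) 1, ‖P t - R 0‖ with hN
  have hi : IntegrableOn (fun t ↦ P t - R 0) (Icc 0 1) := hP.sub (by simp)
  obtain ⟨K, hK, hKN⟩ := exists_forall_mul_exp_neg_mul_le N hδ (half_pos hε)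
  refine ⟨K, hK, fun κ hκ ↦ ?_⟩
  have hκ0 : 0 < κ := lt_of_lt_of_le hK hκ
  have he : IntegrableOn (fun t ↦ Real.exp (-κ * |0 - t|)) (Icc (0 : ℝ) 1) :=
    Continuous.integrableOn_Icc (by fun_prop)
  calc _ ≤ ∫ t in Icc (0 : ℝ) 1,
        (ε / 4 * Real.exp (-κ * |0 - t|) + Real.exp (-κ * δ) * ‖P t - R 0‖) := by
        refine integral_mono_of_nonneg (Eventually.of_forall fun t ↦ by positivity)
          ((he.const_mul _).add (hi.norm.const_mul _)) ?_
        filter_upwards [hPR, ae_restrict_mem measurableSet_Icc] with t ht htI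
        rcases lt_or_ge t δ with h | h
        · have h1 := hδR htI (by simpa [abs_of_nonneg htI.1] using h)
          rw [dist_eq_norm, ← ht] at h1
          have h2 : 0 ≤ Real.exp (-κ * δ) * ‖P t - R 0‖ := by positivity
          have h3 := mul_le_mul_of_nonneg_left h1.le (Real.exp_pos (-κ * |0 - t|)).le
          linarith
        · have h1 : Real.exp (-κ * |0 - t|) ≤ Real.exp (-κ * δ) := by
            rw [zero_sub, abs_neg, abs_of_nonneg htI.1]
            refine Real.exp_le_exp.2 ?_
            nlinarith
          have h2 : 0 ≤ ε / 4 * Real.exp (-κ * |0 - t|) := by positivity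
          have h3 := mul_le_mul_of_nonneg_right h1 (norm_nonneg (P t - R 0))
          linarith
    _ = ε / 4 * (∫ t in Icc (0 : ℝ) 1, Real.exp (-κ * |0 - t|)) + Real.exp (-κ * δ) * N := by
        rw [integral_add (he.const_mul _) (hi.norm.const_mul _), integral_const_mul,
          integral_const_mul]
    _ ≤ ε / 4 * (2 / κ) + ε / 2 / κ := by
        refine add_le_add (mul_le_mul_of_nonneg_left (integral_exp_neg_mul_abs_sub_le hκ0 0)
          (by positivity)) ?_
        rw [mul_comm]
        exact hKN κ hκ
    _ = _ := by ring

theorem exists_forall_integral_exp_neg_mul_le {P R : ℝ → ℂ} (hP : IntegrableOn P (Icc 0 1))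
    (hPR : P =ᵐ[volume.restrict (Icc 0 1)] R) (hR : ContinuousWithinAt R (Icc 0 1) 0) :
    ∃ C > 0, ∃ K > 0, ∀ κ ≥ K,
      ∫ t in Icc (0 : ℝ) 1, Real.exp (-κ * |0 - t|) * ‖P t‖ ≤ C / κ := by
  obtain ⟨K, hK, h⟩ := exists_forall_integral_exp_neg_mul_sub_le hP hPR hR one_pos
  refine ⟨1 + ‖R 0‖ * 2, by positivity, K, hK, fun κ hκ ↦ ?_⟩
  have hκ0 : 0 < κ := lt_of_lt_of_le hK hκ
  have hi : IntegrableOn (fun t ↦ P t - R 0) (Icc 0 1) := hP.sub (by simp)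
  have he : IntegrableOn (fun t ↦ Real.exp (-κ * |0 - t|)) (Icc (0 : ℝ) 1) :=
    Continuous.integrableOn_Icc (by fun_prop)
  have hi' := integrableOn_exp_neg_mul_abs_mul (ρ := κ) (x := 0) hi.norm
  calc _ ≤ ∫ t in Icc (0 : ℝ) 1, (Real.exp (-κ * |0 - t|) * ‖P t - R 0‖ +
        ‖R 0‖ * Real.exp (-κ * |0 - t|)) := by
        refine integral_mono_of_nonneg (Eventually.of_forall fun t ↦ by positivity)
          (hi'.add (he.const_mul _)) (Eventually.of_forall fun t ↦ ?_)
        have h1 : ‖P t‖ ≤ ‖P t - R 0‖ + ‖R 0‖ := by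
          simpa using norm_add_le (P t - R 0) (R 0)
        have := mul_le_mul_of_nonneg_left h1 (Real.exp_pos (-κ * |0 - t|)).le
        simp only
        linarith
    _ = (∫ t in Icc (0 : ℝ) 1, Real.exp (-κ * |0 - t|) * ‖P t - R 0‖) +
        ‖R 0‖ * ∫ t in Icc (0 : ℝ) 1, Real.exp (-κ * |0 - t|) := by
        rw [integral_add hi' (he.const_mul _), integral_const_mul]
    _ ≤ 1 / κ + ‖R 0‖ * (2 / κ) := add_le_add (h κ hκ)
        (mul_le_mul_of_nonneg_left (integral_exp_neg_mul_abs_sub_le hκ0 0) (norm_nonneg _))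
    _ = _ := by ring

/-- First-order Laplace asymptotics `∫₀¹ e^{-mt} P(t) dt = P(0)/m + o(1/κ)`. -/
theorem exists_forall_norm_integral_exp_sub_le {P R : ℝ → ℂ} (hP : IntegrableOn P (Icc 0 1))
    (hPR : P =ᵐ[volume.restrict (Icc 0 1)] R) (hR : ContinuousWithinAt R (Icc 0 1) 0)
    {ε : ℝ} (hε : 0 < ε) :
    ∃ K > 0, ∀ κ ≥ K, ∀ m : ℂ, κ ≤ m.re →
      ‖(∫ t in (0 : ℝ)..1, Complex.exp (-m * t) * P t) - R 0 / m‖ ≤ ε / κ := by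
  obtain ⟨K, hK, h⟩ := exists_forall_integral_exp_neg_mul_sub_le hP hPR hR (half_pos hε)
  obtain ⟨K', hK', h'⟩ := exists_forall_mul_exp_neg_mul_le ‖R 0‖ one_pos (half_pos hε)
  refine ⟨max K (max K' 1), by positivity, fun κ hκ m hm ↦ ?_⟩
  have hκK : K ≤ κ := (le_max_left _ _).trans hκ
  have hκK' : K' ≤ κ := (le_max_left _ _).trans ((le_max_right _ _).trans hκ)
  have hκ1 : 1 ≤ κ := (le_max_right _ _).trans ((le_max_right _ _).trans hκ)
  have hm1 : 1 ≤ ‖m‖ := (hκ1.trans hm).trans (Complex.re_le_norm m)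
  have hm0 : m ≠ 0 := norm_pos_iff.1 (by linarith)
  have hi : IntegrableOn (fun t ↦ P t - R 0) (Icc 0 1) := hP.sub (by simp)
  have hii : IntervalIntegrable (fun t : ℝ ↦ Complex.exp (-m * t) * (P t - R 0)) volume 0 1 :=
    (intervalIntegrable_of_integrableOn_Icc hi).continuousOn_mul (by fun_prop)
  have hic : IntervalIntegrable (fun t : ℝ ↦ Complex.exp (-m * t) * R 0) volume 0 1 :=
    Continuous.intervalIntegrable (by fun_prop) _ _
  have e : (∫ t in (0 : ℝ)..1, Complex.exp (-m * t) * P t) - R 0 / m =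
      (∫ t in (0 : ℝ)..1, Complex.exp (-m * t) * (P t - R 0)) - Complex.exp (-m) * R 0 / m := by
    have e1 : (∫ t in (0 : ℝ)..1, Complex.exp (-m * t) * P t) =
        (∫ t in (0 : ℝ)..1, Complex.exp (-m * t) * (P t - R 0)) +
        ∫ t in (0 : ℝ)..1, Complex.exp (-m * t) * R 0 := by
      rw [← intervalIntegral.integral_add hii hic]
      congr 1
      ext t
      ring
    rw [e1, intervalIntegral.integral_mul_const, integral_exp_mul_complex (neg_ne_zero.2 hm0)]
    simp
    field_simp
    ring
  rw [e]
  have b1 : ‖∫ t in (0 : ℝ)..1, Complex.exp (-m * t) * (P t - R 0)‖ ≤ ε / 2 / κ := by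
    have := norm_integral_exp_mul_le (c := m) (ρ := κ) (x := 0) hi le_rfl zero_le_one le_rfl
      (fun t ht ↦ by
        rw [zero_sub, abs_neg, abs_of_pos ht.1]
        nlinarith [ht.1])
    refine le_trans (le_of_eq ?_) (this.trans (h κ hκK))
    congr 2
    ext t
    simp
  have b2 : ‖Complex.exp (-m) * R 0 / m‖ ≤ ε / 2 / κ := by
    refine le_trans ?_ (h' κ hκK')
    rw [norm_div, norm_mul, mul_one, Complex.norm_exp]
    have h3 : Real.exp (-m).re ≤ Real.exp (-κ) := by
      gcongr
      simpa using hm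
    calc _ ≤ Real.exp (-m).re * ‖R 0‖ := div_le_self (by positivity) hm1
      _ ≤ Real.exp (-κ) * ‖R 0‖ := by gcongr
      _ = _ := mul_comm _ _
  calc _ ≤ _ := norm_sub_le _ _
    _ ≤ ε / 2 / κ + ε / 2 / κ := add_le_add b1 b2
    _ = _ := by ring

/-- Deviation of the decaying component from a free exponential. -/
theorem SolvesSystem.norm_sub_exp_mul_le {c₁ c₂ : ℂ} {p q u v : ℝ → ℂ} {κ η : ℝ}
    (h : SolvesSystem c₁ c₂ p q 0 0 u v) (hκ : 0 ≤ κ)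
    (hc₁ : 2 * κ ≤ c₁.re) (hc₂ : c₂.re ≤ -(2 * κ))
    (hp : IntegrableOn p (Icc 0 1)) (hq : IntegrableOn q (Icc 0 1))
    (hpκ : ∀ x, ∫ t in Icc (0 : ℝ) 1, Real.exp (-κ * |x - t|) * ‖p t‖ ≤ 1 / 2)
    (hqκ : ∀ x, ∫ t in Icc (0 : ℝ) 1, Real.exp (-κ * |x - t|) * ‖q t‖ ≤ 1 / 2)
    (hqη : ∀ x, ∫ t in Icc (0 : ℝ) 1, Real.exp (-κ * |x - t|) * ‖q t‖ ≤ η) :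
    ∀ x ∈ Icc (0 : ℝ) 1, ‖v x - Complex.exp (c₂ * x) * v 0‖ ≤
      2 * η * (Real.exp (-κ * (1 - x)) * ‖u 1‖ + Real.exp (-κ * x) * ‖v 0‖) := by
  have hW := h.norm_le hκ hc₁ hc₂ hp hq hpκ hqκ
  set A := ‖u 1‖ with hA
  set B := ‖v 0‖ with hB
  obtain ⟨hu, hv, hu', hv'⟩ := h
  simp only [Pi.zero_apply, add_zero] at hu' hv'
  intro x hx
  refine (_root_.norm_sub_exp_mul_le hc₂ hv (integrableOn_mul_continuousOn hq hu) hv' x hx).trans ?_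
  have i1 := integrableOn_exp_neg_mul_abs_mul (ρ := κ) (x := x) hq.norm
  calc _ ≤ ∫ t in Icc (0 : ℝ) 1, (2 * (Real.exp (-κ * (1 - x)) * A + Real.exp (-κ * x) * B)) *
        (Real.exp (-κ * |x - t|) * ‖q t‖) := by
        refine integral_mono_of_nonneg (Eventually.of_forall fun t ↦ by positivity)
          (i1.const_mul _) ?_
        filter_upwards [ae_restrict_mem measurableSet_Icc] with t ht
        have e : -(2 * κ) * |x - t| = -κ * |x - t| + -κ * |x - t| := by ring
        have hWe : Real.exp (-κ * |x - t|) *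
            (Real.exp (-κ * (1 - t)) * A + Real.exp (-κ * t) * B) ≤
            Real.exp (-κ * (1 - x)) * A + Real.exp (-κ * x) * B := by
          rw [mul_add, ← mul_assoc, ← mul_assoc, ← Real.exp_add, ← Real.exp_add]
          gcongr
          · nlinarith [neg_abs_le (x - t)]
          · nlinarith [le_abs_self (x - t)]
        rw [e, Real.exp_add, norm_mul]
        calc _ = Real.exp (-κ * |x - t|) * ‖q t‖ * (Real.exp (-κ * |x - t|) * ‖u t‖) := by ring
          _ ≤ Real.exp (-κ * |x - t|) * ‖q t‖ * (Real.exp (-κ * |x - t|) *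
            (2 * (Real.exp (-κ * (1 - t)) * A + Real.exp (-κ * t) * B))) := by
            gcongr
            exact (hW t ht).1
          _ = Real.exp (-κ * |x - t|) * ‖q t‖ * (2 * (Real.exp (-κ * |x - t|) *
            (Real.exp (-κ * (1 - t)) * A + Real.exp (-κ * t) * B))) := by ring
          _ ≤ Real.exp (-κ * |x - t|) * ‖q t‖ *
            (2 * (Real.exp (-κ * (1 - x)) * A + Real.exp (-κ * x) * B)) := by gcongr
          _ = _ := by ring
    _ = (2 * (Real.exp (-κ * (1 - x)) * A + Real.exp (-κ * x) * B)) *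
        ∫ t in Icc (0 : ℝ) 1, Real.exp (-κ * |x - t|) * ‖q t‖ := integral_const_mul _ _
    _ ≤ (2 * (Real.exp (-κ * (1 - x)) * A + Real.exp (-κ * x) * B)) * η :=
        mul_le_mul_of_nonneg_left (hqη x) (by positivity)
    _ = _ := by ring

/-- If the off-diagonal coefficient `p` does not vanish at `0`, then the value of `v` at its stable
endpoint `0` is controlled, with a loss of one power of `κ`, by the value of `u` at its
unstable endpoint `0`. -/
theorem SolvesSystem.exists_forall_norm_zero_le {p q R : ℝ → ℂ} (hp : IntegrableOn p (Icc 0 1))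
    (hq : IntegrableOn q (Icc 0 1)) (hpR : p =ᵐ[volume.restrict (Icc 0 1)] R)
    (hR : ContinuousWithinAt R (Icc 0 1) 0) (hR0 : R 0 ≠ 0) {Λ : ℝ} (hΛ : 0 < Λ) :
    ∃ C > 0, ∃ K > 0, ∀ κ ≥ K, ∀ (c₁ c₂ : ℂ) (u v : ℝ → ℂ), 2 * κ ≤ c₁.re → c₂.re ≤ -(2 * κ) →
      ‖c₁ - c₂‖ ≤ Λ * κ → SolvesSystem c₁ c₂ p q 0 0 u v →
      ‖v 0‖ ≤ C * κ * (‖u 0‖ + Real.exp (-κ) * ‖u 1‖) := by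
  set s : ℝ := ‖R 0‖ / (4 * Λ) with hs
  have hs0 : 0 < s := div_pos (norm_pos_iff.2 hR0) (by positivity)
  obtain ⟨Cp, hCp, K₁, hK₁, h₁⟩ := exists_forall_integral_exp_neg_mul_le hp hpR hR
  obtain ⟨K₂, hK₂, h₂⟩ := exists_forall_norm_integral_exp_sub_le hp hpR hR hs0
  obtain ⟨K₃, hK₃, h₃⟩ := exists_forall_integral_exp_neg_mul_abs_le hp one_half_pos
  obtain ⟨K₄, hK₄, h₄⟩ := exists_forall_integral_exp_neg_mul_abs_le hq
    (ε := min (1 / 2) (s / (2 * Cp))) (by positivity)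
  refine ⟨(1 + s) / (2 * s), by positivity, max (max K₁ K₂) (max (max K₃ K₄) 1), by positivity,
    fun κ hκ c₁ c₂ u v hc₁ hc₂ hc h ↦ ?_⟩
  simp only [ge_iff_le, max_le_iff] at hκ
  obtain ⟨⟨hκ₁, hκ₂⟩, ⟨hκ₃, hκ₄⟩, hκ1⟩ := hκ
  have hκ0 : 0 < κ := by linarith
  set A := ‖u 1‖ with hA
  set B := ‖v 0‖ with hB
  set η := s / (2 * Cp) with hη
  have hη0 : 0 < η := by positivity
  obtain ⟨hu, hv, hu', hv'⟩ := id h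
  simp only [Pi.zero_apply, add_zero] at hu' hv'
  set r : ℝ → ℂ := fun t ↦ v t - Complex.exp (c₂ * t) * v 0 with hr
  have hrc : ContinuousOn r (Icc 0 1) := by fun_prop
  have hr_le : ∀ x ∈ Icc (0 : ℝ) 1,
      ‖r x‖ ≤ 2 * η * (Real.exp (-κ * (1 - x)) * A + Real.exp (-κ * x) * B) :=
    h.norm_sub_exp_mul_le hκ0.le hc₁ hc₂ hp hq (h₃ κ hκ₃)
      (fun x ↦ (h₄ κ hκ₄ x).trans (min_le_left _ _)) (fun x ↦ (h₄ κ hκ₄ x).trans (min_le_right _ _))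
  have hpr_le : ‖∫ t in (0 : ℝ)..1, Complex.exp (c₁ * ((0 : ℝ) - t)) * (p t * r t)‖ ≤
      s * (Real.exp (-κ) * A + B) / κ := by
    have i1 := integrableOn_exp_neg_mul_abs_mul (ρ := κ) (x := 0) hp.norm
    calc _ ≤ ∫ t in Icc (0 : ℝ) 1, Real.exp (-(2 * κ) * |0 - t|) * ‖p t * r t‖ := by
          refine norm_integral_exp_mul_le (integrableOn_mul_continuousOn hp hrc) le_rfl zero_le_one
            le_rfl fun t ht ↦ ?_
          rw [zero_sub, abs_neg, abs_of_pos ht.1]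
          nlinarith [ht.1]
      _ ≤ ∫ t in Icc (0 : ℝ) 1, (2 * η * (Real.exp (-κ) * A + B)) *
          (Real.exp (-κ * |0 - t|) * ‖p t‖) := by
          refine integral_mono_of_nonneg (Eventually.of_forall fun t ↦ by positivity)
            (i1.const_mul _) ?_
          filter_upwards [ae_restrict_mem measurableSet_Icc] with t ht
          rw [norm_mul, zero_sub, abs_neg, abs_of_nonneg ht.1]
          have e : -(2 * κ) * t = -κ * t + -κ * t := by ring
          have hWe : Real.exp (-κ * t) * (Real.exp (-κ * (1 - t)) * A + Real.exp (-κ * t) * B) ≤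
              Real.exp (-κ) * A + B := by
            rw [mul_add, ← mul_assoc, ← mul_assoc, ← Real.exp_add, ← Real.exp_add]
            refine add_le_add (le_of_eq ?_) (mul_le_of_le_one_left (norm_nonneg _) ?_)
            · ring_nf
            · rw [Real.exp_le_one_iff]
              nlinarith [ht.1]
          rw [e, Real.exp_add]
          calc _ = Real.exp (-κ * t) * ‖p t‖ * (Real.exp (-κ * t) * ‖r t‖) := by ring
            _ ≤ Real.exp (-κ * t) * ‖p t‖ * (Real.exp (-κ * t) *
              (2 * η * (Real.exp (-κ * (1 - t)) * A + Real.exp (-κ * t) * B))) := by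
              gcongr
              exact hr_le t ht
            _ = Real.exp (-κ * t) * ‖p t‖ * (2 * η * (Real.exp (-κ * t) *
              (Real.exp (-κ * (1 - t)) * A + Real.exp (-κ * t) * B))) := by ring
            _ ≤ Real.exp (-κ * t) * ‖p t‖ * (2 * η * (Real.exp (-κ) * A + B)) := by gcongr
            _ = _ := by ring
      _ = (2 * η * (Real.exp (-κ) * A + B)) *
          ∫ t in Icc (0 : ℝ) 1, Real.exp (-κ * |0 - t|) * ‖p t‖ := integral_const_mul _ _
      _ ≤ (2 * η * (Real.exp (-κ) * A + B)) * (Cp / κ) :=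
          mul_le_mul_of_nonneg_left (h₁ κ hκ₁) (by positivity)
      _ = _ := by
          rw [hη]
          field_simp
  set M := ∫ t in (0 : ℝ)..1, Complex.exp (-(c₁ - c₂) * t) * p t with hM
  have hm : κ ≤ (c₁ - c₂).re := by rw [Complex.sub_re]; linarith
  have hM_ge : 3 * s / κ ≤ ‖M‖ := by
    have h5 := h₂ κ hκ₂ (c₁ - c₂) hm
    have h6 : 4 * s / κ ≤ ‖R 0 / (c₁ - c₂)‖ := by
      rw [norm_div, hs, div_le_div_iff₀ hκ0 ((hκ0.trans_le hm).trans_le (Complex.re_le_norm _))]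
      have : 4 * (‖R 0‖ / (4 * Λ)) = ‖R 0‖ / Λ := by field_simp
      rw [this, div_mul_eq_mul_div, div_le_iff₀ hΛ]
      calc _ ≤ ‖R 0‖ * (Λ * κ) := by gcongr
        _ = _ := by ring
    have h7 := norm_sub_norm_le (R 0 / (c₁ - c₂)) M
    rw [norm_sub_rev] at h7
    have h8 : 4 * s / κ = 3 * s / κ + s / κ := by ring
    linarith
  have hu0 := eq_exp_mul_sub_integral hu (intervalIntegrable_of_integrableOn_Icc
    (integrableOn_mul_continuousOn hp hv)) hu' 0 (by simp)
  have hsplit : ∫ t in (0 : ℝ)..1, Complex.exp (c₁ * ((0 : ℝ) - t)) * (p t * v t) =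
      M * v 0 + ∫ t in (0 : ℝ)..1, Complex.exp (c₁ * ((0 : ℝ) - t)) * (p t * r t) := by
    rw [hM, ← intervalIntegral.integral_mul_const, ← intervalIntegral.integral_add]
    · refine intervalIntegral.integral_congr fun t _ ↦ ?_
      have : Complex.exp (-(c₁ - c₂) * t) =
          Complex.exp (c₁ * ((0 : ℝ) - t)) * Complex.exp (c₂ * t) := by
        rw [← Complex.exp_add]
        congr 1
        push_cast
        ring
      simp only [hr, this]
      ring
    · exact ((intervalIntegrable_of_integrableOn_Icc hp).continuousOn_mul (by fun_prop)).mul_const _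
    · exact (intervalIntegrable_of_integrableOn_Icc
        (integrableOn_mul_continuousOn hp hrc)).continuousOn_mul (by fun_prop)
  have hMB : ‖M‖ * B ≤ ‖u 0‖ + Real.exp (-κ) * A + s * (Real.exp (-κ) * A + B) / κ := by
    rw [hsplit] at hu0
    have e : M * v 0 = Complex.exp (c₁ * ((0 : ℝ) - 1)) * u 1 - u 0 -
        ∫ t in (0 : ℝ)..1, Complex.exp (c₁ * ((0 : ℝ) - t)) * (p t * r t) := by
      rw [hu0]
      ring
    rw [hB, ← norm_mul, e]
    have h9 : ‖Complex.exp (c₁ * ((0 : ℝ) - 1)) * u 1‖ ≤ Real.exp (-κ) * A := by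
      rw [norm_mul]
      gcongr
      refine (norm_exp_mul_le' hc₁ zero_le_one).trans ?_
      gcongr
      linarith
    calc _ ≤ ‖Complex.exp (c₁ * ((0 : ℝ) - 1)) * u 1‖ + ‖u 0‖ + _ :=
          (norm_sub_le _ _).trans (add_le_add_left (norm_sub_le _ _) _)
      _ ≤ Real.exp (-κ) * A + ‖u 0‖ + s * (Real.exp (-κ) * A + B) / κ := by gcongr
      _ = _ := by ring
  have hE : 0 ≤ Real.exp (-κ) * A := by positivity
  have hB0 : 0 ≤ B := norm_nonneg _
  have h10 : 3 * s / κ * B ≤ ‖M‖ * B := by gcongr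
  have h11 : 2 * s * B ≤ κ * ‖u 0‖ + (κ + s) * (Real.exp (-κ) * A) := by
    have h12 := mul_le_mul_of_nonneg_left (h10.trans hMB) hκ0.le
    have e1 : κ * (3 * s / κ * B) = 3 * s * B := by field_simp
    have e2 : κ * (‖u 0‖ + Real.exp (-κ) * A + s * (Real.exp (-κ) * A + B) / κ) =
        κ * ‖u 0‖ + κ * (Real.exp (-κ) * A) + s * (Real.exp (-κ) * A + B) := by field_simp
    rw [e1, e2] at h12
    linarith
  have h13 : (1 + s) / (2 * s) * κ * (‖u 0‖ + Real.exp (-κ) * A) =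
      ((1 + s) * κ * (‖u 0‖ + Real.exp (-κ) * A)) / (2 * s) := by ring
  rw [h13, le_div_iff₀ (by positivity)]
  have h14 : 0 ≤ s * κ * ‖u 0‖ := by positivity
  have h15 : s * (Real.exp (-κ) * A) ≤ s * κ * (Real.exp (-κ) * A) := by
    have : s ≤ s * κ := by nlinarith
    gcongr
  linarith

/-- The reflected system `x ↦ 1 - x`, with the roles of the components exchanged. -/
theorem SolvesSystem.reflect_swap {c₁ c₂ : ℂ} {p q u v : ℝ → ℂ}
    (h : SolvesSystem c₁ c₂ p q 0 0 u v) (hp : IntegrableOn p (Icc 0 1))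
    (hq : IntegrableOn q (Icc 0 1)) :
    SolvesSystem (-c₂) (-c₁) (fun x ↦ -q (1 - x)) (fun x ↦ -p (1 - x)) 0 0
      (fun x ↦ v (1 - x)) (fun x ↦ u (1 - x)) := by
  have := (h.reflect hp hq (by simp [Pi.zero_def]) (by simp [Pi.zero_def])).swap
  simpa only [Pi.zero_apply, neg_zero, ← Pi.zero_def] using this

theorem ae_comp_one_sub {P R : ℝ → ℂ} (h : P =ᵐ[volume.restrict (Icc (0 : ℝ) 1)] R) :
    (fun x ↦ P (1 - x)) =ᵐ[volume.restrict (Icc (0 : ℝ) 1)] fun x ↦ R (1 - x) := by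
  have h1 : MeasurePreserving (fun x : ℝ ↦ 1 - x) (volume.restrict (Icc 0 1))
      (volume.restrict (Icc 0 1)) := by
    have := (Measure.measurePreserving_sub_left (volume : Measure ℝ) 1).restrict_preimage
      (s := Icc 0 1) measurableSet_Icc
    simpa using this
  exact h1.quasiMeasurePreserving.ae_eq_comp h

theorem SolvesSystem.exists_forall_norm_one_le {p q R : ℝ → ℂ} (hp : IntegrableOn p (Icc 0 1))
    (hq : IntegrableOn q (Icc 0 1)) (hqR : q =ᵐ[volume.restrict (Icc 0 1)] R)
    (hR : ContinuousWithinAt R (Icc 0 1) 1) (hR0 : R 1 ≠ 0) {Λ : ℝ} (hΛ : 0 < Λ) :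
    ∃ C > 0, ∃ K > 0, ∀ κ ≥ K, ∀ (c₁ c₂ : ℂ) (u v : ℝ → ℂ), 2 * κ ≤ c₁.re → c₂.re ≤ -(2 * κ) →
      ‖c₁ - c₂‖ ≤ Λ * κ → SolvesSystem c₁ c₂ p q 0 0 u v →
      ‖u 1‖ ≤ C * κ * (‖v 1‖ + Real.exp (-κ) * ‖v 0‖) := by
  have hR' : ContinuousWithinAt (fun x ↦ -R (1 - x)) (Icc 0 1) 0 := by
    refine ContinuousWithinAt.neg (ContinuousWithinAt.comp (t := Icc 0 1) (by simpa using hR)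
      (by fun_prop) fun x hx ↦ ⟨by linarith [hx.2], by linarith [hx.1]⟩)
  obtain ⟨C, hC, K, hK, h⟩ := SolvesSystem.exists_forall_norm_zero_le
    (integrableOn_comp_one_sub hq).neg (integrableOn_comp_one_sub hp).neg
    (ae_comp_one_sub hqR).neg hR' (by simpa using hR0) hΛ
  refine ⟨C, hC, K, hK, fun κ hκ c₁ c₂ u v hc₁ hc₂ hc hs ↦ ?_⟩
  have := h κ hκ (-c₂) (-c₁) _ _ (by simpa using by linarith) (by simpa using hc₁)
    (by rwa [neg_sub_neg]) (hs.reflect_swap hp hq)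
  simpa using this

theorem exists_forall_add_le {C a b : ℝ} (hC : 0 ≤ C) (ha : 0 ≤ a) (hb : 0 ≤ b) (hab : a * b = 0) :
    ∃ D > 0, ∃ K > 0, ∀ κ ≥ K, ∀ A B P Q : ℝ, 0 ≤ A → 0 ≤ B → 0 ≤ P → 0 ≤ Q →
      A ≤ C * κ * (Q + (a + Real.exp (-κ)) * B) → B ≤ C * κ * (P + (b + Real.exp (-κ)) * A) →
      A + B ≤ D * κ ^ 2 * (P + Q) := by
  have h := (Real.tendsto_pow_mul_exp_neg_atTop_nhds_zero 2).const_mul (C ^ 2 * (a + b + 1))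
  rw [mul_zero] at h
  obtain ⟨K, hK⟩ := eventually_atTop.1 (h.eventually_le_const one_half_pos)
  refine ⟨2 * C + 2 * C ^ 2 * (a + b + 1) + 1, by positivity, max K 1, by positivity,
    fun κ hκ A B P Q hA hB hP hQ h1 h2 ↦ ?_⟩
  have hκ1 : 1 ≤ κ := (le_max_right _ _).trans hκ
  have hκK := hK κ ((le_max_left _ _).trans hκ)
  set e := Real.exp (-κ) with he
  have he0 : 0 < e := Real.exp_pos _
  have he1 : e ≤ 1 := Real.exp_le_one_iff.2 (by linarith)
  have hprod : (a + e) * (b + e) ≤ (a + b + 1) * e := by nlinarith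
  have hsmall : C ^ 2 * κ ^ 2 * ((a + e) * (b + e)) ≤ 1 / 2 := by
    calc _ ≤ C ^ 2 * κ ^ 2 * ((a + b + 1) * e) := by gcongr
      _ = C ^ 2 * (a + b + 1) * (κ ^ 2 * e) := by ring
      _ ≤ _ := hκK
  have hCκ : 0 ≤ C * κ := by positivity
  have hae : 0 ≤ a + e := by positivity
  have hbe : 0 ≤ b + e := by positivity
  have hA' : A ≤ C * κ * Q + C ^ 2 * κ ^ 2 * ((a + e) * P) + A / 2 := by
    calc A ≤ C * κ * (Q + (a + e) * B) := h1
      _ ≤ C * κ * (Q + (a + e) * (C * κ * (P + (b + e) * A))) := by gcongr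
      _ = C * κ * Q + C ^ 2 * κ ^ 2 * ((a + e) * P) + C ^ 2 * κ ^ 2 * ((a + e) * (b + e)) * A := by
        ring
      _ ≤ C * κ * Q + C ^ 2 * κ ^ 2 * ((a + e) * P) + 1 / 2 * A := by gcongr
      _ = _ := by ring
  have hB' : B ≤ C * κ * P + C ^ 2 * κ ^ 2 * ((b + e) * Q) + B / 2 := by
    calc B ≤ C * κ * (P + (b + e) * A) := h2
      _ ≤ C * κ * (P + (b + e) * (C * κ * (Q + (a + e) * B))) := by gcongr
      _ = C * κ * P + C ^ 2 * κ ^ 2 * ((b + e) * Q) + C ^ 2 * κ ^ 2 * ((a + e) * (b + e)) * B := by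
        ring
      _ ≤ C * κ * P + C ^ 2 * κ ^ 2 * ((b + e) * Q) + 1 / 2 * B := by gcongr
      _ = _ := by ring
  have hκ2 : κ ≤ κ ^ 2 := by nlinarith
  have g1 : C * κ * Q + C * κ * P ≤ C * κ ^ 2 * (P + Q) := by
    calc _ = C * κ * (P + Q) := by ring
      _ ≤ _ := by gcongr
  have g2 : C ^ 2 * κ ^ 2 * ((a + e) * P) ≤ C ^ 2 * κ ^ 2 * ((a + b + 1) * P) := by
    gcongr
    linarith
  have g3 : C ^ 2 * κ ^ 2 * ((b + e) * Q) ≤ C ^ 2 * κ ^ 2 * ((a + b + 1) * Q) := by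
    gcongr
    linarith
  have g4 : 0 ≤ κ ^ 2 * (P + Q) := by positivity
  linarith

/-- Polynomial bound for the boundary value problem in the half-plane where the decaying
endpoints of the components are not the ones appearing with nonzero coefficients. -/
theorem SolvesSystem.exists_forall_norm_le_sq {p q R S : ℝ → ℂ} {α β : ℂ} (hαβ : α * β = 0)
    (hp : IntegrableOn p (Icc 0 1)) (hq : IntegrableOn q (Icc 0 1))
    (hpR : p =ᵐ[volume.restrict (Icc 0 1)] R) (hR : ContinuousWithinAt R (Icc 0 1) 0)
    (hR0 : R 0 ≠ 0) (hqS : q =ᵐ[volume.restrict (Icc 0 1)] S)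
    (hS : ContinuousWithinAt S (Icc 0 1) 1) (hS1 : S 1 ≠ 0) {Λ : ℝ} (hΛ : 0 < Λ) :
    ∃ D > 0, ∃ K > 0, ∀ κ ≥ K, ∀ (c₁ c₂ : ℂ) (u v : ℝ → ℂ), 2 * κ ≤ c₁.re → c₂.re ≤ -(2 * κ) →
      ‖c₁ - c₂‖ ≤ Λ * κ → SolvesSystem c₁ c₂ p q 0 0 u v → ∀ x ∈ Icc (0 : ℝ) 1,
      ‖u x‖ ≤ D * κ ^ 2 * (‖u 0 + β * u 1‖ + ‖v 1 + α * v 0‖) ∧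
      ‖v x‖ ≤ D * κ ^ 2 * (‖u 0 + β * u 1‖ + ‖v 1 + α * v 0‖) := by
  obtain ⟨C₁, hC₁, K₁, hK₁, h₁⟩ := exists_forall_norm_zero_le hp hq hpR hR hR0 hΛ
  obtain ⟨C₂, hC₂, K₂, hK₂, h₂⟩ := exists_forall_norm_one_le hp hq hqS hS hS1 hΛ
  obtain ⟨D, hD, K₃, hK₃, h₃⟩ := exists_forall_add_le (C := max C₁ C₂) (by positivity)
    (norm_nonneg α) (norm_nonneg β) (by rw [← norm_mul, hαβ, norm_zero])
  obtain ⟨K₄, hK₄, h₄⟩ := exists_forall_integral_exp_neg_mul_abs_le hp one_half_pos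
  obtain ⟨K₅, hK₅, h₅⟩ := exists_forall_integral_exp_neg_mul_abs_le hq one_half_pos
  refine ⟨2 * D, by positivity, max (max K₁ K₂) (max K₃ (max K₄ K₅)), by positivity,
    fun κ hκ c₁ c₂ u v hc₁ hc₂ hc h ↦ ?_⟩
  simp only [ge_iff_le, max_le_iff] at hκ
  obtain ⟨⟨hκ₁, hκ₂⟩, hκ₃, hκ₄, hκ₅⟩ := hκ
  have hκ0 : 0 < κ := by linarith
  have hu0 : ‖u 0‖ ≤ ‖u 0 + β * u 1‖ + ‖β‖ * ‖u 1‖ := by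
    simpa using norm_sub_le (u 0 + β * u 1) (β * u 1)
  have hv1 : ‖v 1‖ ≤ ‖v 1 + α * v 0‖ + ‖α‖ * ‖v 0‖ := by
    simpa using norm_sub_le (v 1 + α * v 0) (α * v 0)
  have hB := h₁ κ hκ₁ c₁ c₂ u v hc₁ hc₂ hc h
  have hA := h₂ κ hκ₂ c₁ c₂ u v hc₁ hc₂ hc h
  have hAB := h₃ κ hκ₃ ‖u 1‖ ‖v 0‖ ‖u 0 + β * u 1‖ ‖v 1 + α * v 0‖ (by positivity) (by positivity)
    (by positivity) (by positivity)
    (hA.trans (mul_le_mul (by gcongr; exact le_max_right _ _) (by linarith) (by positivity)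
      (by positivity)))
    (hB.trans (mul_le_mul (by gcongr; exact le_max_left _ _) (by linarith) (by positivity)
      (by positivity)))
  have hW := h.norm_le hκ0.le hc₁ hc₂ hp hq (h₄ κ hκ₄) (h₅ κ hκ₅)
  intro x hx
  have hle : 2 * (Real.exp (-κ * (1 - x)) * ‖u 1‖ + Real.exp (-κ * x) * ‖v 0‖) ≤
      2 * D * κ ^ 2 * (‖u 0 + β * u 1‖ + ‖v 1 + α * v 0‖) := by
    have e1 : Real.exp (-κ * (1 - x)) ≤ 1 := Real.exp_le_one_iff.2 (by nlinarith [hx.2])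
    have e2 : Real.exp (-κ * x) ≤ 1 := Real.exp_le_one_iff.2 (by nlinarith [hx.1])
    have := mul_le_of_le_one_left (norm_nonneg (u 1)) e1
    have := mul_le_of_le_one_left (norm_nonneg (v 0)) e2
    linarith
  exact ⟨(hW x hx).1.trans hle, (hW x hx).2.trans hle⟩

/-- Bound for the boundary value problem in the half-plane where the boundary conditions
control the stable endpoints. -/
theorem SolvesSystem.exists_forall_norm_le_exp {p q : ℝ → ℂ} (α β : ℂ)
    (hp : IntegrableOn p (Icc 0 1)) (hq : IntegrableOn q (Icc 0 1)) :
    ∃ K > 0, ∀ κ ≥ K, ∀ (c₁ c₂ : ℂ) (u v : ℝ → ℂ), 2 * κ ≤ c₁.re → c₂.re ≤ -(2 * κ) →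
      SolvesSystem c₁ c₂ p q 0 0 u v → ∀ x ∈ Icc (0 : ℝ) 1,
      ‖u x‖ ≤ 4 * (Real.exp (-κ * (1 - x)) + Real.exp (-κ * x)) *
        (‖v 0 + β * v 1‖ + ‖u 1 + α * u 0‖) ∧
      ‖v x‖ ≤ 4 * (Real.exp (-κ * (1 - x)) + Real.exp (-κ * x)) *
        (‖v 0 + β * v 1‖ + ‖u 1 + α * u 0‖) := by
  set η : ℝ := 1 / (8 * (‖α‖ + ‖β‖ + 1)) with hη
  have hη0 : 0 < η := by positivity
  obtain ⟨K₁, hK₁, h₁⟩ := exists_forall_integral_exp_neg_mul_abs_le hp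
    (ε := min (1 / 2) η) (by positivity)
  obtain ⟨K₂, hK₂, h₂⟩ := exists_forall_integral_exp_neg_mul_abs_le hq
    (ε := min (1 / 2) η) (by positivity)
  obtain ⟨K₃, hK₃⟩ := eventually_atTop.1
    (Real.tendsto_exp_neg_atTop_nhds_zero.eventually_le_const hη0)
  refine ⟨max K₁ (max K₂ K₃), by positivity, fun κ hκ c₁ c₂ u v hc₁ hc₂ h ↦ ?_⟩
  simp only [ge_iff_le, max_le_iff] at hκ
  obtain ⟨hκ₁, hκ₂, hκ₃⟩ := hκ
  have hκ0 : 0 < κ := by linarith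
  have he := hK₃ κ hκ₃
  have hp1 := fun x ↦ (h₁ κ hκ₁ x).trans (min_le_left _ _)
  have hq1 := fun x ↦ (h₂ κ hκ₂ x).trans (min_le_left _ _)
  have key : ∀ (c₁ c₂ : ℂ) (p q u v : ℝ → ℂ), 2 * κ ≤ c₁.re → c₂.re ≤ -(2 * κ) →
      IntegrableOn p (Icc 0 1) → IntegrableOn q (Icc 0 1) →
      (∀ x, ∫ t in Icc (0 : ℝ) 1, Real.exp (-κ * |x - t|) * ‖p t‖ ≤ min (1 / 2) η) →
      (∀ x, ∫ t in Icc (0 : ℝ) 1, Real.exp (-κ * |x - t|) * ‖q t‖ ≤ min (1 / 2) η) →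
      SolvesSystem c₁ c₂ p q 0 0 u v → ‖v 1‖ ≤ 4 * η * (‖u 1‖ + ‖v 0‖) := by
    intro c₁ c₂ p q u v hc₁ hc₂ hp hq h₁ h₂ h
    have h5 := h.norm_sub_exp_mul_le hκ0.le hc₁ hc₂ hp hq (fun x ↦ (h₁ x).trans (min_le_left _ _))
      (fun x ↦ (h₂ x).trans (min_le_left _ _)) (fun x ↦ (h₂ x).trans (min_le_right _ _)) 1 (by simp)
    have h6 : ‖Complex.exp (c₂ * (1 : ℝ))‖ ≤ η := by
      refine (norm_exp_mul_le hc₂ zero_le_one).trans (le_trans ?_ he)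
      gcongr
      linarith
    have h7 : ‖v 1‖ ≤ ‖Complex.exp (c₂ * (1 : ℝ)) * v 0‖ +
        ‖v 1 - Complex.exp (c₂ * (1 : ℝ)) * v 0‖ := by
      simpa using norm_add_le (Complex.exp (c₂ * (1 : ℝ)) * v 0)
        (v 1 - Complex.exp (c₂ * (1 : ℝ)) * v 0)
    rw [norm_mul] at h7
    have h8 := mul_le_mul_of_nonneg_right h6 (norm_nonneg (v 0))
    have h9 : Real.exp (-κ * 1) * ‖v 0‖ ≤ ‖v 0‖ :=
      mul_le_of_le_one_left (norm_nonneg _) (Real.exp_le_one_iff.2 (by linarith))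
    have h10 : 2 * η * (Real.exp (-κ * (1 - 1)) * ‖u 1‖ + Real.exp (-κ * 1) * ‖v 0‖) ≤
        2 * η * (‖u 1‖ + ‖v 0‖) := by
      simp only [sub_self, mul_zero, Real.exp_zero, one_mul]
      gcongr
    have := mul_nonneg hη0.le (norm_nonneg (u 1))
    have := mul_nonneg hη0.le (norm_nonneg (v 0))
    linarith
  have hv1 := key c₁ c₂ p q u v hc₁ hc₂ hp hq (h₁ κ hκ₁) (h₂ κ hκ₂) h
  have hrefl : ∀ r : ℝ → ℂ, (∀ x, ∫ t in Icc (0 : ℝ) 1, Real.exp (-κ * |x - t|) * ‖r t‖ ≤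
      min (1 / 2) η) → ∀ x, ∫ t in Icc (0 : ℝ) 1, Real.exp (-κ * |x - t|) * ‖-r (1 - t)‖ ≤
      min (1 / 2) η := by
    intro r hr x
    refine le_trans (le_of_eq ?_) (hr (1 - x))
    rw [integral_Icc_eq_integral_Ioc, integral_Icc_eq_integral_Ioc,
      ← intervalIntegral.integral_of_le zero_le_one, ← intervalIntegral.integral_of_le zero_le_one]
    have := intervalIntegral.integral_comp_sub_left (a := 0) (b := 1)
      (fun t ↦ Real.exp (-κ * |1 - x - t|) * ‖r t‖) 1
    simp only [sub_self, sub_zero] at this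
    rw [← this]
    refine intervalIntegral.integral_congr fun t _ ↦ ?_
    have e : |1 - x - (1 - t)| = |x - t| := by
      rw [show 1 - x - (1 - t) = -(x - t) by ring, abs_neg]
    simp only [norm_neg, e]
  have hu0 := key (-c₂) (-c₁) _ _ _ _ (by simpa using by linarith) (by simpa using hc₁)
    (integrableOn_comp_one_sub hq).neg (integrableOn_comp_one_sub hp).neg
    (hrefl q (h₂ κ hκ₂)) (hrefl p (h₁ κ hκ₁)) (h.reflect_swap hp hq)
  simp only [sub_self, sub_zero] at hu0
  have hA : ‖u 1‖ ≤ ‖u 1 + α * u 0‖ + ‖α‖ * ‖u 0‖ := by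
    simpa using norm_sub_le (u 1 + α * u 0) (α * u 0)
  have hB : ‖v 0‖ ≤ ‖v 0 + β * v 1‖ + ‖β‖ * ‖v 1‖ := by
    simpa using norm_sub_le (v 0 + β * v 1) (β * v 1)
  have hAB : ‖u 1‖ + ‖v 0‖ ≤ 2 * (‖v 0 + β * v 1‖ + ‖u 1 + α * u 0‖) := by
    have h1 := mul_le_mul_of_nonneg_left hu0 (norm_nonneg α)
    have h2 := mul_le_mul_of_nonneg_left hv1 (norm_nonneg β)
    have h3 : 4 * η * (‖α‖ + ‖β‖) ≤ 1 / 2 := by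
      rw [hη, mul_one_div, div_mul_eq_mul_div, div_le_iff₀ (by positivity)]
      linarith
    have h4 := mul_le_mul_of_nonneg_right h3 (add_nonneg (norm_nonneg (u 1)) (norm_nonneg (v 0)))
    linarith
  intro x hx
  have hW := h.norm_le hκ0.le hc₁ hc₂ hp hq hp1 hq1 x hx
  have hle : 2 * (Real.exp (-κ * (1 - x)) * ‖u 1‖ + Real.exp (-κ * x) * ‖v 0‖) ≤
      4 * (Real.exp (-κ * (1 - x)) + Real.exp (-κ * x)) *
        (‖v 0 + β * v 1‖ + ‖u 1 + α * u 0‖) := by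
    calc _ ≤ 2 * ((Real.exp (-κ * (1 - x)) + Real.exp (-κ * x)) * (‖u 1‖ + ‖v 0‖)) := by
          have : 0 ≤ Real.exp (-κ * (1 - x)) * ‖v 0‖ := by positivity
          have : 0 ≤ Real.exp (-κ * x) * ‖u 1‖ := by positivity
          linarith
      _ ≤ 2 * ((Real.exp (-κ * (1 - x)) + Real.exp (-κ * x)) *
          (2 * (‖v 0 + β * v 1‖ + ‖u 1 + α * u 0‖))) := by gcongr
      _ = _ := by ring
  exact ⟨hW.1.trans hle, hW.2.trans hle⟩

/-- Integration over a disc centred at the origin in polar coordinates. -/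
theorem setIntegral_ball_zero_eq_integral_circleAverage {u : ℂ → ℝ} (hu : Continuous u) {R : ℝ}
    (hR : 0 ≤ R) :
    ∫ z in Metric.ball (0 : ℂ) R, u z
      = ∫ r in (0 : ℝ)..R, r * (2 * Real.pi * Real.circleAverage u 0 r) := by
  have hpi := Real.pi_pos
  rw [← integral_indicator Metric.isOpen_ball.measurableSet,
    ← Complex.integral_comp_polarCoord_symm]
  have hset : polarCoord.target = Ioi (0 : ℝ) ×ˢ Ioo (-Real.pi) Real.pi := rfl
  set F : ℝ × ℝ → ℝ := fun p => p.1 * u (circleMap 0 p.1 p.2) with hF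
  have hsymm : ∀ p : ℝ × ℝ, Complex.polarCoord.symm p = circleMap 0 p.1 p.2 := fun p => by
    rw [Complex.polarCoord_symm_apply, circleMap, Complex.exp_mul_I]
    simp
  have hFc : Continuous F := by
    refine continuous_fst.mul (hu.comp ?_)
    unfold circleMap
    fun_prop
  have hsub : (Ioo (0 : ℝ) R ×ˢ Ioo (-Real.pi) Real.pi) ⊆ Ioi (0 : ℝ) ×ˢ Ioo (-Real.pi) Real.pi :=
    prod_mono Ioo_subset_Ioi_self Subset.rfl
  have hmeas : MeasurableSet (Ioo (0 : ℝ) R ×ˢ Ioo (-Real.pi) Real.pi) :=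
    measurableSet_Ioo.prod measurableSet_Ioo
  have h1 : ∫ p in polarCoord.target,
      p.1 • (Metric.ball (0 : ℂ) R).indicator u (Complex.polarCoord.symm p)
      = ∫ p in Ioo (0 : ℝ) R ×ˢ Ioo (-Real.pi) Real.pi, F p := by
    rw [hset, ← integral_indicator (measurableSet_Ioi.prod measurableSet_Ioo),
      ← integral_indicator hmeas]
    congr 1
    ext p
    by_cases hp : p ∈ Ioi (0 : ℝ) ×ˢ Ioo (-Real.pi) Real.pi
    · rw [indicator_of_mem hp, hsymm]
      have hp0 : 0 < p.1 := hp.1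
      by_cases hpR : p.1 < R
      · rw [indicator_of_mem (show p ∈ Ioo (0 : ℝ) R ×ˢ Ioo (-Real.pi) Real.pi from
          ⟨⟨hp0, hpR⟩, hp.2⟩), indicator_of_mem]
        · rfl
        · simpa [abs_of_pos hp0] using hpR
      · rw [indicator_of_notMem, indicator_of_notMem (fun h => hpR h.1.2), smul_zero]
        simpa [abs_of_pos hp0] using hpR
    · rw [indicator_of_notMem hp, indicator_of_notMem (fun h => hp (hsub h))]
  rw [h1, Measure.volume_eq_prod, setIntegral_prod, intervalIntegral.integral_of_le hR,
    integral_Ioc_eq_integral_Ioo]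
  · refine setIntegral_congr_fun measurableSet_Ioo fun r _ => ?_
    simp only [hF]
    rw [Real.circleAverage_eq_integral_add (-Real.pi), integral_const_mul,
      intervalIntegral.integral_comp_add_right (fun θ => u (circleMap 0 r θ)),
      smul_eq_mul, mul_inv_cancel_left₀ (by positivity), zero_add,
      show 2 * Real.pi + -Real.pi = Real.pi by ring,
      intervalIntegral.integral_of_le (by linarith), integral_Ioc_eq_integral_Ioo]
  · rw [← Measure.volume_eq_prod]
    refine (hFc.continuousOn.integrableOn_compact
      ((isCompact_Icc (a := (0 : ℝ)) (b := R)).prod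
        (isCompact_Icc (a := -Real.pi) (b := Real.pi)))).mono_set ?_
    exact prod_mono Ioo_subset_Icc_self Ioo_subset_Icc_self

/-- Integration over a disc in polar coordinates. -/
theorem setIntegral_ball_eq_integral_circleAverage {u : ℂ → ℝ} (hu : Continuous u) (c : ℂ) {R : ℝ}
    (hR : 0 ≤ R) :
    ∫ z in Metric.ball c R, u z
      = ∫ r in (0 : ℝ)..R, r * (2 * Real.pi * Real.circleAverage u c r) := by
  have h := setIntegral_ball_zero_eq_integral_circleAverage
    (u := fun z => u (c + z)) (by fun_prop) hR
  have h1 : ∫ z in Metric.ball c R, u z = ∫ z in Metric.ball (0 : ℂ) R, u (c + z) := by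
    rw [← integral_indicator Metric.isOpen_ball.measurableSet,
      ← integral_indicator Metric.isOpen_ball.measurableSet,
      ← integral_add_left_eq_self _ c]
    congr 1
    ext z
    by_cases hz : z ∈ Metric.ball (0 : ℂ) R
    · rw [indicator_of_mem hz, indicator_of_mem]
      simpa using hz
    · rw [indicator_of_notMem hz, indicator_of_notMem]
      simpa using hz
  rw [h1, h]
  congr 1
  ext r
  congr 2
  simp only [Real.circleAverage, circleMap, zero_add]

/-- Sub-mean value property of `log ‖f‖`, with the positive part of the logarithm. -/
theorem log_norm_le_circleAverage_posLog {f : ℂ → ℂ} (hf : Differentiable ℂ f) {c : ℂ}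
    (hc : f c ≠ 0) {r : ℝ} (hr : 0 < r) :
    Real.log ‖f c‖ ≤ Real.circleAverage (fun z => Real.log ‖f z‖) c r := by
  have ha : AnalyticOnNhd ℂ f (Metric.closedBall c |r|) := fun z _ => hf.analyticAt z
  have hj := ha.circleAverage_log_norm hr.ne' hc
  rw [hj]
  have : 0 ≤ ∑ᶠ u, MeromorphicOn.divisor f (Metric.closedBall c |r|) u
      * Real.log (r * ‖c - u‖⁻¹) := by
    refine finsum_nonneg fun u => ?_
    by_cases hu : u ∈ Metric.closedBall c |r|
    · refine mul_nonneg ?_ ?_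
      · exact_mod_cast MeromorphicOn.AnalyticOnNhd.divisor_nonneg ha u
      · by_cases huc : u = c
        · simp [huc]
        · refine Real.log_nonneg ?_
          rw [← div_eq_mul_inv, one_le_div (by rw [norm_pos_iff, sub_ne_zero]; exact Ne.symm huc)]
          rw [Metric.mem_closedBall, dist_comm, dist_eq_norm, abs_of_pos hr] at hu
          exact hu
    · rw [Function.locallyFinsuppWithin.apply_eq_zero_of_notMem _ hu]
      simp
  linarith

theorem circleAverage_posLog_norm_le_of_mul {H Δ : ℂ → ℂ} (hH : Differentiable ℂ H)
    (hΔ : Differentiable ℂ Δ) (h0 : Δ 0 ≠ 0) {C : ℝ} (hC : 1 ≤ C)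
    (hΔC : ∀ z, ‖Δ z‖ ≤ C * Real.exp (C * ‖z‖))
    (hHC : ∀ z, ‖H z * Δ z‖ ≤ C * Real.exp (C * ‖z‖)) {r : ℝ} (hr : 0 < r) :
    Real.circleAverage (fun z => Real.posLog ‖H z‖) 0 r
      ≤ 2 * (Real.log C + C * r) - Real.log ‖Δ 0‖ := by
  have hlog : ∀ {w : ℂ} {z : ℂ}, ‖z‖ = r → ‖w‖ ≤ C * Real.exp (C * ‖z‖) →
      Real.posLog ‖w‖ ≤ Real.log C + C * r := by
    intro w z hz hw
    refine (Real.posLog_le_posLog (norm_nonneg _) hw).trans ?_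
    have h1 : 1 ≤ C * Real.exp (C * ‖z‖) := by
      have : 1 ≤ Real.exp (C * ‖z‖) := Real.one_le_exp (by positivity)
      nlinarith
    rw [Real.posLog_eq_log (h1.trans (le_abs_self _)), Real.log_mul (by positivity)
      (Real.exp_pos _).ne', Real.log_exp, hz]
  have hmer : MeromorphicOn (fun z => H z * Δ z * (Δ z)⁻¹) (Metric.sphere 0 |r|) := fun z _ =>
    ((hH.analyticAt z).meromorphicAt.mul (hΔ.analyticAt z).meromorphicAt).mul
      (hΔ.analyticAt z).meromorphicAt.inv
  have hmer' : MeromorphicOn Δ (Metric.sphere 0 |r|) := fun z _ =>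
    (hΔ.analyticAt z).meromorphicAt
  have hcongr : Real.circleAverage (fun z => Real.posLog ‖H z‖) 0 r
      = Real.circleAverage (fun z => Real.posLog ‖H z * Δ z * (Δ z)⁻¹‖) 0 r := by
    refine Real.circleAverage_congr_codiscreteWithin ?_ hr.ne'
    have hco := AnalyticOnNhd.preimage_zero_mem_codiscrete (𝕜 := ℂ) (f := Δ)
      (fun z _ => hΔ.analyticAt z) h0
    refine Filter.codiscreteWithin_mono (subset_univ _) ?_
    filter_upwards [hco] with z hz
    have hz' : Δ z ≠ 0 := by simpa using hz
    rw [mul_assoc, mul_inv_cancel₀ hz', mul_one]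
  have hint := hmer'.circleIntegrable_log_norm
  rw [hcongr]
  have hle := Real.circleAverage_mono (c := 0) (R := r)
    (f₁ := fun z => Real.posLog ‖H z * Δ z * (Δ z)⁻¹‖)
    (f₂ := fun z => 2 * (Real.log C + C * r) - Real.log ‖Δ z‖) hmer.circleIntegrable_posLog_norm
    ((circleIntegrable_const _ _ _).sub hint) (by
      intro z hz
      have hz' : ‖z‖ = r := by simpa [abs_of_pos hr] using hz
      have h1 := hlog hz' (hΔC z)
      have h2 := hlog hz' (hHC z)
      have h3 := Real.posLog_mul (x := ‖H z * Δ z‖) (y := ‖Δ z‖⁻¹)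
      have h4 := Real.posLog_sub_posLog_inv (x := ‖Δ z‖)
      rw [norm_mul _ (Δ z)⁻¹, norm_inv]
      linarith)
  refine hle.trans ?_
  rw [Real.circleAverage_fun_sub (circleIntegrable_const _ _ _) hint, Real.circleAverage_const]
  have := log_norm_le_circleAverage_posLog hΔ h0 hr
  linarith

theorem norm_le_exp_of_mul_of_ne_zero {H Δ : ℂ → ℂ} (hH : Differentiable ℂ H)
    (hΔ : Differentiable ℂ Δ) (h0 : Δ 0 ≠ 0) {C : ℝ} (hC : 1 ≤ C)
    (hΔC : ∀ z, ‖Δ z‖ ≤ C * Real.exp (C * ‖z‖))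
    (hHC : ∀ z, ‖H z * Δ z‖ ≤ C * Real.exp (C * ‖z‖)) (z : ℂ) :
    ‖H z‖ ≤ Real.exp (4 * (2 * (Real.log C + C * (2 * (‖z‖ + 1))) - Real.log ‖Δ 0‖)) := by
  set M := 2 * (Real.log C + C * (2 * (‖z‖ + 1))) - Real.log ‖Δ 0‖ with hM
  by_cases hz : H z = 0
  · simp [hz, (Real.exp_pos _).le]
  rw [← Real.log_le_iff_le_exp (norm_pos_iff.2 hz)]
  set R := ‖z‖ + 1 with hR
  have hR0 : 0 < R := by positivity
  set u : ℂ → ℝ := fun w => Real.posLog ‖H w‖ with hu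
  have huc : Continuous u := Real.continuous_posLog.comp (hH.continuous.norm)
  have hpi := Real.pi_pos
  have hav : ∀ c, Continuous fun r : ℝ => r * (2 * Real.pi * Real.circleAverage u c r) :=
    fun c => continuous_id.mul (continuous_const.mul (Real.Continuous.circleAverage huc))
  have hint : ∀ c' T : ℝ, ∫ r in (0 : ℝ)..T, r * (2 * Real.pi * c') = T ^ 2 * Real.pi * c' := by
    intro c' T
    rw [intervalIntegral.integral_mul_const, integral_id]
    ring
  have h1 : R ^ 2 * Real.pi * Real.log ‖H z‖ ≤ ∫ w in Metric.ball z R, u w := by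
    rw [setIntegral_ball_eq_integral_circleAverage huc z hR0.le, ← hint]
    refine intervalIntegral.integral_mono_on hR0.le
      ((continuous_id.mul continuous_const).intervalIntegrable _ _)
      ((hav z).intervalIntegrable _ _) fun r hr => ?_
    rcases hr.1.eq_or_lt with h | h
    · simp [← h]
    · refine mul_le_mul_of_nonneg_left (mul_le_mul_of_nonneg_left ?_ (by positivity)) h.le
      refine (log_norm_le_circleAverage_posLog hH hz h).trans ?_
      refine Real.circleAverage_mono ?_ ?_ fun w _ => le_max_right _ _
      · exact MeromorphicOn.circleIntegrable_log_norm
          fun w _ => (hH.analyticAt w).meromorphicAt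
      · exact MeromorphicOn.circleIntegrable_posLog_norm
          fun w _ => (hH.analyticAt w).meromorphicAt
  have h2 : ∫ w in Metric.ball z R, u w ≤ ∫ w in Metric.ball (0 : ℂ) (2 * R), u w := by
    refine setIntegral_mono_set ?_ ?_ ?_
    · exact (huc.continuousOn.integrableOn_compact
        (isCompact_closedBall _ _)).mono_set Metric.ball_subset_closedBall
    · exact Eventually.of_forall fun w => Real.posLog_nonneg
    · refine (Metric.ball_subset_ball' ?_).eventuallyLE
      rw [dist_zero_right, hR]
      linarith
  have h3 : ∫ w in Metric.ball (0 : ℂ) (2 * R), u w ≤ (2 * R) ^ 2 * Real.pi * M := by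
    rw [setIntegral_ball_eq_integral_circleAverage huc 0 (by positivity), ← hint]
    refine intervalIntegral.integral_mono_on (by positivity)
      ((hav 0).intervalIntegrable _ _)
      ((continuous_id.mul continuous_const).intervalIntegrable _ _) fun r hr => ?_
    rcases hr.1.eq_or_lt with h | h
    · simp [← h]
    · refine mul_le_mul_of_nonneg_left (mul_le_mul_of_nonneg_left ?_ (by positivity)) h.le
      refine (circleAverage_posLog_norm_le_of_mul hH hΔ h0 hC hΔC hHC h).trans ?_
      have : C * r ≤ C * (2 * R) := mul_le_mul_of_nonneg_left hr.2 (by linarith)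
      linarith
  have h4 : R ^ 2 * Real.pi * Real.log ‖H z‖ ≤ R ^ 2 * Real.pi * (4 * M) := by
    calc _ ≤ _ := (h1.trans h2).trans h3
      _ = _ := by ring
  exact le_of_mul_le_mul_left h4 (by positivity)

/-- The quotient of two entire functions of exponential type is of exponential type as soon as it
is entire. -/
theorem exists_norm_le_exp_of_mul {H Δ : ℂ → ℂ} (hH : Differentiable ℂ H)
    (hΔ : Differentiable ℂ Δ) (h0 : ∃ z, Δ z ≠ 0) {C : ℝ}
    (hΔC : ∀ z, ‖Δ z‖ ≤ C * Real.exp (C * ‖z‖))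
    (hHC : ∀ z, ‖H z * Δ z‖ ≤ C * Real.exp (C * ‖z‖)) :
    ∃ C', ∀ z, ‖H z‖ ≤ C' * Real.exp (C' * ‖z‖) := by
  obtain ⟨p, hp⟩ := h0
  have hC0 : 0 < C := by
    by_contra! hneg
    have := hΔC p
    have h1 : C * Real.exp (C * ‖p‖) ≤ 0 := mul_nonpos_of_nonpos_of_nonneg hneg (Real.exp_pos _).le
    exact hp (norm_le_zero_iff.1 (this.trans h1))
  set B := max 1 (C * Real.exp (C * ‖p‖)) with hB
  have hCB : C ≤ B := by
    refine le_trans ?_ (le_max_right _ _)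
    exact le_mul_of_one_le_right hC0.le (Real.one_le_exp (by positivity))
  have hshift : ∀ w : ℂ, C * Real.exp (C * ‖w + p‖) ≤ B * Real.exp (B * ‖w‖) := by
    intro w
    calc C * Real.exp (C * ‖w + p‖) ≤ C * Real.exp (C * ‖p‖ + C * ‖w‖) := by
          gcongr
          nlinarith [norm_add_le w p]
      _ = C * Real.exp (C * ‖p‖) * Real.exp (C * ‖w‖) := by rw [Real.exp_add]; ring
      _ ≤ _ := by
          gcongr
          exact le_max_right _ _
  have key := norm_le_exp_of_mul_of_ne_zero (H := fun w => H (w + p)) (Δ := fun w => Δ (w + p))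
    (hH.comp (differentiable_id.add_const p)) (hΔ.comp (differentiable_id.add_const p))
    (by simpa using hp) (C := B) (le_max_left _ _) (fun w => (hΔC _).trans (hshift w))
    (fun w => (hHC _).trans (hshift w))
  simp only [zero_add] at key
  have hB1 : 1 ≤ B := le_max_left _ _
  set A := 4 * (2 * (Real.log B + B * (2 * (‖p‖ + 1))) - Real.log ‖Δ p‖) with hA
  refine ⟨max (Real.exp A) (16 * B), fun z => ?_⟩
  have hz := key (z - p)
  rw [sub_add_cancel] at hz
  refine hz.trans ?_
  calc _ ≤ Real.exp (A + 16 * B * ‖z‖) := by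
        gcongr
        have := norm_sub_le z p
        rw [hA]
        nlinarith
    _ = Real.exp A * Real.exp (16 * B * ‖z‖) := Real.exp_add _ _
    _ ≤ _ := by
        gcongr
        · exact le_max_left _ _
        · exact le_max_right _ _

theorem differentiable_dslope {F : ℂ → ℂ} (hF : Differentiable ℂ F) (c : ℂ) :
    Differentiable ℂ (dslope F c) := by
  rw [← differentiableOn_univ] at hF ⊢
  exact (Complex.differentiableOn_dslope Filter.univ_mem).2 hF

/-- A function of exponential type bounded on the four bisecting half-lines of the coordinate axes
is bounded. -/
theorem exists_norm_le_of_bisectors {K : ℂ → ℂ} (hK : Differentiable ℂ K) {C : ℝ}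
    (hC : ∀ᶠ z in Bornology.cobounded ℂ, ‖K z‖ ≤ C * Real.exp (C * ‖z‖))
    (hray : ∀ d : ℂ, |d.re| = 1 → |d.im| = 1 → ∃ B, ∀ t : ℝ, 0 ≤ t → ‖K (t * d)‖ ≤ B) :
    ∃ B, ∀ z, ‖K z‖ ≤ B := by
  have hquad : ∀ d : ℂ, |d.re| = 1 → |d.im| = 1 →
      ∃ B, ∀ w : ℂ, 0 ≤ w.re → 0 ≤ w.im → ‖K (w * d)‖ ≤ B := by
    intro d hd1 hd2
    obtain ⟨B₁, hB₁⟩ := hray d hd1 hd2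
    obtain ⟨B₂, hB₂⟩ := hray (Complex.I * d) (by simpa using hd2) (by simpa using hd1)
    have hd0 : d ≠ 0 := by
      rintro rfl
      simp at hd1
    refine ⟨max B₁ B₂, fun w hw1 hw2 => ?_⟩
    refine PhragmenLindelof.quadrant_I (f := fun w => K (w * d)) (C := max B₁ B₂)
      (hK.comp (differentiable_id.mul_const d)).diffContOnCl
      ⟨1, one_lt_two, C * ‖d‖, ?_⟩ (fun x hx => (hB₁ x hx).trans (le_max_left _ _))
      (fun x hx => ?_) hw1 hw2
    · refine Asymptotics.IsBigO.of_bound C ?_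
      have ht : Tendsto (fun w : ℂ => w * d) (Bornology.cobounded ℂ) (Bornology.cobounded ℂ) := by
        rw [← tendsto_norm_atTop_iff_cobounded]
        simp only [norm_mul]
        exact tendsto_norm_cobounded_atTop.atTop_mul_const (norm_pos_iff.2 hd0)
      filter_upwards [(ht.eventually hC).filter_mono inf_le_left] with w hw
      rw [Real.norm_of_nonneg (Real.exp_pos _).le, Real.rpow_one]
      refine hw.trans (le_of_eq ?_)
      rw [norm_mul]
      ring_nf
    · rw [mul_assoc]
      exact (hB₂ x hx).trans (le_max_right _ _)
  obtain ⟨B₁, h₁⟩ := hquad (1 - Complex.I) (by simp) (by simp)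
  obtain ⟨B₂, h₂⟩ := hquad (Complex.I * (1 - Complex.I)) (by simp) (by simp)
  obtain ⟨B₃, h₃⟩ := hquad (-(1 - Complex.I)) (by simp) (by simp)
  obtain ⟨B₄, h₄⟩ := hquad (-(Complex.I * (1 - Complex.I))) (by simp) (by simp)
  have hne : (1 - Complex.I) ≠ 0 := fun h => by
    have := congrArg Complex.re h
    simp at this
  refine ⟨max (max B₁ B₂) (max B₃ B₄), fun z => ?_⟩
  obtain ⟨w, rfl⟩ : ∃ w, w * (1 - Complex.I) = z := ⟨z / (1 - Complex.I), div_mul_cancel₀ _ hne⟩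
  have hI := Complex.I_mul_I
  rcases le_total 0 w.re with hr | hr <;> rcases le_total 0 w.im with hi | hi
  · exact (h₁ w hr hi).trans (by simp)
  · have := h₄ (Complex.I * w) (by simpa using hi) (by simpa using hr)
    rw [show Complex.I * w * -(Complex.I * (1 - Complex.I))
      = -(Complex.I * Complex.I) * (w * (1 - Complex.I)) by ring, hI, neg_neg, one_mul] at this
    exact this.trans (by simp)
  · have := h₂ (-Complex.I * w) (by simpa using hi) (by simpa using hr)
    rw [show -Complex.I * w * (Complex.I * (1 - Complex.I))
      = -(Complex.I * Complex.I) * (w * (1 - Complex.I)) by ring, hI, neg_neg, one_mul] at this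
    exact this.trans (by simp)
  · have := h₃ (-w) (by simpa using hr) (by simpa using hi)
    rw [neg_mul_neg] at this
    exact this.trans (by simp)

/-- A function of exponential type which grows at most quadratically on the four bisecting
half-lines of the coordinate axes and tends to zero along one of them vanishes. -/
theorem eq_zero_of_bisectors {F : ℂ → ℂ} (hF : Differentiable ℂ F) {C : ℝ}
    (hC : ∀ z, ‖F z‖ ≤ C * Real.exp (C * ‖z‖))
    (hray : ∀ d : ℂ, |d.re| = 1 → |d.im| = 1 →
      ∃ D : ℝ, ∀ᶠ t : ℝ in atTop, ‖F (t * d)‖ ≤ D * t ^ 2)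
    {d₀ : ℂ} (hd₀ : d₀ ≠ 0) (hlim : Tendsto (fun t : ℝ => F (t * d₀)) atTop (nhds 0)) (z : ℂ) :
    F z = 0 := by
  set G := dslope F 0 with hG
  set K := dslope G 0 with hKdef
  have hGd : Differentiable ℂ G := differentiable_dslope hF 0
  have hKd : Differentiable ℂ K := differentiable_dslope hGd 0
  have hFG : ∀ z, F z = F 0 + z * G z := fun z => by
    have := sub_smul_dslope F 0 z
    rw [sub_zero, smul_eq_mul] at this
    rw [hG, this]
    ring
  have hGK : ∀ z, G z = G 0 + z * K z := fun z => by
    have := sub_smul_dslope G 0 z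
    rw [sub_zero, smul_eq_mul] at this
    rw [hKdef, this]
    ring
  have hFK : ∀ z, F z = F 0 + z * G 0 + z ^ 2 * K z := fun z => by
    rw [hFG z, hGK z]
    ring
  have hbound : ∀ z : ℂ, 1 ≤ ‖z‖ → ‖z‖ ^ 2 * ‖K z‖ ≤ ‖F z‖ + ‖F 0‖ + ‖z‖ * ‖G 0‖ := by
    intro z _
    rw [← norm_pow, ← norm_mul, show z ^ 2 * K z = F z - F 0 - z * G 0 by rw [hFK z]; ring]
    refine (norm_sub_le _ _).trans ?_
    rw [norm_mul]
    gcongr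
    exact norm_sub_le _ _
  have hC0 : 0 ≤ C := by
    by_contra! hneg
    have h1 := hC 0
    simp only [norm_zero, mul_zero, Real.exp_zero, mul_one] at h1
    linarith [norm_nonneg (F 0)]
  have hKb : ∃ B, ∀ z, ‖K z‖ ≤ B := by
    refine exists_norm_le_of_bisectors hKd (C := C + ‖F 0‖ + ‖G 0‖) ?_ fun d hd1 hd2 => ?_
    · filter_upwards [tendsto_norm_cobounded_atTop.eventually_ge_atTop 1] with z hz
      have h1 := hbound z hz
      have h2 := hC z
      set E := Real.exp ((C + ‖F 0‖ + ‖G 0‖) * ‖z‖) with hE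
      have hE1 : 1 ≤ E := Real.one_le_exp (by positivity)
      have hE2 : Real.exp (C * ‖z‖) ≤ E := by
        refine Real.exp_le_exp.2 ?_
        nlinarith [norm_nonneg (F 0), norm_nonneg (G 0), norm_nonneg z]
      have h3 : ‖F z‖ + ‖F 0‖ ≤ ‖z‖ ^ 2 * ((C + ‖F 0‖) * E) := by
        have : ‖F z‖ + ‖F 0‖ ≤ (C + ‖F 0‖) * E := by
          nlinarith [norm_nonneg (F 0), mul_le_mul_of_nonneg_left hE2 hC0]
        refine this.trans (le_mul_of_one_le_left (by positivity) (one_le_pow₀ hz))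
      have h4 : ‖z‖ * ‖G 0‖ ≤ ‖z‖ ^ 2 * (‖G 0‖ * E) := by
        have : ‖z‖ ≤ ‖z‖ ^ 2 := by nlinarith
        exact mul_le_mul this (le_mul_of_one_le_right (norm_nonneg _) hE1) (norm_nonneg _)
          (by positivity)
      have h5 : ‖z‖ ^ 2 * ‖K z‖ ≤ ‖z‖ ^ 2 * ((C + ‖F 0‖ + ‖G 0‖) * E) := by
        nlinarith
      exact le_of_mul_le_mul_left h5 (by positivity)
    · obtain ⟨D, hD⟩ := hray d hd1 hd2
      have hdn : 1 ≤ ‖d‖ := hd1 ▸ Complex.abs_re_le_norm d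
      obtain ⟨T, hT⟩ := eventually_atTop.1 (hD.and (eventually_ge_atTop 1))
      have hcont : ContinuousOn (fun t : ℝ => K (t * d)) (Icc 0 T) :=
        (hKd.continuous.comp (by fun_prop)).continuousOn
      obtain ⟨B, hB⟩ := isCompact_Icc.exists_bound_of_continuousOn hcont
      refine ⟨max B (D + ‖F 0‖ + ‖G 0‖), fun t ht => ?_⟩
      rcases le_total t T with h | h
      · exact (hB t ⟨ht, h⟩).trans (le_max_left _ _)
      · refine le_trans ?_ (le_max_right _ _)
        obtain ⟨h1, ht1⟩ := hT t h
        have hn : ‖(t : ℂ) * d‖ = t * ‖d‖ := by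
          rw [norm_mul, Complex.norm_real, Real.norm_of_nonneg ht]
        have hn1 : t ≤ ‖(t : ℂ) * d‖ := by rw [hn]; exact le_mul_of_one_le_right ht hdn
        have h2 := hbound (t * d) (ht1.trans hn1)
        set N := ‖(t : ℂ) * d‖
        have hN1 : 1 ≤ N := ht1.trans hn1
        have hD0 : 0 ≤ D := by
          by_contra! hneg
          have : D * t ^ 2 < 0 := mul_neg_of_neg_of_pos hneg (by positivity)
          linarith [norm_nonneg (F (t * d))]
        have h3 : D * t ^ 2 ≤ D * N ^ 2 := by gcongr
        have h4 : ‖F 0‖ ≤ N ^ 2 * ‖F 0‖ :=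
          le_mul_of_one_le_left (norm_nonneg _) (one_le_pow₀ hN1)
        have h5 : N * ‖G 0‖ ≤ N ^ 2 * ‖G 0‖ := by
          gcongr
          nlinarith
        have h6 : N ^ 2 * ‖K (t * d)‖ ≤ N ^ 2 * (D + ‖F 0‖ + ‖G 0‖) := by nlinarith
        exact le_of_mul_le_mul_left h6 (by positivity)
  obtain ⟨B, hB⟩ := hKb
  have hconst : ∀ z, K z = K 0 := fun z =>
    hKd.apply_eq_apply_of_bounded
      (isBounded_iff_forall_norm_le.2 ⟨B, by rintro _ ⟨w, rfl⟩; exact hB w⟩) z 0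
  have hpoly : ∀ z, F z = F 0 + z * G 0 + z ^ 2 * K 0 := fun z => by rw [hFK z, hconst z]
  have hinv : Tendsto (fun t : ℝ => ((t : ℂ) * d₀)⁻¹) atTop (nhds 0) := by
    have : Tendsto (fun t : ℝ => ‖((t : ℂ) * d₀)⁻¹‖) atTop (nhds 0) := by
      simp only [norm_inv, norm_mul, Complex.norm_real]
      exact (tendsto_norm_atTop_atTop.atTop_mul_const (norm_pos_iff.2 hd₀)).inv_tendsto_atTop
    exact tendsto_zero_iff_norm_tendsto_zero.2 this
  have hne : ∀ᶠ t : ℝ in atTop, (t : ℂ) * d₀ ≠ 0 := by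
    filter_upwards [eventually_gt_atTop 0] with t ht
    exact mul_ne_zero (by exact_mod_cast ht.ne') hd₀
  have hK0 : K 0 = 0 := by
    have h1 := ((hlim.mul hinv).mul hinv).sub
      (((hinv.const_mul (F 0)).mul hinv).add (hinv.const_mul (G 0)))
    simp only [mul_zero, add_zero, sub_zero] at h1
    refine tendsto_nhds_unique (tendsto_const_nhds.congr' ?_) h1
    filter_upwards [hne] with t ht
    rw [hpoly (t * d₀)]
    generalize (t : ℂ) * d₀ = s at ht
    field_simp
    ring
  have hG0 : G 0 = 0 := by
    have h1 := (hlim.mul hinv).sub (hinv.const_mul (F 0))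
    simp only [mul_zero, sub_zero] at h1
    refine tendsto_nhds_unique (tendsto_const_nhds.congr' ?_) h1
    filter_upwards [hne] with t ht
    rw [hpoly (t * d₀), hK0]
    generalize (t : ℂ) * d₀ = s at ht
    field_simp
    ring
  have hF0 : F 0 = 0 := by
    refine tendsto_nhds_unique (tendsto_const_nhds.congr' ?_) hlim
    filter_upwards with t
    rw [hpoly (t * d₀), hK0, hG0]
    ring
  rw [hpoly z, hK0, hG0, hF0]
  ring

/-- If the zeros of `Δ` are zeros of `G` with at least the same multiplicity, then `Δ` divides `G`
in the ring of entire functions. -/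
theorem exists_differentiable_eq_mul {G Δ : ℂ → ℂ} (hG : Differentiable ℂ G)
    (hΔ : Differentiable ℂ Δ) (h0 : ∃ z, Δ z ≠ 0)
    (hord : ∀ z, analyticOrderAt Δ z ≤ analyticOrderAt G z) :
    ∃ H : ℂ → ℂ, Differentiable ℂ H ∧ ∀ z, G z = H z * Δ z := by
  obtain ⟨p, hp⟩ := h0
  set f : ℂ → ℂ := fun z => G z * (Δ z)⁻¹ with hf
  have hmer : MeromorphicOn f univ := fun z _ =>
    (hG.analyticAt z).meromorphicAt.mul (hΔ.analyticAt z).meromorphicAt.inv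
  have htop : ∀ z, analyticOrderAt Δ z ≠ ⊤ := by
    intro z hz
    rw [analyticOrderAt_eq_top] at hz
    exact hp (AnalyticOnNhd.eqOn_zero_of_preconnected_of_eventuallyEq_zero
      (fun w _ => hΔ.analyticAt w) isPreconnected_univ (mem_univ z) hz (mem_univ p))
  have hne : ∀ z, ∀ᶠ w in nhdsWithin z {z}ᶜ, Δ w ≠ 0 := fun z =>
    (hΔ.analyticAt z).eventually_eq_zero_or_eventually_ne_zero.resolve_left
      (fun h => htop z (analyticOrderAt_eq_top.2 h))
  have hnonneg : ∀ z, 0 ≤ meromorphicOrderAt f z := by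
    intro z
    obtain ⟨n, hn⟩ := ENat.ne_top_iff_exists.1 (htop z)
    obtain ⟨g₁, hg₁, hg₁z, hg₁e⟩ := (hΔ.analyticAt z).analyticOrderAt_eq_natCast.1 hn.symm
    obtain ⟨g₂, hg₂, hg₂e⟩ := (natCast_le_analyticOrderAt (hG.analyticAt z)).1
      (hn.trans_le (hord z))
    have : f =ᶠ[nhdsWithin z {z}ᶜ] fun w => g₂ w * (g₁ w)⁻¹ := by
      filter_upwards [hg₁e.filter_mono nhdsWithin_le_nhds, hg₂e.filter_mono nhdsWithin_le_nhds,
        self_mem_nhdsWithin] with w h1 h2 h3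
      have h4 : (w - z) ^ n ≠ 0 := pow_ne_zero _ (sub_ne_zero.2 h3)
      rw [hf]
      simp only [h1, h2, smul_eq_mul]
      rw [mul_inv, mul_mul_mul_comm, mul_inv_cancel₀ h4, one_mul]
    rw [meromorphicOrderAt_congr this]
    exact (hg₂.mul (hg₁.inv hg₁z)).meromorphicOrderAt_nonneg
  set H := toMeromorphicNFOn f univ with hH
  have hHa : ∀ z, AnalyticAt ℂ H z := fun z => by
    rw [← (meromorphicNFOn_toMeromorphicNFOn f univ
      (mem_univ z)).meromorphicOrderAt_nonneg_iff_analyticAt,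
      meromorphicOrderAt_toMeromorphicNFOn hmer (mem_univ z)]
    exact hnonneg z
  refine ⟨H, fun z => (hHa z).differentiableAt, fun z => ?_⟩
  have h1 : (fun w => H w * Δ w) =ᶠ[nhdsWithin z {z}ᶜ] G := by
    filter_upwards [hmer.toMeromorphicNFOn_eq_self_on_nhdsNE (mem_univ z), hne z] with w h2 h3
    rw [hH, h2]
    change G w * (Δ w)⁻¹ * Δ w = G w
    rw [mul_assoc, inv_mul_cancel₀ h3, mul_one]
  have h2 := (ContinuousAt.eventuallyEq_nhds_iff_eventuallyEq_nhdsNE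
    ((hHa z).continuousAt.mul hΔ.continuous.continuousAt) hG.continuous.continuousAt).1 h1
  exact h2.eq_of_nhds.symm

section Chains

variable {X : Type*} [NormedAddCommGroup X] [NormedSpace ℂ X] [CompleteSpace X]

theorem differentiable_iteratedDeriv {w : ℂ → X} (hw : Differentiable ℂ w) (k : ℕ) :
    Differentiable ℂ (iteratedDeriv k w) := by
  induction k with
  | zero => simpa using hw
  | succ k ih =>
    rw [iteratedDeriv_succ]
    exact ih.deriv

theorem ContinuousLinearMap.iteratedDeriv_comp_apply {Y : Type*} [NormedAddCommGroup Y]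
    [NormedSpace ℂ Y] (l : X →L[ℂ] Y) {w : ℂ → X} (hw : Differentiable ℂ w) (k : ℕ) (z : ℂ) :
    iteratedDeriv k (fun z => l (w z)) z = l (iteratedDeriv k w z) := by
  induction k generalizing z with
  | zero => simp
  | succ k ih =>
    rw [iteratedDeriv_succ, iteratedDeriv_succ, funext ih]
    exact (l.hasFDerivAt.comp_hasDerivAt z
      (differentiable_iteratedDeriv hw k z).hasDerivAt).deriv

/-- Derivatives of a holomorphic family of null vectors of a linear pencil. -/
theorem pencil_iteratedDeriv {Y : Type*} [NormedAddCommGroup Y] [NormedSpace ℂ Y]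
    (N₀ N₁ : X →L[ℂ] Y) {w : ℂ → X} (hw : Differentiable ℂ w)
    (h : ∀ z, N₀ (w z) = z • N₁ (w z)) (k : ℕ) (z : ℂ) :
    N₀ (iteratedDeriv k w z) = z • N₁ (iteratedDeriv k w z)
      + (k : ℂ) • N₁ (iteratedDeriv (k - 1) w z) := by
  induction k generalizing z with
  | zero => simpa using h z
  | succ k ih =>
    have hd : ∀ j, HasDerivAt (iteratedDeriv j w) (iteratedDeriv (j + 1) w z) z := fun j => by
      rw [iteratedDeriv_succ]
      exact (differentiable_iteratedDeriv hw j z).hasDerivAt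
    have h0 := N₀.hasFDerivAt.comp_hasDerivAt z (hd k)
    have h1 := N₁.hasFDerivAt.comp_hasDerivAt z (hd k)
    have h2 := N₁.hasFDerivAt.comp_hasDerivAt z (hd (k - 1))
    have h3 := ((hasDerivAt_id z).smul h1).add (h2.const_smul (k : ℂ))
    have h4 := h3.congr_of_eventuallyEq (f₁ := N₀ ∘ iteratedDeriv k w)
      (Eventually.of_forall fun z => by simpa using ih z)
    have h5 := h0.unique h4
    rw [h5]
    rcases k with _ | k
    · simp
    · simp only [Nat.add_sub_cancel, Function.comp_apply, id, one_smul, Nat.cast_add, Nat.cast_one]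
      module

/-- Suppose that `ℓ` annihilates all chains of a linear pencil, subject to some linear conditions,
and that a holomorphic family `w` of null vectors of the pencil satisfies these conditions at the
zeros of `Δ`. Then `ℓ ∘ w` is divisible by `Δ`. -/
theorem exists_eq_mul_of_chains {Y ι : Type*} [NormedAddCommGroup Y] [NormedSpace ℂ Y]
    (N₀ N₁ : X →L[ℂ] Y) (U : ι → X →L[ℂ] ℂ) (l : X →L[ℂ] ℂ)
    (hl : ∀ (z : ℂ) (ch : ℕ → X) (m : ℕ), ch 0 ≠ 0 → N₀ (ch 0) = z • N₁ (ch 0) →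
      (∀ j < m, N₀ (ch (j + 1)) = z • N₁ (ch (j + 1)) + N₁ (ch j)) →
      (∀ j ≤ m, ∀ i, U i (ch j) = 0) → l (ch m) = 0)
    {w : ℂ → X} (hw : Differentiable ℂ w) (h : ∀ z, N₀ (w z) = z • N₁ (w z))
    {Δ : ℂ → ℂ} (hΔ : Differentiable ℂ Δ) (h0 : ∃ z, Δ z ≠ 0)
    {c : ι → ℂ} (hU : ∀ i z, U i (w z) = c i * Δ z) :
    ∃ H : ℂ → ℂ, Differentiable ℂ H ∧ ∀ z, l (w z) = H z * Δ z := by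
  have hlw : Differentiable ℂ fun z => l (w z) := l.differentiable.comp hw
  refine exists_differentiable_eq_mul hlw hΔ h0 fun z => ?_
  refine ENat.forall_natCast_le_iff_le.1 fun n hn => ?_
  rw [natCast_le_analyticOrderAt_iff_iteratedDeriv_eq_zero (hΔ.analyticAt z)] at hn
  rw [natCast_le_analyticOrderAt_iff_iteratedDeriv_eq_zero (hlw.analyticAt z)]
  intro k hk
  rw [l.iteratedDeriv_comp_apply hw]
  have hUz : ∀ j ≤ k, ∀ i, U i (iteratedDeriv j w z) = 0 := by
    intro j hj i
    rw [← (U i).iteratedDeriv_comp_apply hw, funext (hU i)]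
    have := (ContinuousLinearMap.mul ℂ ℂ (c i)).iteratedDeriv_comp_apply hΔ j z
    simp only [ContinuousLinearMap.mul_apply'] at this
    rw [this, hn j (by omega), mul_zero]
  classical
  by_cases hk0 : iteratedDeriv k w z = 0
  · rw [hk0, map_zero]
  have hex : ∃ j, iteratedDeriv j w z ≠ 0 := ⟨k, hk0⟩
  set s := Nat.find hex with hs
  have hsk : s ≤ k := Nat.find_min' hex hk0
  have hs0 : iteratedDeriv s w z ≠ 0 := Nat.find_spec hex
  have hsm : ∀ j < s, iteratedDeriv j w z = 0 := fun j hj => by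
    simpa using Nat.find_min hex hj
  have key := hl z (fun j => ((s + j).factorial : ℂ)⁻¹ • iteratedDeriv (s + j) w z) (k - s)
    (smul_ne_zero (inv_ne_zero (by exact_mod_cast (s + 0).factorial_ne_zero)) hs0) ?_ ?_ ?_
  · simp only [Nat.add_sub_cancel' hsk, map_smul, smul_eq_mul, mul_eq_zero, inv_eq_zero] at key
    exact key.resolve_left (by exact_mod_cast k.factorial_ne_zero)
  · have := pencil_iteratedDeriv N₀ N₁ hw h s z
    have hz : (s : ℂ) • N₁ (iteratedDeriv (s - 1) w z) = 0 := by
      rcases Nat.eq_zero_or_pos s with h' | h'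
      · rw [h', Nat.cast_zero, zero_smul]
      · rw [hsm (s - 1) (by omega), map_zero, smul_zero]
    rw [hz, add_zero] at this
    simp only [add_zero, map_smul, this]
    exact smul_comm _ _ _
  · intro j _
    have := pencil_iteratedDeriv N₀ N₁ hw h (s + j + 1) z
    rw [Nat.add_sub_cancel] at this
    have hfac : ((s + j + 1).factorial : ℂ)⁻¹ * ((s + j + 1 : ℕ) : ℂ)
        = ((s + j).factorial : ℂ)⁻¹ := by
      have h1 : ((s + j + 1 : ℕ) : ℂ) ≠ 0 := by exact_mod_cast (s + j).succ_ne_zero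
      rw [Nat.factorial_succ, Nat.cast_mul, mul_inv, mul_right_comm, inv_mul_cancel₀ h1, one_mul]
    simp only [← add_assoc, map_smul, this]
    rw [smul_add, smul_smul _ ((s + j + 1 : ℕ) : ℂ), hfac, smul_comm z]
  · intro j hj i
    rw [map_smul, hUz (s + j) (by omega) i, smul_zero]

end Chains

section Volterra

variable {p q : ℝ → ℂ}

/-- The primitive on the unit interval of the product of an integrable and a continuous
function. -/
def volterraFun (hp : IntegrableOn p (Icc 0 1)) (U : C(unitInterval, ℂ)) : C(unitInterval, ℂ) where
  toFun x := ∫ t in (0 : ℝ)..x, p t * IccExtend zero_le_one U t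
  continuous_toFun := by
    have hc : Continuous (IccExtend (zero_le_one (α := ℝ)) U) := U.continuous.Icc_extend'
    have hi : IntegrableOn (fun t => p t * IccExtend zero_le_one U t) (uIcc 0 1) := by
      rw [uIcc_of_le zero_le_one]
      exact hp.mul_continuousOn hc.continuousOn isCompact_Icc
    have := intervalIntegral.continuousOn_primitive_interval hi
    rw [uIcc_of_le zero_le_one] at this
    exact this.domRestrict

theorem integrableOn_mul_IccExtend (hp : IntegrableOn p (Icc 0 1)) (U : C(unitInterval, ℂ)) :
    IntegrableOn (fun t => p t * IccExtend (zero_le_one (α := ℝ)) U t) (Icc 0 1) :=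
  hp.mul_continuousOn (U.continuous.Icc_extend').continuousOn isCompact_Icc

theorem intervalIntegrable_mul_IccExtend (hp : IntegrableOn p (Icc 0 1)) (U : C(unitInterval, ℂ))
    (x : unitInterval) :
    IntervalIntegrable (fun t => p t * IccExtend (zero_le_one (α := ℝ)) U t) volume 0 x := by
  rw [intervalIntegrable_iff, uIoc_of_le x.2.1]
  exact (integrableOn_mul_IccExtend hp U).mono_set
    (Ioc_subset_Icc_self.trans (Icc_subset_Icc_right x.2.2))

theorem norm_volterraFun_apply_le (hp : IntegrableOn p (Icc 0 1)) (U : C(unitInterval, ℂ))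
    {N ε M : ℝ}
    (hε : ∀ x : ℝ, ∫ t in Icc (0 : ℝ) 1, Real.exp (-N * |x - t|) * ‖p t‖ ≤ ε) (hM : 0 ≤ M)
    (hU : ∀ x : unitInterval, Real.exp (-N * x) * ‖U x‖ ≤ M) (x : unitInterval) :
    Real.exp (-N * x) * ‖volterraFun hp U x‖ ≤ ε * M := by
  have hint := integrableOn_exp_neg_mul_abs_mul (ρ := N) (x := (x : ℝ)) hp.norm
  calc Real.exp (-N * x) * ‖volterraFun hp U x‖
      ≤ Real.exp (-N * x) * ∫ t in Ioc (0 : ℝ) x, ‖p t * IccExtend zero_le_one U t‖ := by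
        refine mul_le_mul_of_nonneg_left ?_ (Real.exp_pos _).le
        rw [← intervalIntegral.integral_of_le x.2.1]
        exact intervalIntegral.norm_integral_le_integral_norm x.2.1
    _ = ∫ t in Ioc (0 : ℝ) x, Real.exp (-N * x) * ‖p t * IccExtend zero_le_one U t‖ :=
        (integral_const_mul _ _).symm
    _ ≤ ∫ t in Ioc (0 : ℝ) x, Real.exp (-N * |x - t|) * ‖p t‖ * M := by
        refine setIntegral_mono_on ?_ ?_ measurableSet_Ioc fun t ht => ?_
        · exact ((intervalIntegrable_mul_IccExtend hp U x).1.norm).const_mul _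
        · exact (hint.mono_set
            (Ioc_subset_Icc_self.trans (Icc_subset_Icc_right x.2.2))).mul_const _
        · have ht' : t ∈ Icc (0 : ℝ) 1 := ⟨ht.1.le, ht.2.trans x.2.2⟩
          rw [norm_mul, IccExtend_of_mem _ _ ht', abs_of_nonneg (sub_nonneg.2 ht.2),
            show -N * (x : ℝ) = -N * (x - t) + -N * t by ring, Real.exp_add]
          have := mul_le_mul_of_nonneg_left (hU ⟨t, ht'⟩)
            (mul_nonneg (Real.exp_pos (-N * (x - t))).le (norm_nonneg (p t)))
          calc _ = Real.exp (-N * (x - t)) * ‖p t‖ * (Real.exp (-N * t) * ‖U ⟨t, ht'⟩‖) := by ring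
            _ ≤ _ := this
    _ = (∫ t in Ioc (0 : ℝ) x, Real.exp (-N * |x - t|) * ‖p t‖) * M := integral_mul_const _ _
    _ ≤ ε * M := by
        refine mul_le_mul_of_nonneg_right ((setIntegral_mono_set hint ?_ ?_).trans (hε x)) hM
        · exact Eventually.of_forall fun t => by positivity
        · exact (Ioc_subset_Icc_self.trans (Icc_subset_Icc_right x.2.2)).eventuallyLE

/-- The Volterra operator `U ↦ ∫ p U` on continuous functions. -/
def volterra (hp : IntegrableOn p (Icc 0 1)) : C(unitInterval, ℂ) →L[ℂ] C(unitInterval, ℂ) :=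
  LinearMap.mkContinuous
    { toFun := volterraFun hp
      map_add' := fun U V => by
        ext x
        change ∫ t in (0 : ℝ)..x, p t * IccExtend zero_le_one (⇑(U + V)) t
          = (∫ t in (0 : ℝ)..x, p t * IccExtend zero_le_one U t)
            + ∫ t in (0 : ℝ)..x, p t * IccExtend zero_le_one V t
        rw [← intervalIntegral.integral_add (intervalIntegrable_mul_IccExtend hp U x)
          (intervalIntegrable_mul_IccExtend hp V x)]
        exact intervalIntegral.integral_congr fun t _ => mul_add _ _ _
      map_smul' := fun a U => by
        ext x
        change ∫ t in (0 : ℝ)..x, p t * IccExtend zero_le_one (⇑(a • U)) t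
          = a * ∫ t in (0 : ℝ)..x, p t * IccExtend zero_le_one U t
        rw [← intervalIntegral.integral_const_mul]
        exact intervalIntegral.integral_congr fun t _ => mul_left_comm _ _ _ }
    (∫ t in Icc (0 : ℝ) 1, ‖p t‖) fun U => by
      have h0 : 0 ≤ ∫ t in Icc (0 : ℝ) 1, ‖p t‖ := integral_nonneg fun t => norm_nonneg _
      rw [ContinuousMap.norm_le _ (mul_nonneg h0 (norm_nonneg _))]
      intro x
      have := norm_volterraFun_apply_le hp U (N := 0) (ε := ∫ t in Icc (0 : ℝ) 1, ‖p t‖)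
        (by simp) (norm_nonneg U) (fun x => by simpa using U.norm_coe_le_norm x) x
      simpa using this

theorem volterra_apply (hp : IntegrableOn p (Icc 0 1)) (U : C(unitInterval, ℂ))
    (x : unitInterval) :
    volterra hp U x = ∫ t in (0 : ℝ)..x, p t * IccExtend zero_le_one U t := rfl

/-- Multiplication by `exp (-N x)` on continuous functions. -/
def expMul (N : ℝ) : C(unitInterval, ℂ) →L[ℂ] C(unitInterval, ℂ) :=
  ContinuousLinearMap.mul ℂ _ ⟨fun x => Complex.exp ((-N * (x : ℝ) : ℝ)), by fun_prop⟩

theorem norm_expMul_apply (N : ℝ) (U : C(unitInterval, ℂ)) (x : unitInterval) :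
    ‖expMul N U x‖ = Real.exp (-N * x) * ‖U x‖ := by
  change ‖Complex.exp ((-N * (x : ℝ) : ℝ)) * U x‖ = _
  rw [norm_mul, Complex.norm_exp, Complex.ofReal_re]

theorem expMul_comp_expMul_neg (N : ℝ) : (expMul N).comp (expMul (-N)) = 1 := by
  ext U x
  change Complex.exp ((-N * (x : ℝ) : ℝ)) * (Complex.exp ((-(-N) * (x : ℝ) : ℝ)) * U x) = U x
  rw [← mul_assoc, ← Complex.exp_add]
  simp

theorem norm_expMul_volterra_le (hp : IntegrableOn p (Icc 0 1)) (U : C(unitInterval, ℂ))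
    {N ε : ℝ} (hε0 : 0 ≤ ε)
    (hε : ∀ x : ℝ, ∫ t in Icc (0 : ℝ) 1, Real.exp (-N * |x - t|) * ‖p t‖ ≤ ε) :
    ‖expMul N (volterra hp U)‖ ≤ ε * ‖expMul N U‖ := by
  rw [ContinuousMap.norm_le _ (by positivity)]
  intro x
  rw [norm_expMul_apply]
  exact norm_volterraFun_apply_le hp U hε (norm_nonneg _)
    (fun x => by rw [← norm_expMul_apply]; exact (expMul N U).norm_coe_le_norm x) x

theorem norm_expMul_le {N : ℝ} (hN : 0 ≤ N) (U : C(unitInterval, ℂ)) : ‖expMul N U‖ ≤ ‖U‖ := by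
  rw [ContinuousMap.norm_le _ (norm_nonneg _)]
  intro x
  rw [norm_expMul_apply]
  refine (mul_le_of_le_one_left (norm_nonneg _) ?_).trans (U.norm_coe_le_norm x)
  rw [Real.exp_le_one_iff]
  nlinarith [x.2.1]

theorem norm_le_exp_mul_norm_expMul {N : ℝ} (hN : 0 ≤ N) (U : C(unitInterval, ℂ)) :
    ‖U‖ ≤ Real.exp N * ‖expMul N U‖ := by
  rw [ContinuousMap.norm_le _ (by positivity)]
  intro x
  have h1 := (expMul N U).norm_coe_le_norm x
  rw [norm_expMul_apply] at h1
  have h2 : Real.exp N * (Real.exp (-N * x) * ‖U x‖) ≤ Real.exp N * ‖expMul N U‖ := by gcongr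
  refine le_trans ?_ h2
  rw [← mul_assoc, ← Real.exp_add]
  refine le_mul_of_one_le_left (norm_nonneg _) (Real.one_le_exp ?_)
  nlinarith [x.2.2]

end Volterra

section VolterraFamily

theorem isUnit_one_sub_of_conj {X : Type*} [NormedAddCommGroup X] [NormedSpace ℂ X]
    [CompleteSpace X] {T E E' : X →L[ℂ] X} (h₁ : E * E' = 1) (h₂ : E' * E = 1)
    (h : ∀ y, ‖E (T y)‖ ≤ 1 / 2 * ‖E y‖) : IsUnit (1 - T) := by
  have hS : ‖E * T * E'‖ < 1 := by
    refine lt_of_le_of_lt (ContinuousLinearMap.opNorm_le_bound _ (M := 1 / 2) (by norm_num)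
      fun y => ?_) (by norm_num)
    have := h (E' y)
    rwa [show E (E' y) = y from congrArg (fun A : X →L[ℂ] X => A y) h₁] at this
  have hE : IsUnit E := ⟨⟨E, E', h₁, h₂⟩, rfl⟩
  have hmem : IsUnit E' := ⟨⟨E', E, h₂, h₁⟩, rfl⟩
  have : 1 - T = E' * (1 - E * T * E') * E := by
    calc 1 - T = E' * E - (E' * E) * T * (E' * E) := by rw [h₂]; simp
      _ = _ := by noncomm_ring
  rw [this]
  exact (hmem.mul (isUnit_one_sub_of_norm_lt_one hS)).mul hE

theorem differentiable_inverse_one_sub_apply {X : Type*} [NormedAddCommGroup X]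
    [NormedSpace ℂ X] [CompleteSpace X] {A B : X →L[ℂ] X}
    (h : ∀ z : ℂ, IsUnit (1 - (A + z • B))) (F : X) :
    Differentiable ℂ fun z : ℂ => Ring.inverse (1 - (A + z • B)) F := by
  intro z
  have hd : DifferentiableAt ℂ (fun z : ℂ => 1 - (A + z • B)) z :=
    (differentiableAt_const _).sub ((differentiableAt_const _).add
      (differentiableAt_id.smul_const _))
  exact ((differentiableAt_inverse (h z)).comp z hd).clm_apply (differentiableAt_const F)

variable {p q : ℝ → ℂ}

/-- The off-diagonal Volterra operator `(U, V) ↦ (∫ p V, ∫ q U)`. -/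
def volterraOffDiag (hp : IntegrableOn p (Icc 0 1)) (hq : IntegrableOn q (Icc 0 1)) :
    C(unitInterval, ℂ) × C(unitInterval, ℂ) →L[ℂ] C(unitInterval, ℂ) × C(unitInterval, ℂ) :=
  ((volterra hp).comp (ContinuousLinearMap.snd ℂ _ _)).prod
    ((volterra hq).comp (ContinuousLinearMap.fst ℂ _ _))

theorem integrableOn_const_Icc (c : ℂ) : IntegrableOn (fun _ : ℝ => c) (Icc 0 1) :=
  continuousOn_const.integrableOn_Icc

/-- The diagonal Volterra operator `(U, V) ↦ (c₁ ∫ U, c₂ ∫ V)`. -/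
def volterraDiag (c₁ c₂ : ℂ) :
    C(unitInterval, ℂ) × C(unitInterval, ℂ) →L[ℂ] C(unitInterval, ℂ) × C(unitInterval, ℂ) :=
  ((volterra (integrableOn_const_Icc c₁)).comp (ContinuousLinearMap.fst ℂ _ _)).prod
    ((volterra (integrableOn_const_Icc c₂)).comp (ContinuousLinearMap.snd ℂ _ _))

theorem integral_exp_neg_mul_abs_sub_mul_norm_le {N : ℝ} (hN : 0 < N) {c : ℂ} {M : ℝ}
    (hc : 8 * ‖c‖ * M ≤ N) (hM : 0 ≤ M) (x : ℝ) :
    M * ∫ t in Icc (0 : ℝ) 1, Real.exp (-N * |x - t|) * ‖c‖ ≤ 1 / 4 := by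
  rw [integral_mul_const]
  have h := integral_exp_neg_mul_abs_sub_le hN x
  calc _ ≤ M * (2 / N * ‖c‖) := by gcongr
    _ ≤ 1 / 4 := by
      rw [div_mul_eq_mul_div, mul_div_assoc', div_le_iff₀ hN]
      linarith

/-- The diagonal exponential weight. -/
def expMulProd (N : ℝ) :
    C(unitInterval, ℂ) × C(unitInterval, ℂ) →L[ℂ] C(unitInterval, ℂ) × C(unitInterval, ℂ) :=
  (expMul N).prodMap (expMul N)

theorem expMulProd_mul_neg (N : ℝ) : expMulProd N * expMulProd (-N) = 1 := by
  have h (U : C(unitInterval, ℂ)) : expMul N (expMul (-N) U) = U :=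
    congrArg (fun A : C(unitInterval, ℂ) →L[ℂ] C(unitInterval, ℂ) => A U)
      (expMul_comp_expMul_neg N)
  refine ContinuousLinearMap.ext fun Y => Prod.ext ?_ ?_
  · exact h Y.1
  · exact h Y.2

theorem exists_norm_expMulProd_le (hp : IntegrableOn p (Icc 0 1)) (hq : IntegrableOn q (Icc 0 1))
    (c₁ c₂ : ℂ) : ∃ N₀ > 0, ∀ (z : ℂ) (N : ℝ), N₀ + 8 * (‖c₁‖ + ‖c₂‖) * ‖z‖ ≤ N → ∀ Y,
      ‖expMulProd N ((volterraOffDiag hp hq + z • volterraDiag c₁ c₂) Y)‖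
        ≤ 1 / 2 * ‖expMulProd N Y‖ := by
  obtain ⟨N₁, hN₁, h₁⟩ := exists_forall_integral_exp_neg_mul_abs_le hp (ε := 1 / 4) (by norm_num)
  obtain ⟨N₂, hN₂, h₂⟩ := exists_forall_integral_exp_neg_mul_abs_le hq (ε := 1 / 4) (by norm_num)
  refine ⟨max N₁ N₂, lt_max_of_lt_left hN₁, fun z N hN Y => ?_⟩
  have hz : 0 ≤ 8 * (‖c₁‖ + ‖c₂‖) * ‖z‖ := by positivity
  have hNN₁ : N₁ ≤ N := by linarith [le_max_left N₁ N₂]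
  have hNN₂ : N₂ ≤ N := by linarith [le_max_right N₁ N₂]
  have hN0 : 0 < N := hN₁.trans_le hNN₁
  have hd (c : ℂ) (hc : ‖c‖ ≤ ‖c₁‖ + ‖c₂‖) (U : C(unitInterval, ℂ)) :
      ‖expMul N (z • volterra (integrableOn_const_Icc c) U)‖ ≤ 1 / 4 * ‖expMul N U‖ := by
    rw [map_smul, norm_smul]
    obtain h0 | h0 := (norm_nonneg z).eq_or_lt
    · rw [← h0, zero_mul]
      positivity
    · have := norm_expMul_volterra_le (integrableOn_const_Icc c) U (N := N)
        (ε := 1 / 4 / ‖z‖) (by positivity) fun x => by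
          rw [le_div_iff₀' h0]
          refine integral_exp_neg_mul_abs_sub_mul_norm_le hN0 ?_ h0.le x
          have := mul_le_mul_of_nonneg_right hc h0.le
          have := hN₁.trans_le (le_max_left N₁ N₂)
          nlinarith
      calc _ ≤ ‖z‖ * (1 / 4 / ‖z‖ * ‖expMul N U‖) := by gcongr
        _ = _ := by field_simp
  have e₁ := norm_expMul_volterra_le hp Y.2 (by norm_num) (h₁ N hNN₁)
  have e₂ := norm_expMul_volterra_le hq Y.1 (by norm_num) (h₂ N hNN₂)
  have e₃ := hd c₁ (by linarith [norm_nonneg c₂]) Y.1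
  have e₄ := hd c₂ (by linarith [norm_nonneg c₁]) Y.2
  have l₁ : ‖expMul N Y.1‖ ≤ ‖expMulProd N Y‖ := norm_fst_le (expMulProd N Y)
  have l₂ : ‖expMul N Y.2‖ ≤ ‖expMulProd N Y‖ := norm_snd_le (expMulProd N Y)
  refine max_le ?_ ?_
  · change ‖expMul N (volterra hp Y.2 + z • volterra (integrableOn_const_Icc c₁) Y.1)‖ ≤ _
    rw [map_add]
    refine (norm_add_le _ _).trans ?_
    linarith
  · change ‖expMul N (volterra hq Y.1 + z • volterra (integrableOn_const_Icc c₂) Y.2)‖ ≤ _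
    rw [map_add]
    refine (norm_add_le _ _).trans ?_
    linarith

theorem exists_differentiable_eq_add_volterra (hp : IntegrableOn p (Icc 0 1))
    (hq : IntegrableOn q (Icc 0 1)) (c₁ c₂ : ℂ) (F : C(unitInterval, ℂ) × C(unitInterval, ℂ)) :
    ∃ Y : ℂ → C(unitInterval, ℂ) × C(unitInterval, ℂ), Differentiable ℂ Y ∧
      (∀ z, Y z = F + (volterraOffDiag hp hq (Y z) + z • volterraDiag c₁ c₂ (Y z))) ∧
      ∃ C, ∀ z, ‖Y z‖ ≤ C * Real.exp (C * ‖z‖) := by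
  obtain ⟨N₀, hN₀, hN⟩ := exists_norm_expMulProd_le hp hq c₁ c₂
  set T : ℂ → (C(unitInterval, ℂ) × C(unitInterval, ℂ) →L[ℂ]
    C(unitInterval, ℂ) × C(unitInterval, ℂ)) :=
    fun z => volterraOffDiag hp hq + z • volterraDiag c₁ c₂ with hT
  set N : ℂ → ℝ := fun z => N₀ + 8 * (‖c₁‖ + ‖c₂‖) * ‖z‖ with hNdef
  have hNz (z : ℂ) : 0 ≤ N z := by positivity
  have hbd (z : ℂ) := hN z (N z) le_rfl
  have hunit (z : ℂ) : IsUnit (1 - T z) :=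
    isUnit_one_sub_of_conj (expMulProd_mul_neg (N z))
      (by simpa using expMulProd_mul_neg (-N z)) (hbd z)
  set Y := fun z => Ring.inverse (1 - T z) F with hY
  have heq (z : ℂ) : Y z = F + T z (Y z) := by
    have h := congrArg (fun A : C(unitInterval, ℂ) × C(unitInterval, ℂ) →L[ℂ]
      C(unitInterval, ℂ) × C(unitInterval, ℂ) => A F) (Ring.mul_inverse_cancel _ (hunit z))
    have h' : Y z - T z (Y z) = F := h
    rw [← h', sub_add_cancel]
  refine ⟨Y, ?_, heq, ?_⟩
  · exact differentiable_inverse_one_sub_apply hunit F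
  · have hYle (z : ℂ) : ‖Y z‖ ≤ 2 * Real.exp (N z) * ‖F‖ := by
      have h1 : ‖expMulProd (N z) (Y z)‖ ≤ ‖F‖ + 1 / 2 * ‖expMulProd (N z) (Y z)‖ := by
        have hF : ‖expMulProd (N z) F‖ ≤ ‖F‖ := max_le
          ((norm_expMul_le (hNz z) F.1).trans (norm_fst_le F))
          ((norm_expMul_le (hNz z) F.2).trans (norm_snd_le F))
        calc ‖expMulProd (N z) (Y z)‖ = ‖expMulProd (N z) F + expMulProd (N z) (T z (Y z))‖ := by
              rw [← map_add, ← heq z]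
          _ ≤ _ := (norm_add_le _ _).trans (add_le_add hF (hbd z _))
      have h2 : ‖Y z‖ ≤ Real.exp (N z) * ‖expMulProd (N z) (Y z)‖ := max_le
        ((norm_le_exp_mul_norm_expMul (hNz z) (Y z).1).trans (mul_le_mul_of_nonneg_left
          (norm_fst_le (expMulProd (N z) (Y z))) (Real.exp_pos _).le))
        ((norm_le_exp_mul_norm_expMul (hNz z) (Y z).2).trans (mul_le_mul_of_nonneg_left
          (norm_snd_le (expMulProd (N z) (Y z))) (Real.exp_pos _).le))
      have h3 : ‖expMulProd (N z) (Y z)‖ ≤ 2 * ‖F‖ := by linarith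
      calc _ ≤ Real.exp (N z) * (2 * ‖F‖) := h2.trans (by gcongr)
        _ = _ := by ring
    refine ⟨max (2 * Real.exp N₀ * ‖F‖) (8 * (‖c₁‖ + ‖c₂‖)), fun z => (hYle z).trans ?_⟩
    rw [hNdef]
    simp only
    rw [Real.exp_add]
    calc _ = 2 * Real.exp N₀ * ‖F‖ * Real.exp (8 * (‖c₁‖ + ‖c₂‖) * ‖z‖) := by ring
      _ ≤ _ := by
        gcongr
        · exact le_max_left _ _
        · exact le_max_right _ _

end VolterraFamily

section Pencil

variable {p q f g : ℝ → ℂ} {c₁ c₂ z : ℂ}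

/-- The operator `Y ↦ Y - Y(0) - (∫ p Y₂, ∫ q Y₁)`. -/
def volterraPencil (hp : IntegrableOn p (Icc 0 1)) (hq : IntegrableOn q (Icc 0 1)) :
    C(unitInterval, ℂ) × C(unitInterval, ℂ) →L[ℂ] C(unitInterval, ℂ) × C(unitInterval, ℂ) :=
  ContinuousLinearMap.id ℂ _ -
    (((ContinuousLinearMap.toSpanSingleton ℂ (1 : C(unitInterval, ℂ))).comp
      (ContinuousMap.evalCLM ℂ (0 : unitInterval))).prodMap
    ((ContinuousLinearMap.toSpanSingleton ℂ (1 : C(unitInterval, ℂ))).comp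
      (ContinuousMap.evalCLM ℂ (0 : unitInterval)))) - volterraOffDiag hp hq

theorem volterraPencil_fst_apply (hp : IntegrableOn p (Icc 0 1)) (hq : IntegrableOn q (Icc 0 1))
    (Y : C(unitInterval, ℂ) × C(unitInterval, ℂ)) (x : unitInterval) :
    (volterraPencil hp hq Y).1 x
      = Y.1 x - Y.1 0 - ∫ t in (0 : ℝ)..x, p t * IccExtend zero_le_one Y.2 t := by
  change Y.1 x - Y.1 0 * 1 - volterra hp Y.2 x = _
  rw [mul_one, volterra_apply]

theorem volterraPencil_snd_apply (hp : IntegrableOn p (Icc 0 1)) (hq : IntegrableOn q (Icc 0 1))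
    (Y : C(unitInterval, ℂ) × C(unitInterval, ℂ)) (x : unitInterval) :
    (volterraPencil hp hq Y).2 x
      = Y.2 x - Y.2 0 - ∫ t in (0 : ℝ)..x, q t * IccExtend zero_le_one Y.1 t := by
  change Y.2 x - Y.2 0 * 1 - volterra hq Y.1 x = _
  rw [mul_one, volterra_apply]

theorem integral_mul_IccExtend_add (hp : IntegrableOn p (Icc 0 1)) (hf : IntegrableOn f (Icc 0 1))
    (c : ℂ) (U V : C(unitInterval, ℂ)) (x : unitInterval) :
    ∫ t in (0 : ℝ)..x, (z * c * IccExtend zero_le_one U t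
        + (p t * IccExtend zero_le_one V t + f t))
      = z * (∫ t in (0 : ℝ)..x, c * IccExtend zero_le_one U t)
        + ((∫ t in (0 : ℝ)..x, p t * IccExtend zero_le_one V t) + ∫ t in (0 : ℝ)..x, f t) := by
  have hfx : IntervalIntegrable f volume 0 x :=
    (intervalIntegrable_of_integrableOn_Icc hf).mono_set
      (uIcc_subset_uIcc_left (by rw [uIcc_of_le zero_le_one]; exact x.2))
  have h1 := intervalIntegrable_mul_IccExtend (integrableOn_const_Icc c) U x
  have h2 := intervalIntegrable_mul_IccExtend hp V x
  rw [← intervalIntegral.integral_const_mul, ← intervalIntegral.integral_add h2 hfx,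
    ← intervalIntegral.integral_add (h1.const_mul z) (h2.add hfx)]
  simp only [mul_assoc]

theorem IccExtend_zero_one_apply (U : C(unitInterval, ℂ)) (x : unitInterval) :
    IccExtend (zero_le_one (α := ℝ)) U x = U x := IccExtend_val _ _ _

theorem volterraPencil_eq_iff (hp : IntegrableOn p (Icc 0 1)) (hq : IntegrableOn q (Icc 0 1))
    (hf : IntegrableOn f (Icc 0 1)) (hg : IntegrableOn g (Icc 0 1))
    {Y W : C(unitInterval, ℂ) × C(unitInterval, ℂ)}
    (hW₁ : ∀ x, W.1 x = ∫ t in (0 : ℝ)..x, f t) (hW₂ : ∀ x, W.2 x = ∫ t in (0 : ℝ)..x, g t) :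
    volterraPencil hp hq Y = z • volterraDiag c₁ c₂ Y + W ↔
      SolvesSystem (z * c₁) (z * c₂) p q f g (IccExtend zero_le_one Y.1)
        (IccExtend zero_le_one Y.2) := by
  have h0 (U : C(unitInterval, ℂ)) : IccExtend (zero_le_one (α := ℝ)) U 0 = U 0 :=
    IccExtend_zero_one_apply U 0
  have e₁ (x : unitInterval) : (z • volterraDiag c₁ c₂ Y + W).1 x
      = z * (∫ t in (0 : ℝ)..x, c₁ * IccExtend zero_le_one Y.1 t) + ∫ t in (0 : ℝ)..x, f t := by
    rw [← hW₁]; rfl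
  have e₂ (x : unitInterval) : (z • volterraDiag c₁ c₂ Y + W).2 x
      = z * (∫ t in (0 : ℝ)..x, c₂ * IccExtend zero_le_one Y.2 t) + ∫ t in (0 : ℝ)..x, g t := by
    rw [← hW₂]; rfl
  constructor
  · intro h
    refine ⟨(Y.1.continuous.Icc_extend').continuousOn, (Y.2.continuous.Icc_extend').continuousOn,
      fun x hx => ?_, fun x hx => ?_⟩
    · have h1 := volterraPencil_fst_apply hp hq Y ⟨x, hx⟩
      rw [h, e₁] at h1
      rw [h0, IccExtend_zero_one_apply Y.1 ⟨x, hx⟩,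
        integral_mul_IccExtend_add hp hf c₁ Y.1 Y.2 ⟨x, hx⟩]
      linear_combination -h1
    · have h1 := volterraPencil_snd_apply hp hq Y ⟨x, hx⟩
      rw [h, e₂] at h1
      rw [h0, IccExtend_zero_one_apply Y.2 ⟨x, hx⟩,
        integral_mul_IccExtend_add hq hg c₂ Y.2 Y.1 ⟨x, hx⟩]
      linear_combination -h1
  · rintro ⟨-, -, h1, h2⟩
    refine Prod.ext (ContinuousMap.ext fun x => ?_) (ContinuousMap.ext fun x => ?_)
    · have := h1 x x.2
      rw [h0, IccExtend_zero_one_apply, integral_mul_IccExtend_add hp hf c₁ Y.1 Y.2] at this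
      rw [e₁, volterraPencil_fst_apply, this]
      ring
    · have := h2 x x.2
      rw [h0, IccExtend_zero_one_apply, integral_mul_IccExtend_add hq hg c₂ Y.2 Y.1] at this
      rw [e₂, volterraPencil_snd_apply, this]
      ring

theorem volterraPencil_eq_smul_iff (hp : IntegrableOn p (Icc 0 1))
    (hq : IntegrableOn q (Icc 0 1)) {Y : C(unitInterval, ℂ) × C(unitInterval, ℂ)} :
    volterraPencil hp hq Y = z • volterraDiag c₁ c₂ Y ↔
      SolvesSystem (z * c₁) (z * c₂) p q 0 0 (IccExtend zero_le_one Y.1)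
        (IccExtend zero_le_one Y.2) := by
  rw [← volterraPencil_eq_iff hp hq (f := 0) (g := 0) (integrable_zero _ _ _)
    (integrable_zero _ _ _) (W := 0) (by simp) (by simp), add_zero]

theorem exists_differentiable_solvesSystem (hp : IntegrableOn p (Icc 0 1))
    (hq : IntegrableOn q (Icc 0 1)) (hf : IntegrableOn f (Icc 0 1))
    (hg : IntegrableOn g (Icc 0 1)) (c₁ c₂ a b : ℂ) :
    ∃ Y : ℂ → C(unitInterval, ℂ) × C(unitInterval, ℂ), Differentiable ℂ Y ∧
      (∀ z, (Y z).1 0 = a ∧ (Y z).2 0 = b ∧ SolvesSystem (z * c₁) (z * c₂) p q f g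
        (IccExtend zero_le_one (Y z).1) (IccExtend zero_le_one (Y z).2)) ∧
      ∃ C, ∀ z, ‖Y z‖ ≤ C * Real.exp (C * ‖z‖) := by
  set W : C(unitInterval, ℂ) × C(unitInterval, ℂ) := (volterra hf 1, volterra hg 1) with hW
  have hW₁ (x : unitInterval) : W.1 x = ∫ t in (0 : ℝ)..x, f t := by
    exact intervalIntegral.integral_congr fun t _ => mul_one _
  have hW₂ (x : unitInterval) : W.2 x = ∫ t in (0 : ℝ)..x, g t := by
    exact intervalIntegral.integral_congr fun t _ => mul_one _
  obtain ⟨Y, hYd, hY, C, hC⟩ := exists_differentiable_eq_add_volterra hp hq c₁ c₂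
    ((ContinuousMap.const _ a, ContinuousMap.const _ b) + W)
  have h₁ (z : ℂ) (x : unitInterval) : (Y z).1 x = a + (∫ t in (0 : ℝ)..x, f t)
      + ((∫ t in (0 : ℝ)..x, p t * IccExtend zero_le_one (Y z).2 t)
        + z * ∫ t in (0 : ℝ)..x, c₁ * IccExtend zero_le_one (Y z).1 t) := by
    rw [← hW₁]
    exact congrArg (fun A : C(unitInterval, ℂ) × C(unitInterval, ℂ) => A.1 x) (hY z)
  have h₂ (z : ℂ) (x : unitInterval) : (Y z).2 x = b + (∫ t in (0 : ℝ)..x, g t)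
      + ((∫ t in (0 : ℝ)..x, q t * IccExtend zero_le_one (Y z).1 t)
        + z * ∫ t in (0 : ℝ)..x, c₂ * IccExtend zero_le_one (Y z).2 t) := by
    rw [← hW₂]
    exact congrArg (fun A : C(unitInterval, ℂ) × C(unitInterval, ℂ) => A.2 x) (hY z)
  have ha (z : ℂ) : (Y z).1 0 = a := by simpa using h₁ z 0
  have hb (z : ℂ) : (Y z).2 0 = b := by simpa using h₂ z 0
  refine ⟨Y, hYd, fun z => ⟨ha z, hb z, (volterraPencil_eq_iff hp hq hf hg hW₁ hW₂).1 ?_⟩, C, hC⟩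
  refine Prod.ext (ContinuousMap.ext fun x => ?_) (ContinuousMap.ext fun x => ?_)
  · rw [volterraPencil_fst_apply, ha, h₁ z x, ← hW₁]
    change _ = z * (∫ t in (0 : ℝ)..x, c₁ * IccExtend zero_le_one (Y z).1 t) + W.1 x
    ring
  · rw [volterraPencil_snd_apply, hb, h₂ z x, ← hW₂]
    change _ = z * (∫ t in (0 : ℝ)..x, c₂ * IccExtend zero_le_one (Y z).2 t) + W.2 x
    ring

end Pencil

section Adjoint

variable {p q f g : ℝ → ℂ} {c₁ c₂ : ℂ}

theorem ae_eq_zero_of_forall_integral_eq_zero (hf : IntegrableOn f (Icc 0 1))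
    (h : ∀ x ∈ Icc (0 : ℝ) 1, ∫ t in (0 : ℝ)..x, f t = 0) :
    f =ᵐ[volume.restrict (Icc 0 1)] 0 := by
  rw [← restrict_Ioo_eq_restrict_Icc]
  refine (ae_restrict_iff' measurableSet_Ioo).2 ?_
  filter_upwards [(intervalIntegrable_of_integrableOn_Icc hf).ae_hasDerivAt_integral] with x hx hx'
  rw [uIcc_of_le zero_le_one] at hx
  have h1 := hx (Ioo_subset_Icc_self hx') 0 (left_mem_Icc.2 zero_le_one)
  have h2 : HasDerivAt (fun x => ∫ t in (0 : ℝ)..x, f t) 0 x := by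
    refine (hasDerivAt_const x (0 : ℂ)).congr_of_eventuallyEq ?_
    filter_upwards [isOpen_Ioo.mem_nhds hx'] with y hy
    exact h y (Ioo_subset_Icc_self hy)
  exact h1.unique h2

/-- Lagrange's identity. -/
theorem SolvesSystem.lagrange {u v z w : ℝ → ℂ} (h : SolvesSystem c₁ c₂ p q 0 0 u v)
    (hz : SolvesSystem (-c₁) (-c₂) (fun x => -q x) (fun x => -p x) (fun x => -f x)
      (fun x => -g x) z w)
    (hp : IntegrableOn p (Icc 0 1)) (hq : IntegrableOn q (Icc 0 1))
    (hf : IntegrableOn f (Icc 0 1)) (hg : IntegrableOn g (Icc 0 1)) :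
    (u 1 * z 1 + v 1 * w 1) + ((∫ t in (0 : ℝ)..1, f t * u t) + ∫ t in (0 : ℝ)..1, g t * v t)
      = u 0 * z 0 + v 0 * w 0 := by
  have hc {c : ℂ} {y : ℝ → ℂ} (hy : ContinuousOn y (Icc 0 1)) :
      IntervalIntegrable (fun t => c * y t) volume 0 1 :=
    ContinuousOn.intervalIntegrable (by rw [uIcc_of_le zero_le_one]; fun_prop)
  obtain ⟨hu, hv, hu', hv'⟩ := h
  obtain ⟨hzc, hwc, hz', hw'⟩ := hz
  have hiu := (hc (c := c₁) hu).add
    (SolvesSystem.intervalIntegrable (f := 0) hv hp (integrable_zero _ _ _))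
  have hiv := (hc (c := c₂) hv).add
    (SolvesSystem.intervalIntegrable (f := 0) hu hq (integrable_zero _ _ _))
  have hiz := (hc (c := -c₁) hzc).add (SolvesSystem.intervalIntegrable hwc hq.neg hf.neg)
  have hiw := (hc (c := -c₂) hwc).add (SolvesSystem.intervalIntegrable hzc hp.neg hg.neg)
  have h1 := mul_eq_integral_of_eq_integral hiu hiz hu' hz' 1 (right_mem_Icc.2 zero_le_one)
  have h2 := mul_eq_integral_of_eq_integral hiv hiw hv' hw' 1 (right_mem_Icc.2 zero_le_one)
  have hm {a y : ℝ → ℂ} (ha : IntervalIntegrable a volume 0 1) (hy : ContinuousOn y (Icc 0 1)) :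
      IntervalIntegrable (fun t => a t * y t) volume 0 1 :=
    ha.mul_continuousOn (by rwa [uIcc_of_le zero_le_one])
  have hm' {a y : ℝ → ℂ} (ha : IntervalIntegrable a volume 0 1) (hy : ContinuousOn y (Icc 0 1)) :
      IntervalIntegrable (fun t => y t * a t) volume 0 1 :=
    ha.continuousOn_mul (by rwa [uIcc_of_le zero_le_one])
  rw [h1, h2]
  have key := intervalIntegral.integral_add ((hm hiu hzc).add (hm' hiz hu))
    ((hm hiv hwc).add (hm' hiw hv))
  have key' := intervalIntegral.integral_add
    (hm (intervalIntegrable_of_integrableOn_Icc hf) hu)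
    (hm (intervalIntegrable_of_integrableOn_Icc hg) hv)
  rw [← key', add_add_add_comm, ← key]
  have : ∀ a b c d : ℂ, c = -d → a + c + d = a := by intro a b c d h; rw [h]; ring
  refine this _ 0 _ _ ?_
  rw [← intervalIntegral.integral_neg]
  refine intervalIntegral.integral_congr fun t _ => ?_
  simp only [Pi.zero_apply, Pi.neg_apply]
  ring

theorem SolvesSystem.exists_forall_norm_le_of_eq_zero (hp : IntegrableOn p (Icc 0 1))
    (hq : IntegrableOn q (Icc 0 1)) (hf : IntegrableOn f (Icc 0 1))
    (hg : IntegrableOn g (Icc 0 1)) {ε : ℝ} (hε : 0 < ε) :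
    ∃ K > 0, ∀ κ ≥ K, ∀ (c₁ c₂ : ℂ) (u v : ℝ → ℂ),
      (2 * κ ≤ c₁.re ∧ c₂.re ≤ -(2 * κ)) ∨ (2 * κ ≤ c₂.re ∧ c₁.re ≤ -(2 * κ)) →
      SolvesSystem c₁ c₂ p q f g u v → u 0 = 0 → v 0 = 0 → u 1 = 0 → v 1 = 0 →
      ∀ x ∈ Icc (0 : ℝ) 1, ‖u x‖ ≤ ε ∧ ‖v x‖ ≤ ε := by
  obtain ⟨K₁, hK₁, h₁⟩ := exists_forall_integral_exp_neg_mul_abs_le hp one_half_pos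
  obtain ⟨K₂, hK₂, h₂⟩ := exists_forall_integral_exp_neg_mul_abs_le hq one_half_pos
  obtain ⟨K₃, hK₃, h₃⟩ := exists_forall_integral_exp_neg_mul_abs_le hf (half_pos hε)
  obtain ⟨K₄, hK₄, h₄⟩ := exists_forall_integral_exp_neg_mul_abs_le hg (half_pos hε)
  refine ⟨max (max K₁ K₂) (max K₃ K₄), by positivity,
    fun κ hκ c₁ c₂ u v hc h hu0 hv0 hu1 hv1 x hx => ?_⟩
  simp only [ge_iff_le, max_le_iff] at hκ
  have hκ0 : 0 ≤ κ := hK₁.le.trans hκ.1.1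
  have h2 : 2 * (ε / 2) = ε := by ring
  rcases hc with hc | hc
  · have := h.norm_le_of_eq_zero hκ0 hc.1 hc.2 hp hq hf hg (half_pos hε).le (h₁ κ hκ.1.1)
      (h₂ κ hκ.1.2) (h₃ κ hκ.2.1) (h₄ κ hκ.2.2) hu1 hv0 x hx
    rwa [h2] at this
  · have := h.swap.norm_le_of_eq_zero hκ0 hc.1 hc.2 hq hp hg hf (half_pos hε).le (h₂ κ hκ.1.2)
      (h₁ κ hκ.1.1) (h₄ κ hκ.2.2) (h₃ κ hκ.2.1) hv1 hu0 x hx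
    rw [h2] at this
    exact this.symm

theorem re_ofReal_mul_mul_I_mul (t b : ℝ) (d : ℂ) :
    ((t : ℂ) * d * (Complex.I * b)).re = -b * t * d.im := by
  simp
  ring

theorem re_le_of_im_eq_one {b₁ b₂ t : ℝ} (ht : 0 ≤ t) {d : ℂ} (hd : d.im = 1) :
    2 * (min (-b₁) b₂ / 2 * t) ≤ ((t : ℂ) * d * (Complex.I * b₁)).re ∧
      ((t : ℂ) * d * (Complex.I * b₂)).re ≤ -(2 * (min (-b₁) b₂ / 2 * t)) := by
  rw [re_ofReal_mul_mul_I_mul, re_ofReal_mul_mul_I_mul, hd]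
  have h1 := mul_le_mul_of_nonneg_right (min_le_left (-b₁) b₂) ht
  have h2 := mul_le_mul_of_nonneg_right (min_le_right (-b₁) b₂) ht
  constructor <;> linarith

theorem re_le_of_im_eq_neg_one {b₁ b₂ t : ℝ} (ht : 0 ≤ t) {d : ℂ} (hd : d.im = -1) :
    2 * (min (-b₁) b₂ / 2 * t) ≤ ((t : ℂ) * d * (Complex.I * b₂)).re ∧
      ((t : ℂ) * d * (Complex.I * b₁)).re ≤ -(2 * (min (-b₁) b₂ / 2 * t)) := by
  rw [re_ofReal_mul_mul_I_mul, re_ofReal_mul_mul_I_mul, hd]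
  have h1 := mul_le_mul_of_nonneg_right (min_le_left (-b₁) b₂) ht
  have h2 := mul_le_mul_of_nonneg_right (min_le_right (-b₁) b₂) ht
  constructor <;> linarith

/-- A holomorphic family of solutions of exponential type that vanishes at both endpoints for
large spectral parameters on the bisectors comes from a vanishing inhomogeneity. -/
theorem SolvesSystem.ae_eq_zero_of_bisectors {b₁ b₂ : ℝ} (hb₁ : b₁ < 0) (hb₂ : 0 < b₂)
    (hp : IntegrableOn p (Icc 0 1)) (hq : IntegrableOn q (Icc 0 1))
    (hf : IntegrableOn f (Icc 0 1)) (hg : IntegrableOn g (Icc 0 1))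
    {Y : ℂ → C(unitInterval, ℂ) × C(unitInterval, ℂ)} (hY : Differentiable ℂ Y) {C : ℝ}
    (hC : ∀ z, ‖Y z‖ ≤ C * Real.exp (C * ‖z‖))
    (h : ∀ z, (Y z).1 0 = 0 ∧ (Y z).2 0 = 0 ∧
      SolvesSystem (z * (Complex.I * b₁)) (z * (Complex.I * b₂)) p q f g
        (IccExtend zero_le_one (Y z).1) (IccExtend zero_le_one (Y z).2))
    (hray : ∀ d : ℂ, |d.re| = 1 → |d.im| = 1 →
      ∀ᶠ t : ℝ in atTop, (Y (t * d)).1 1 = 0 ∧ (Y (t * d)).2 1 = 0) :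
    f =ᵐ[volume.restrict (Icc 0 1)] 0 ∧ g =ᵐ[volume.restrict (Icc 0 1)] 0 := by
  have hm : 0 < min (-b₁) b₂ / 2 := half_pos (lt_min (by linarith) hb₂)
  have hsmall (d : ℂ) (hre : |d.re| = 1) (him : |d.im| = 1) (ε : ℝ) (hε : 0 < ε) :
      ∀ᶠ t : ℝ in atTop, ∀ x, ‖(Y (t * d)).1 x‖ ≤ ε ∧ ‖(Y (t * d)).2 x‖ ≤ ε := by
    obtain ⟨K, hK, hKe⟩ := SolvesSystem.exists_forall_norm_le_of_eq_zero hp hq hf hg hε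
    filter_upwards [hray d hre him, eventually_ge_atTop 0,
      (tendsto_id.const_mul_atTop hm).eventually_ge_atTop K] with t ht ht0 htK x
    obtain ⟨h1, h2, h3⟩ := h (t * d)
    have := hKe _ htK _ _ _ _ ?_ h3 ((IccExtend_zero_one_apply _ 0).trans h1)
      ((IccExtend_zero_one_apply _ 0).trans h2) ((IccExtend_zero_one_apply _ 1).trans ht.1)
      ((IccExtend_zero_one_apply _ 1).trans ht.2) x x.2
    · rwa [IccExtend_zero_one_apply, IccExtend_zero_one_apply] at this
    · rcases eq_or_eq_neg_of_abs_eq him with hd | hd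
      · exact Or.inl (re_le_of_im_eq_one ht0 hd)
      · exact Or.inr (re_le_of_im_eq_neg_one ht0 hd)
  have hzero (L : C(unitInterval, ℂ) × C(unitInterval, ℂ) →L[ℂ] ℂ)
      (hL : ∀ V, ‖L V‖ ≤ ‖V‖)
      (hLs : ∀ d : ℂ, |d.re| = 1 → |d.im| = 1 → ∀ ε > 0, ∀ᶠ t : ℝ in atTop,
        ‖L (Y (t * d))‖ ≤ ε) (z : ℂ) : L (Y z) = 0 := by
    refine eq_zero_of_bisectors (F := fun z => L (Y z)) (L.differentiable.comp hY)
      (fun z => (hL _).trans (hC z)) (fun d h1 h2 => ⟨1, ?_⟩) (d₀ := ⟨1, 1⟩) ?_ ?_ z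
    · filter_upwards [hLs d h1 h2 1 one_pos, eventually_ge_atTop 1] with t ht ht1
      nlinarith
    · intro h0
      simpa using congrArg Complex.re h0
    · rw [Metric.tendsto_nhds]
      intro ε hε
      filter_upwards [hLs ⟨1, 1⟩ (by simp) (by simp) (ε / 2) (half_pos hε)] with t ht
      rw [dist_zero_right]
      linarith
  have hY1 (z : ℂ) (x : unitInterval) : (Y z).1 x = 0 :=
    hzero ((ContinuousMap.evalCLM ℂ x).comp (ContinuousLinearMap.fst ℂ _ _))
      (fun V => (V.1.norm_coe_le_norm x).trans (norm_fst_le V))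
      (fun d h1 h2 ε hε => (hsmall d h1 h2 ε hε).mono fun t ht => (ht x).1) z
  have hY2 (z : ℂ) (x : unitInterval) : (Y z).2 x = 0 :=
    hzero ((ContinuousMap.evalCLM ℂ x).comp (ContinuousLinearMap.snd ℂ _ _))
      (fun V => (V.2.norm_coe_le_norm x).trans (norm_snd_le V))
      (fun d h1 h2 ε hε => (hsmall d h1 h2 ε hε).mono fun t ht => (ht x).2) z
  obtain ⟨-, -, -, -, h3, h4⟩ := h 0
  have e1 (t : ℝ) : IccExtend (zero_le_one (α := ℝ)) (Y 0).1 t = 0 := hY1 0 _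
  have e2 (t : ℝ) : IccExtend (zero_le_one (α := ℝ)) (Y 0).2 t = 0 := hY2 0 _
  constructor
  · refine ae_eq_zero_of_forall_integral_eq_zero hf fun x hx => ?_
    simpa [e1, e2, hY1] using (h3 x hx).symm
  · refine ae_eq_zero_of_forall_integral_eq_zero hg fun x hx => ?_
    simpa [e1, e2, hY2] using (h4 x hx).symm

end Adjoint

section ExpBounded

/-- The function `F` grows at most exponentially. -/
def IsExpBounded {E : Type*} [NormedAddCommGroup E] (F : ℂ → E) : Prop :=
  ∃ C : ℝ, ∀ z, ‖F z‖ ≤ C * Real.exp (C * ‖z‖)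

theorem mul_exp_le_mul_exp_of_le {C C' r : ℝ} (hC : 0 ≤ C) (h : C ≤ C') (hr : 0 ≤ r) :
    C * Real.exp (C * r) ≤ C' * Real.exp (C' * r) := by
  gcongr
  exact hC.trans h

theorem IsExpBounded.exists_nonneg {E : Type*} [NormedAddCommGroup E] {F : ℂ → E}
    (hF : IsExpBounded F) : ∃ C : ℝ, 0 ≤ C ∧ ∀ C' ≥ C, ∀ z, ‖F z‖ ≤ C' * Real.exp (C' * ‖z‖) := by
  obtain ⟨C, hC⟩ := hF
  refine ⟨max C 0, le_max_right _ _, fun C' hC' z => (hC z).trans ?_⟩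
  have h0 : 0 ≤ C := by
    have := (norm_nonneg _).trans (hC z)
    exact nonneg_of_mul_nonneg_left this (Real.exp_pos _)
  exact mul_exp_le_mul_exp_of_le h0 ((le_max_left _ _).trans hC') (norm_nonneg z)

theorem IsExpBounded.smul {E : Type*} [NormedAddCommGroup E] [NormedSpace ℂ E] {F : ℂ → ℂ}
    {G : ℂ → E} (hF : IsExpBounded F) (hG : IsExpBounded G) :
    IsExpBounded fun z => F z • G z := by
  obtain ⟨A, hA0, hA⟩ := hF.exists_nonneg
  obtain ⟨B, hB0, hB⟩ := hG.exists_nonneg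
  refine ⟨max (A * B) (A + B), fun z => ?_⟩
  rw [norm_smul]
  calc ‖F z‖ * ‖G z‖ ≤ (A * Real.exp (A * ‖z‖)) * (B * Real.exp (B * ‖z‖)) := by
        gcongr
        · exact hA A le_rfl z
        · exact hB B le_rfl z
    _ = A * B * Real.exp ((A + B) * ‖z‖) := by rw [add_mul, Real.exp_add]; ring
    _ ≤ _ := by
      gcongr
      · exact le_max_left _ _
      · exact le_max_right _ _

theorem IsExpBounded.sub {E : Type*} [NormedAddCommGroup E] {F G : ℂ → E} (hF : IsExpBounded F)
    (hG : IsExpBounded G) : IsExpBounded fun z => F z - G z := by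
  obtain ⟨A, hA0, hA⟩ := hF.exists_nonneg
  obtain ⟨B, hB0, hB⟩ := hG.exists_nonneg
  refine ⟨A + B, fun z => (norm_sub_le _ _).trans ?_⟩
  rw [add_mul]
  gcongr
  · refine (hA A le_rfl z).trans ?_
    gcongr
    linarith
  · refine (hB B le_rfl z).trans ?_
    gcongr
    linarith

theorem IsExpBounded.clm {E : Type*} [NormedAddCommGroup E] [NormedSpace ℂ E] {F : ℂ → E}
    (hF : IsExpBounded F) (L : E →L[ℂ] ℂ) : IsExpBounded fun z => L (F z) := by
  obtain ⟨A, hA0, hA⟩ := hF.exists_nonneg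
  refine ⟨max (‖L‖ * A) A, fun z => (L.le_opNorm _).trans ?_⟩
  calc ‖L‖ * ‖F z‖ ≤ ‖L‖ * A * Real.exp (A * ‖z‖) := by
        rw [mul_assoc]
        gcongr
        exact hA A le_rfl z
    _ ≤ _ := by
      gcongr
      · exact le_max_left _ _
      · exact le_max_right _ _

theorem IsExpBounded.of_mul {H Δ : ℂ → ℂ} (hH : Differentiable ℂ H) (hΔ : Differentiable ℂ Δ)
    (h0 : ∃ z, Δ z ≠ 0) (hΔC : IsExpBounded Δ) (hHC : IsExpBounded fun z => H z * Δ z) :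
    IsExpBounded H := by
  obtain ⟨A, hA0, hA⟩ := hΔC.exists_nonneg
  obtain ⟨B, hB0, hB⟩ := hHC.exists_nonneg
  exact exists_norm_le_exp_of_mul hH hΔ h0 (hA _ (le_max_left A B)) (hB _ (le_max_right A B))

end ExpBounded

section Rays

variable {p q R S f g : ℝ → ℂ} {b₁ b₂ : ℝ} {α β : ℂ}

/-- The linear form `Y ↦ ∫ f Y₁ + ∫ g Y₂`. -/
def integralForm (hf : IntegrableOn f (Icc 0 1)) (hg : IntegrableOn g (Icc 0 1)) :
    C(unitInterval, ℂ) × C(unitInterval, ℂ) →L[ℂ] ℂ :=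
  (ContinuousMap.evalCLM ℂ (1 : unitInterval)).comp
    ((volterra hf).coprod (volterra hg))

theorem integralForm_apply (hf : IntegrableOn f (Icc 0 1)) (hg : IntegrableOn g (Icc 0 1))
    (Y : C(unitInterval, ℂ) × C(unitInterval, ℂ)) :
    integralForm hf hg Y = (∫ t in (0 : ℝ)..1, f t * IccExtend zero_le_one Y.1 t)
      + ∫ t in (0 : ℝ)..1, g t * IccExtend zero_le_one Y.2 t := rfl

/-- The boundary form `Y ↦ Y₁(0) + β Y₁(1)`. -/
def leftForm (β : ℂ) : C(unitInterval, ℂ) × C(unitInterval, ℂ) →L[ℂ] ℂ :=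
  ((ContinuousMap.evalCLM ℂ (0 : unitInterval) : C(unitInterval, ℂ) →L[ℂ] ℂ)
    + β • (ContinuousMap.evalCLM ℂ (1 : unitInterval) : C(unitInterval, ℂ) →L[ℂ] ℂ)).comp
    (ContinuousLinearMap.fst ℂ _ _)

/-- The boundary form `Y ↦ Y₂(1) + α Y₂(0)`. -/
def rightForm (α : ℂ) : C(unitInterval, ℂ) × C(unitInterval, ℂ) →L[ℂ] ℂ :=
  ((ContinuousMap.evalCLM ℂ (1 : unitInterval) : C(unitInterval, ℂ) →L[ℂ] ℂ)
    + α • (ContinuousMap.evalCLM ℂ (0 : unitInterval) : C(unitInterval, ℂ) →L[ℂ] ℂ)).comp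
    (ContinuousLinearMap.snd ℂ _ _)

theorem leftForm_apply (Y : C(unitInterval, ℂ) × C(unitInterval, ℂ)) :
    leftForm β Y = Y.1 0 + β * Y.1 1 := rfl

theorem rightForm_apply (Y : C(unitInterval, ℂ) × C(unitInterval, ℂ)) :
    rightForm α Y = Y.2 1 + α * Y.2 0 := rfl

theorem eventually_norm_le_of_im_eq_one (hb₁ : b₁ < 0) (hb₂ : 0 < b₂) (hαβ : α * β = 0)
    (hp : IntegrableOn p (Icc 0 1)) (hq : IntegrableOn q (Icc 0 1))
    (hpR : p =ᵐ[volume.restrict (Icc 0 1)] R) (hR : ContinuousWithinAt R (Icc 0 1) 0)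
    (hR0 : R 0 ≠ 0) (hqS : q =ᵐ[volume.restrict (Icc 0 1)] S)
    (hS : ContinuousWithinAt S (Icc 0 1) 1) (hS1 : S 1 ≠ 0) {d : ℂ} (hre : |d.re| = 1)
    (hd : d.im = 1) :
    ∃ D : ℝ, ∀ᶠ t : ℝ in atTop, ∀ Y, volterraPencil hp hq Y
      = (t * d) • volterraDiag (Complex.I * b₁) (Complex.I * b₂) Y →
      ‖Y‖ ≤ D * t ^ 2 * (‖leftForm β Y‖ + ‖rightForm α Y‖) := by
  set m := min (-b₁) b₂ / 2 with hmdef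
  have hm : 0 < m := half_pos (lt_min (by linarith) hb₂)
  have hd2 : ‖d‖ ≤ 2 := (Complex.norm_le_abs_re_add_abs_im d).trans (by rw [hre, hd]; norm_num)
  obtain ⟨D, hD, K, hK, h⟩ := SolvesSystem.exists_forall_norm_le_sq hαβ hp hq hpR hR hR0 hqS hS hS1
    (Λ := 2 * (b₂ - b₁) / m) (div_pos (by linarith) hm)
  refine ⟨D * m ^ 2, ?_⟩
  filter_upwards [eventually_ge_atTop 0,
    (tendsto_id.const_mul_atTop hm).eventually_ge_atTop K] with t ht0 htK Y hY
  have h' := re_le_of_im_eq_one (b₁ := b₁) (b₂ := b₂) ht0 hd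
  have hdiff : ‖(t * d) * (Complex.I * b₁) - (t * d) * (Complex.I * b₂)‖
      ≤ 2 * (b₂ - b₁) / m * (m * t) := by
    have e : (t * d) * (Complex.I * b₁) - (t * d) * (Complex.I * b₂)
        = (t * d) * (Complex.I * ((b₁ - b₂ : ℝ) : ℂ)) := by push_cast; ring
    rw [e, norm_mul, norm_mul, norm_mul, Complex.norm_I, Complex.norm_real, Complex.norm_real,
      Real.norm_of_nonneg ht0, Real.norm_of_nonpos (by linarith), one_mul]
    calc t * ‖d‖ * -(b₁ - b₂) ≤ t * 2 * -(b₁ - b₂) := by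
          have : 0 ≤ -(b₁ - b₂) := by linarith
          gcongr
      _ = _ := by field_simp; ring
  have key := h (m * t) htK _ _ _ _ h'.1 h'.2 hdiff ((volterraPencil_eq_smul_iff hp hq).1 hY)
  have e0 (U : C(unitInterval, ℂ)) : IccExtend (zero_le_one (α := ℝ)) U 0 = U 0 :=
    IccExtend_zero_one_apply U 0
  have e1 (U : C(unitInterval, ℂ)) : IccExtend (zero_le_one (α := ℝ)) U 1 = U 1 :=
    IccExtend_zero_one_apply U 1
  simp only [e0, e1, ← leftForm_apply, ← rightForm_apply] at key
  have h0 : 0 ≤ D * m ^ 2 * t ^ 2 * (‖leftForm β Y‖ + ‖rightForm α Y‖) := by positivity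
  refine max_le ?_ ?_
  · rw [ContinuousMap.norm_le _ h0]
    intro x
    have := (key x x.2).1
    rw [IccExtend_zero_one_apply] at this
    exact this.trans (le_of_eq (by ring))
  · rw [ContinuousMap.norm_le _ h0]
    intro x
    have := (key x x.2).2
    rw [IccExtend_zero_one_apply] at this
    exact this.trans (le_of_eq (by ring))

theorem eventually_norm_le_of_im_eq_neg_one (hb₁ : b₁ < 0) (hb₂ : 0 < b₂) (α β : ℂ)
    (hp : IntegrableOn p (Icc 0 1)) (hq : IntegrableOn q (Icc 0 1)) {d : ℂ} (hd : d.im = -1) :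
    ∀ᶠ t : ℝ in atTop, ∀ Y, volterraPencil hp hq Y
      = (t * d) • volterraDiag (Complex.I * b₁) (Complex.I * b₂) Y →
      ∀ x, ‖Y.1 x‖ ≤ 4 * (Real.exp (-(min (-b₁) b₂ / 2 * t) * (1 - x))
          + Real.exp (-(min (-b₁) b₂ / 2 * t) * x)) * (‖leftForm β Y‖ + ‖rightForm α Y‖) ∧
        ‖Y.2 x‖ ≤ 4 * (Real.exp (-(min (-b₁) b₂ / 2 * t) * (1 - x))
          + Real.exp (-(min (-b₁) b₂ / 2 * t) * x)) * (‖leftForm β Y‖ + ‖rightForm α Y‖) := by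
  have hm : 0 < min (-b₁) b₂ / 2 := half_pos (lt_min (by linarith) hb₂)
  obtain ⟨K, hK, h⟩ := SolvesSystem.exists_forall_norm_le_exp α β hq hp
  filter_upwards [eventually_ge_atTop 0,
    (tendsto_id.const_mul_atTop hm).eventually_ge_atTop K] with t ht0 htK Y hY x
  have h' := re_le_of_im_eq_neg_one (b₁ := b₁) (b₂ := b₂) ht0 hd
  have key := h _ htK _ _ _ _ h'.1 h'.2 ((volterraPencil_eq_smul_iff hp hq).1 hY).swap x x.2
  have e0 (U : C(unitInterval, ℂ)) : IccExtend (zero_le_one (α := ℝ)) U 0 = U 0 :=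
    IccExtend_zero_one_apply U 0
  have e1 (U : C(unitInterval, ℂ)) : IccExtend (zero_le_one (α := ℝ)) U 1 = U 1 :=
    IccExtend_zero_one_apply U 1
  simp only [e0, e1, ← leftForm_apply, ← rightForm_apply, IccExtend_zero_one_apply] at key
  exact key.symm

theorem eventually_norm_le_mul_of_im_eq_neg_one (hb₁ : b₁ < 0) (hb₂ : 0 < b₂) (α β : ℂ)
    (hp : IntegrableOn p (Icc 0 1)) (hq : IntegrableOn q (Icc 0 1)) {d : ℂ} (hd : d.im = -1) :
    ∀ᶠ t : ℝ in atTop, ∀ Y, volterraPencil hp hq Y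
      = (t * d) • volterraDiag (Complex.I * b₁) (Complex.I * b₂) Y →
      ‖Y‖ ≤ 8 * (‖leftForm β Y‖ + ‖rightForm α Y‖) := by
  have hm : 0 < min (-b₁) b₂ / 2 := half_pos (lt_min (by linarith) hb₂)
  filter_upwards [eventually_norm_le_of_im_eq_neg_one hb₁ hb₂ α β hp hq hd,
    eventually_ge_atTop 0] with t ht ht0 Y hY
  have hle (x : unitInterval) : Real.exp (-(min (-b₁) b₂ / 2 * t) * (1 - x))
      + Real.exp (-(min (-b₁) b₂ / 2 * t) * x) ≤ 2 := by
    have h1 : Real.exp (-(min (-b₁) b₂ / 2 * t) * (1 - x)) ≤ 1 := by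
      rw [Real.exp_le_one_iff, neg_mul, neg_nonpos]
      exact mul_nonneg (mul_nonneg hm.le ht0) (sub_nonneg.2 x.2.2)
    have h2 : Real.exp (-(min (-b₁) b₂ / 2 * t) * x) ≤ 1 := by
      rw [Real.exp_le_one_iff, neg_mul, neg_nonpos]
      exact mul_nonneg (mul_nonneg hm.le ht0) x.2.1
    linarith
  have h0 : 0 ≤ ‖leftForm β Y‖ + ‖rightForm α Y‖ := by positivity
  have hle' (x : unitInterval) : 4 * (Real.exp (-(min (-b₁) b₂ / 2 * t) * (1 - x))
      + Real.exp (-(min (-b₁) b₂ / 2 * t) * x)) * (‖leftForm β Y‖ + ‖rightForm α Y‖)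
      ≤ 8 * (‖leftForm β Y‖ + ‖rightForm α Y‖) :=
    mul_le_mul_of_nonneg_right (by linarith [hle x]) h0
  refine max_le ?_ ?_
  · rw [ContinuousMap.norm_le _ (by positivity)]
    exact fun x => (ht Y hY x).1.trans (hle' x)
  · rw [ContinuousMap.norm_le _ (by positivity)]
    exact fun x => (ht Y hY x).2.trans (hle' x)

theorem norm_integral_mul_IccExtend_le (hf : IntegrableOn f (Icc 0 1)) {κ ε B : ℝ} (hB : 0 ≤ B)
    (hε : ∀ x : ℝ, ∫ t in Icc (0 : ℝ) 1, Real.exp (-κ * |x - t|) * ‖f t‖ ≤ ε)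
    {U : C(unitInterval, ℂ)}
    (hU : ∀ x : unitInterval, ‖U x‖ ≤ 4 * (Real.exp (-κ * (1 - x)) + Real.exp (-κ * x)) * B) :
    ‖∫ t in (0 : ℝ)..1, f t * IccExtend zero_le_one U t‖ ≤ 8 * ε * B := by
  have h1 := integrableOn_exp_neg_mul_abs_mul (ρ := κ) (x := 1) hf.norm
  have h0 := integrableOn_exp_neg_mul_abs_mul (ρ := κ) (x := 0) hf.norm
  rw [intervalIntegral.integral_of_le zero_le_one, ← integral_Icc_eq_integral_Ioc]
  calc ‖∫ t in Icc (0 : ℝ) 1, f t * IccExtend zero_le_one U t‖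
      ≤ ∫ t in Icc (0 : ℝ) 1, ‖f t * IccExtend zero_le_one U t‖ := norm_integral_le_integral_norm _
    _ ≤ ∫ t in Icc (0 : ℝ) 1, 4 * B * (Real.exp (-κ * |1 - t|) * ‖f t‖
          + Real.exp (-κ * |0 - t|) * ‖f t‖) := by
        refine setIntegral_mono_on (integrableOn_mul_IccExtend hf U).norm
          ((h1.add h0).const_mul _) measurableSet_Icc fun t ht => ?_
        rw [norm_mul, IccExtend_of_mem _ _ ht, abs_of_nonneg (sub_nonneg.2 ht.2), zero_sub, abs_neg,
          abs_of_nonneg ht.1]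
        have := mul_le_mul_of_nonneg_left (hU ⟨t, ht⟩) (norm_nonneg (f t))
        refine this.trans (le_of_eq ?_)
        ring
    _ = 4 * B * ((∫ t in Icc (0 : ℝ) 1, Real.exp (-κ * |1 - t|) * ‖f t‖)
          + ∫ t in Icc (0 : ℝ) 1, Real.exp (-κ * |0 - t|) * ‖f t‖) := by
        rw [integral_const_mul, integral_add h1 h0]
    _ ≤ 4 * B * (ε + ε) := by
        gcongr
        · exact hε 1
        · exact hε 0
    _ = _ := by ring

theorem eventually_norm_integralForm_le_of_im_eq_neg_one (hb₁ : b₁ < 0) (hb₂ : 0 < b₂) (α β : ℂ)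
    (hp : IntegrableOn p (Icc 0 1)) (hq : IntegrableOn q (Icc 0 1))
    (hf : IntegrableOn f (Icc 0 1)) (hg : IntegrableOn g (Icc 0 1)) {d : ℂ} (hd : d.im = -1)
    {ε : ℝ} (hε : 0 < ε) :
    ∀ᶠ t : ℝ in atTop, ∀ Y, volterraPencil hp hq Y
      = (t * d) • volterraDiag (Complex.I * b₁) (Complex.I * b₂) Y →
      ‖integralForm hf hg Y‖ ≤ ε * (‖leftForm β Y‖ + ‖rightForm α Y‖) := by
  have hm : 0 < min (-b₁) b₂ / 2 := half_pos (lt_min (by linarith) hb₂)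
  obtain ⟨K₁, hK₁, h₁⟩ := exists_forall_integral_exp_neg_mul_abs_le hf (ε := ε / 16) (by positivity)
  obtain ⟨K₂, hK₂, h₂⟩ := exists_forall_integral_exp_neg_mul_abs_le hg (ε := ε / 16) (by positivity)
  filter_upwards [eventually_norm_le_of_im_eq_neg_one hb₁ hb₂ α β hp hq hd,
    (tendsto_id.const_mul_atTop hm).eventually_ge_atTop K₁,
    (tendsto_id.const_mul_atTop hm).eventually_ge_atTop K₂] with t ht ht₁ ht₂ Y hY
  rw [integralForm_apply]
  have h0 : 0 ≤ ‖leftForm β Y‖ + ‖rightForm α Y‖ := by positivity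
  refine (norm_add_le _ _).trans ?_
  have e₁ := norm_integral_mul_IccExtend_le hf h0 (h₁ _ ht₁) fun x => (ht Y hY x).1
  have e₂ := norm_integral_mul_IccExtend_le hg h0 (h₂ _ ht₂) fun x => (ht Y hY x).2
  linarith

end Rays

section Completeness

variable {p q R S f g : ℝ → ℂ} {b₁ b₂ : ℝ} {α β : ℂ}

/-- The linear form `l` vanishes on all chains of root functions of `volterraPencil` with respect
to `volterraDiag`, subject to the boundary conditions `leftForm` and `rightForm`. -/
def VanishesOnChains (hp : IntegrableOn p (Icc 0 1)) (hq : IntegrableOn q (Icc 0 1)) (b₁ b₂ : ℝ)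
    (α β : ℂ) (l : C(unitInterval, ℂ) × C(unitInterval, ℂ) →L[ℂ] ℂ) : Prop :=
  ∀ (z : ℂ) (ch : ℕ → C(unitInterval, ℂ) × C(unitInterval, ℂ)) (m : ℕ), ch 0 ≠ 0 →
    volterraPencil hp hq (ch 0)
      = z • volterraDiag (Complex.I * b₁) (Complex.I * b₂) (ch 0) →
    (∀ j < m, volterraPencil hp hq (ch (j + 1))
      = z • volterraDiag (Complex.I * b₁) (Complex.I * b₂) (ch (j + 1))
        + volterraDiag (Complex.I * b₁) (Complex.I * b₂) (ch j)) →
    (∀ j ≤ m, leftForm β (ch j) = 0 ∧ rightForm α (ch j) = 0) → l (ch m) = 0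

/-- A linear form that vanishes on all chains of root functions vanishes on solutions whose
boundary values are constant multiples of the characteristic function. -/
theorem integralForm_eq_zero_of_chains (hb₁ : b₁ < 0) (hb₂ : 0 < b₂) (hαβ : α * β = 0)
    (hp : IntegrableOn p (Icc 0 1)) (hq : IntegrableOn q (Icc 0 1))
    (hf : IntegrableOn f (Icc 0 1)) (hg : IntegrableOn g (Icc 0 1))
    (hpR : p =ᵐ[volume.restrict (Icc 0 1)] R) (hR : ContinuousWithinAt R (Icc 0 1) 0)
    (hR0 : R 0 ≠ 0) (hqS : q =ᵐ[volume.restrict (Icc 0 1)] S)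
    (hS : ContinuousWithinAt S (Icc 0 1) 1) (hS1 : S 1 ≠ 0)
    (hl : VanishesOnChains hp hq b₁ b₂ α β (integralForm hf hg))
    {w : ℂ → C(unitInterval, ℂ) × C(unitInterval, ℂ)} (hw : Differentiable ℂ w)
    (hwC : IsExpBounded w)
    (hws : ∀ z : ℂ, volterraPencil hp hq (w z)
      = z • volterraDiag (Complex.I * b₁) (Complex.I * b₂) (w z))
    {Δ : ℂ → ℂ} (hΔ : Differentiable ℂ Δ) (hΔC : IsExpBounded Δ)
    (hΔ0 : ∀ d : ℂ, |d.re| = 1 → |d.im| = 1 → ∀ᶠ t : ℝ in atTop, Δ (t * d) ≠ 0)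
    {a b : ℂ} (ha : ∀ z, leftForm β (w z) = a * Δ z) (hb : ∀ z, rightForm α (w z) = b * Δ z)
    (z : ℂ) : integralForm hf hg (w z) = 0 := by
  set l := integralForm hf hg with hl_def
  have h0 : ∃ z, Δ z ≠ 0 := by
    obtain ⟨t, ht⟩ := (hΔ0 ⟨1, 1⟩ (by simp) (by simp)).exists
    exact ⟨_, ht⟩
  obtain ⟨H, hH, hHΔ⟩ := exists_eq_mul_of_chains (volterraPencil hp hq)
    (volterraDiag (Complex.I * b₁) (Complex.I * b₂))
    (fun i : Bool => if i then leftForm β else rightForm α) l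
    (fun z ch m h1 h2 h3 h4 => hl z ch m h1 h2 h3 fun j hj =>
      ⟨h4 j hj true, h4 j hj false⟩) hw hws hΔ h0 (c := fun i => if i then a else b)
    (fun i z => by cases i <;> simp [ha, hb])
  have hHC : IsExpBounded H := by
    refine IsExpBounded.of_mul hH hΔ h0 hΔC ?_
    simp_rw [← hHΔ]
    exact hwC.clm l
  obtain ⟨C, hC⟩ := hHC
  have hnorm (z : ℂ) : ‖leftForm β (w z)‖ + ‖rightForm α (w z)‖ = (‖a‖ + ‖b‖) * ‖Δ z‖ := by
    rw [ha, hb, norm_mul, norm_mul, add_mul]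
  have hle {z : ℂ} {M : ℝ} (hz : Δ z ≠ 0)
      (h : ‖l (w z)‖ ≤ M * (‖leftForm β (w z)‖ + ‖rightForm α (w z)‖)) :
      ‖H z‖ ≤ M * (‖a‖ + ‖b‖) := by
    rw [hnorm, hHΔ, norm_mul, ← mul_assoc] at h
    exact le_of_mul_le_mul_right h (norm_pos_iff.2 hz)
  have hlow (d : ℂ) (hre : |d.re| = 1) (hd : d.im = -1) (ε : ℝ) (hε : 0 < ε) :
      ∀ᶠ t : ℝ in atTop, ‖H (t * d)‖ ≤ ε * (‖a‖ + ‖b‖) := by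
    filter_upwards [hΔ0 d hre (by rw [hd]; simp),
      eventually_norm_integralForm_le_of_im_eq_neg_one hb₁ hb₂ α β hp hq hf hg hd hε] with t ht ht'
    exact hle ht (ht' _ (hws _))
  have hHz : ∀ z, H z = 0 := by
    refine eq_zero_of_bisectors hH hC (fun d hre him => ?_) (d₀ := ⟨1, -1⟩) ?_ ?_
    · rcases eq_or_eq_neg_of_abs_eq him with hd | hd
      · obtain ⟨D, hD⟩ := eventually_norm_le_of_im_eq_one hb₁ hb₂ hαβ hp hq hpR hR hR0 hqS hS hS1
          hre hd
        refine ⟨‖l‖ * D * (‖a‖ + ‖b‖), ?_⟩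
        filter_upwards [hD, hΔ0 d hre him] with t ht ht0
        refine (hle (M := ‖l‖ * (D * t ^ 2)) ht0 ?_).trans (le_of_eq (by ring))
        rw [mul_assoc]
        exact (l.le_opNorm _).trans (mul_le_mul_of_nonneg_left (ht _ (hws _)) (norm_nonneg _))
      · refine ⟨‖a‖ + ‖b‖, ?_⟩
        filter_upwards [hlow d hre hd 1 one_pos, eventually_ge_atTop 1] with t ht ht1
        refine ht.trans ?_
        have : 0 ≤ ‖a‖ + ‖b‖ := by positivity
        rw [one_mul]
        exact le_mul_of_one_le_right this (one_le_pow₀ ht1)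
    · intro h0
      simpa using congrArg Complex.re h0
    · rw [Metric.tendsto_nhds]
      intro ε hε
      filter_upwards [hlow ⟨1, -1⟩ (by simp) rfl (ε / (2 * (‖a‖ + ‖b‖ + 1))) (by positivity)]
        with t ht
      rw [dist_zero_right]
      refine ht.trans_lt ?_
      rw [div_mul_eq_mul_div, div_lt_iff₀ (by positivity)]
      have : 0 ≤ ‖a‖ + ‖b‖ := by positivity
      nlinarith
  rw [hHΔ, hHz, zero_mul]

theorem ae_eq_zero_of_chains (hb₁ : b₁ < 0) (hb₂ : 0 < b₂) (hαβ : α * β = 0)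
    (hp : IntegrableOn p (Icc 0 1)) (hq : IntegrableOn q (Icc 0 1))
    (hf : IntegrableOn f (Icc 0 1)) (hg : IntegrableOn g (Icc 0 1))
    (hpR : p =ᵐ[volume.restrict (Icc 0 1)] R) (hR : ContinuousWithinAt R (Icc 0 1) 0)
    (hR0 : R 0 ≠ 0) (hqS : q =ᵐ[volume.restrict (Icc 0 1)] S)
    (hS : ContinuousWithinAt S (Icc 0 1) 1) (hS1 : S 1 ≠ 0)
    (hl : VanishesOnChains hp hq b₁ b₂ α β (integralForm hf hg)) :
    f =ᵐ[volume.restrict (Icc 0 1)] 0 ∧ g =ᵐ[volume.restrict (Icc 0 1)] 0 := by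
  have hz0 : IntegrableOn (0 : ℝ → ℂ) (Icc 0 1) := integrable_zero _ _ _
  obtain ⟨Φ, hΦ, hΦs, hΦC⟩ := exists_differentiable_solvesSystem hp hq hz0 hz0
    (Complex.I * b₁) (Complex.I * b₂) 1 0
  obtain ⟨Ψ, hΨ, hΨs, hΨC⟩ := exists_differentiable_solvesSystem hp hq hz0 hz0
    (Complex.I * b₁) (Complex.I * b₂) 0 1
  have hΦC' : IsExpBounded Φ := hΦC
  have hΨC' : IsExpBounded Ψ := hΨC
  have hΦp (z : ℂ) := (volterraPencil_eq_smul_iff hp hq).2 (hΦs z).2.2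
  have hΨp (z : ℂ) := (volterraPencil_eq_smul_iff hp hq).2 (hΨs z).2.2
  set u₁ : ℂ → ℂ := fun z => leftForm β (Φ z) with hu₁
  set u₂ : ℂ → ℂ := fun z => rightForm α (Φ z) with hu₂
  set v₁ : ℂ → ℂ := fun z => leftForm β (Ψ z) with hv₁
  set v₂ : ℂ → ℂ := fun z => rightForm α (Ψ z) with hv₂
  have du₁ : Differentiable ℂ u₁ := (leftForm β).differentiable.comp hΦ
  have du₂ : Differentiable ℂ u₂ := (rightForm α).differentiable.comp hΦ
  have dv₁ : Differentiable ℂ v₁ := (leftForm β).differentiable.comp hΨ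
  have dv₂ : Differentiable ℂ v₂ := (rightForm α).differentiable.comp hΨ
  set Δ : ℂ → ℂ := fun z => u₁ z * v₂ z - v₁ z * u₂ z with hΔdef
  have hΔ : Differentiable ℂ Δ := (du₁.mul dv₂).sub (dv₁.mul du₂)
  have hΔC : IsExpBounded Δ := ((hΦC'.clm (leftForm β)).smul (hΨC'.clm (rightForm α))).sub
    ((hΨC'.clm (leftForm β)).smul (hΦC'.clm (rightForm α)))
  set X : ℂ → ℂ → ℂ → C(unitInterval, ℂ) × C(unitInterval, ℂ) :=
    fun s r z => s • Φ z - r • Ψ z with hX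
  have hXp (s r z : ℂ) : volterraPencil hp hq (X s r z)
      = z • volterraDiag (Complex.I * b₁) (Complex.I * b₂) (X s r z) := by
    simp only [hX, map_sub, map_smul, hΦp, hΨp, smul_sub, smul_comm z]
  have hX1 (s r z : ℂ) : (X s r z).1 0 = s := by
    have h1 : (X s r z).1 0 = s * (Φ z).1 0 - r * (Ψ z).1 0 := rfl
    rw [h1, (hΦs z).1, (hΨs z).1]
    ring
  have hX2 (s r z : ℂ) : (X s r z).2 0 = -r := by
    have h1 : (X s r z).2 0 = s * (Φ z).2 0 - r * (Ψ z).2 0 := rfl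
    rw [h1, (hΦs z).2.1, (hΨs z).2.1]
    ring
  have hXl (s r z : ℂ) : leftForm β (X s r z) = s * u₁ z - r * v₁ z := by
    simp only [hX, map_sub, map_smul, smul_eq_mul, hu₁, hv₁]
  have hXr (s r z : ℂ) : rightForm α (X s r z) = s * u₂ z - r * v₂ z := by
    simp only [hX, map_sub, map_smul, smul_eq_mul, hu₂, hv₂]
  have hΔ0 (d : ℂ) (hre : |d.re| = 1) (him : |d.im| = 1) :
      ∀ᶠ t : ℝ in atTop, Δ (t * d) ≠ 0 := by
    have hex : ∀ᶠ t : ℝ in atTop, ∀ Y, volterraPencil hp hq Y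
        = (t * d) • volterraDiag (Complex.I * b₁) (Complex.I * b₂) Y →
        leftForm β Y = 0 → rightForm α Y = 0 → Y = 0 := by
      rcases eq_or_eq_neg_of_abs_eq him with hd | hd
      · obtain ⟨D, hD⟩ := eventually_norm_le_of_im_eq_one hb₁ hb₂ hαβ hp hq hpR hR hR0 hqS hS hS1
          hre hd
        filter_upwards [hD] with t ht Y hY h1 h2
        simpa [h1, h2] using ht Y hY
      · filter_upwards [eventually_norm_le_mul_of_im_eq_neg_one hb₁ hb₂ α β hp hq hd]
          with t ht Y hY h1 h2
        simpa [h1, h2] using ht Y hY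
    filter_upwards [hex] with t ht h0
    have hcoef (s r : ℂ) (hl : s * u₁ (t * d) - r * v₁ (t * d) = 0)
        (hr : s * u₂ (t * d) - r * v₂ (t * d) = 0) : s = 0 ∧ r = 0 := by
      have h := ht _ (hXp s r (t * d)) ((hXl _ _ _).trans hl) ((hXr _ _ _).trans hr)
      have h1 := hX1 s r (t * d)
      have h2 := hX2 s r (t * d)
      rw [h] at h1 h2
      exact ⟨h1.symm, neg_eq_zero.1 h2.symm⟩
    obtain ⟨-, h1⟩ := hcoef (v₂ (t * d)) (u₂ (t * d)) (by linear_combination h0) (by ring)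
    obtain ⟨-, h2⟩ := hcoef (v₁ (t * d)) (u₁ (t * d)) (by ring) (by linear_combination -h0)
    exact one_ne_zero (hcoef 1 0 (by rw [h2]; ring) (by rw [h1]; ring)).1
  have hvan {s r : ℂ → ℂ} (hs : Differentiable ℂ s) (hr : Differentiable ℂ r)
      (hsC : IsExpBounded fun z => X (s z) (r z) z) {a b : ℂ}
      (ha : ∀ z, s z * u₁ z - r z * v₁ z = a * Δ z)
      (hb : ∀ z, s z * u₂ z - r z * v₂ z = b * Δ z) (z : ℂ) :
      s z * integralForm hf hg (Φ z) - r z * integralForm hf hg (Ψ z) = 0 := by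
    have := integralForm_eq_zero_of_chains hb₁ hb₂ hαβ hp hq hf hg hpR hR hR0 hqS hS hS1 hl
      (w := fun z => X (s z) (r z) z) ((hs.smul hΦ).sub (hr.smul hΨ)) hsC (fun z => hXp _ _ _)
      hΔ hΔC hΔ0 (a := a) (b := b) (fun z => (hXl _ _ _).trans (ha z))
      (fun z => (hXr _ _ _).trans (hb z)) z
    simpa [hX] using this
  have hexp {F G : ℂ → C(unitInterval, ℂ) × C(unitInterval, ℂ)} {s r : ℂ → ℂ}
      (hF : IsExpBounded F) (hG : IsExpBounded G) (hs : IsExpBounded s) (hr : IsExpBounded r) :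
      IsExpBounded fun z => s z • F z - r z • G z := (hs.smul hF).sub (hr.smul hG)
  have hA := hvan dv₂ du₂ (hexp hΦC' hΨC' (hΨC'.clm _) (hΦC'.clm _)) (a := 1) (b := 0)
    (fun z => by simp only [hΔdef]; ring) (fun z => by ring)
  have hB := hvan dv₁ du₁ (hexp hΦC' hΨC' (hΨC'.clm _) (hΦC'.clm _)) (a := 0) (b := -1)
    (fun z => by ring) (fun z => by simp only [hΔdef]; ring)
  have hlΦ (z : ℂ) (hz : Δ z ≠ 0) : integralForm hf hg (Φ z) = 0 := by
    refine (mul_eq_zero.1 ?_).resolve_left hz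
    linear_combination u₁ z * hA z - u₂ z * hB z
  have hlΨ (z : ℂ) (hz : Δ z ≠ 0) : integralForm hf hg (Ψ z) = 0 := by
    refine (mul_eq_zero.1 ?_).resolve_left hz
    linear_combination v₁ z * hA z - v₂ z * hB z
  obtain ⟨Y, hY, hYs, C, hYC⟩ := exists_differentiable_solvesSystem
    (integrableOn_comp_one_sub hq) (integrableOn_comp_one_sub hp) (integrableOn_comp_one_sub hf)
    (integrableOn_comp_one_sub hg) (Complex.I * b₁) (Complex.I * b₂) 0 0
  have e0 (U : C(unitInterval, ℂ)) : IccExtend (zero_le_one (α := ℝ)) U 0 = U 0 :=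
    IccExtend_zero_one_apply U 0
  have e1 (U : C(unitInterval, ℂ)) : IccExtend (zero_le_one (α := ℝ)) U 1 = U 1 :=
    IccExtend_zero_one_apply U 1
  have hlag (z : ℂ) {V : C(unitInterval, ℂ) × C(unitInterval, ℂ)}
      (hV : SolvesSystem (z * (Complex.I * b₁)) (z * (Complex.I * b₂)) p q 0 0
        (IccExtend zero_le_one V.1) (IccExtend zero_le_one V.2)) :
      integralForm hf hg V = V.1 0 * (Y z).1 1 + V.2 0 * (Y z).2 1 := by
    have h1 := (hYs z).2.2.reflect (integrableOn_comp_one_sub hq) (integrableOn_comp_one_sub hp)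
      (integrableOn_comp_one_sub hf) (integrableOn_comp_one_sub hg)
    simp only [sub_sub_cancel] at h1
    have h2 := hV.lagrange h1 hp hq hf hg
    simp only [sub_self, sub_zero, e0, e1, (hYs z).1, (hYs z).2.1, mul_zero, add_zero,
      zero_add] at h2
    rw [integralForm_apply]
    exact h2
  obtain ⟨h1, h2⟩ := SolvesSystem.ae_eq_zero_of_bisectors hb₁ hb₂ (integrableOn_comp_one_sub hq)
    (integrableOn_comp_one_sub hp) (integrableOn_comp_one_sub hf) (integrableOn_comp_one_sub hg)
    hY hYC hYs fun d hre him => by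
      filter_upwards [hΔ0 d hre him] with t ht
      have h1 := (hlag _ (hΦs (t * d)).2.2).symm.trans (hlΦ _ ht)
      have h2 := (hlag _ (hΨs (t * d)).2.2).symm.trans (hlΨ _ ht)
      rw [(hΦs _).1, (hΦs _).2.1] at h1
      rw [(hΨs _).1, (hΨs _).2.1] at h2
      exact ⟨by linear_combination h1, by linear_combination h2⟩
  have h1' := ae_comp_one_sub h1
  have h2' := ae_comp_one_sub h2
  simp only [sub_sub_cancel] at h1' h2'
  exact ⟨h1', h2'⟩

end Completeness

section RootFunctions

variable {b₁ b₂ : ℝ} {Q12 Q21 : ℝ → ℂ} {z : ℂ}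

theorem SolvesSystem.solvesDirac (hb₁ : b₁ ≠ 0) (hb₂ : b₂ ≠ 0) (hQ12 : IntegrableOn Q12 I01)
    (hQ21 : IntegrableOn Q21 I01) {f g u v : ℝ → ℂ} {rhs : ℝ → ℂ × ℂ}
    (hf : IntegrableOn f I01) (hg : IntegrableOn g I01)
    (h : SolvesSystem (z * (Complex.I * b₁)) (z * (Complex.I * b₂))
      (fun t => -(Complex.I * b₁) * Q12 t) (fun t => -(Complex.I * b₂) * Q21 t)
      (fun t => Complex.I * b₁ * f t) (fun t => Complex.I * b₂ * g t) u v)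
    (hrhs : ∀ x, rhs x = (z * u x + f x, z * v x + g x)) :
    SolvesDirac b₁ b₂ Q12 Q21 (fun x => (u x, v x)) rhs := by
  obtain ⟨hu, hv, h1, h2⟩ := h
  have hb₁' : (b₁ : ℂ) ≠ 0 := by exact_mod_cast hb₁
  have hb₂' : (b₂ : ℂ) ≠ 0 := by exact_mod_cast hb₂
  set G₁ : ℝ → ℂ := fun t => z * (Complex.I * b₁) * u t
    + (-(Complex.I * b₁) * Q12 t * v t + Complex.I * b₁ * f t) with hG₁
  set G₂ : ℝ → ℂ := fun t => z * (Complex.I * b₂) * v t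
    + (-(Complex.I * b₂) * Q21 t * u t + Complex.I * b₂ * g t) with hG₂
  have hI₁ : IntegrableOn G₁ I01 :=
    ((hu.integrableOn_Icc).const_mul _).add
      ((IntegrableOn.mul_continuousOn (hQ12.const_mul _) hv isCompact_Icc).add (hf.const_mul _))
  have hI₂ : IntegrableOn G₂ I01 :=
    ((hv.integrableOn_Icc).const_mul _).add
      ((IntegrableOn.mul_continuousOn (hQ21.const_mul _) hu isCompact_Icc).add (hg.const_mul _))
  refine ⟨fun t => (G₁ t, G₂ t), hI₁.prodMk hI₂, fun x hx => ?_, ?_⟩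
  · have hsub : Ioc 0 x ⊆ I01 := fun t ht => ⟨ht.1.le, ht.2.trans hx.2⟩
    rw [intervalIntegral.integral_of_le hx.1, integral_pair (hI₁.mono_set hsub) (hI₂.mono_set hsub),
      ← intervalIntegral.integral_of_le hx.1, ← intervalIntegral.integral_of_le hx.1]
    exact Prod.ext (h1 x hx) (h2 x hx)
  · refine Eventually.of_forall fun x => ?_
    simp only [hrhs, hG₁, hG₂]
    constructor
    · field_simp
      linear_combination (-z * u x - f x + Q12 x * v x) * Complex.I_sq
    · field_simp
      linear_combination (-z * v x - g x + Q21 x * u x) * Complex.I_sq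

theorem exists_boundary_normal_form {a : Fin 2 → Fin 4 → ℂ} (hJ32 : Jdet a 2 1 = 0)
    (hJ42 : Jdet a 3 1 = 0) (hJ13 : Jdet a 0 2 = 0) (hJ14 : Jdet a 0 3 ≠ 0) :
    ∃ α β : ℂ, α * β = 0 ∧ ∀ y : ℝ → ℂ × ℂ, (y 0).1 + β * (y 1).1 = 0 →
      (y 1).2 + α * (y 0).2 = 0 → SatisfiesBC a y := by
  have hα (j : Fin 2) : Jdet a 0 1 / Jdet a 0 3 * a j 3 = a j 1 := by
    field_simp
    unfold Jdet at *
    fin_cases j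
    · simp only [Fin.zero_eta]
      linear_combination a 0 0 * hJ42
    · simp only [Fin.mk_one]
      linear_combination a 1 0 * hJ42
  have hβ (j : Fin 2) : Jdet a 2 3 / Jdet a 0 3 * a j 0 = a j 2 := by
    field_simp
    unfold Jdet at *
    fin_cases j
    · simp only [Fin.zero_eta]
      linear_combination -a 0 3 * hJ13
    · simp only [Fin.mk_one]
      linear_combination -a 1 3 * hJ13
  refine ⟨Jdet a 0 1 / Jdet a 0 3, Jdet a 2 3 / Jdet a 0 3, ?_, fun y h0 h1 j => ?_⟩
  · refine (mul_eq_zero.1 ?_).resolve_left hJ14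
    rw [← hJ32, Jdet.eq_1 a 2 1, ← hα, ← hα, ← hβ, ← hβ, Jdet.eq_1 a 0 3]
    ring
  · rw [← hα, ← hβ]
    linear_combination a j 0 * h0 + a j 3 * h1

theorem vanishesOnChains_of_isRootFunction (hb₁ : b₁ ≠ 0) (hb₂ : b₂ ≠ 0)
    (hQ12 : IntegrableOn Q12 I01) (hQ21 : IntegrableOn Q21 I01)
    (hp : IntegrableOn (fun t => -(Complex.I * b₁) * Q12 t) (Icc 0 1))
    (hq : IntegrableOn (fun t => -(Complex.I * b₂) * Q21 t) (Icc 0 1))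
    {a : Fin 2 → Fin 4 → ℂ} {α β : ℂ}
    (ha : ∀ y : ℝ → ℂ × ℂ, (y 0).1 + β * (y 1).1 = 0 → (y 1).2 + α * (y 0).2 = 0 →
      SatisfiesBC a y) {l : C(unitInterval, ℂ) × C(unitInterval, ℂ) →L[ℂ] ℂ}
    (hl : ∀ Y, IsRootFunction b₁ b₂ Q12 Q21 a
      (fun x => (IccExtend zero_le_one Y.1 x, IccExtend zero_le_one Y.2 x)) → l Y = 0) :
    VanishesOnChains hp hq b₁ b₂ α β l := by
  intro z ch m h0 hch0 hch hbc
  have e0 (U : C(unitInterval, ℂ)) : IccExtend (zero_le_one (α := ℝ)) U 0 = U 0 :=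
    IccExtend_zero_one_apply U 0
  have e1 (U : C(unitInterval, ℂ)) : IccExtend (zero_le_one (α := ℝ)) U 1 = U 1 :=
    IccExtend_zero_one_apply U 1
  have hint (U : C(unitInterval, ℂ)) :
      IntegrableOn (IccExtend (zero_le_one (α := ℝ)) U) I01 :=
    (U.continuous.Icc_extend').continuousOn.integrableOn_Icc
  refine hl _ ⟨z, m,
    fun j x => (IccExtend zero_le_one (ch j).1 x, IccExtend zero_le_one (ch j).2 x),
    fun j hj => ?_, ?_, ?_, fun j h1 hj => ?_, m, le_rfl, rfl⟩
  · refine ha _ ?_ ?_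
    · simpa only [e0, e1] using (leftForm_apply (ch j)).symm.trans (hbc j hj).1
    · simpa only [e0, e1] using (rightForm_apply (ch j)).symm.trans (hbc j hj).2
  · by_contra! hne
    refine h0 (Prod.ext (ContinuousMap.ext fun x => ?_) (ContinuousMap.ext fun x => ?_))
    · simpa [IccExtend_zero_one_apply] using congrArg Prod.fst (hne x x.2)
    · simpa [IccExtend_zero_one_apply] using congrArg Prod.snd (hne x x.2)
  · have h := (volterraPencil_eq_smul_iff hp hq).1 hch0
    refine SolvesSystem.solvesDirac (z := z) (f := 0) (g := 0) hb₁ hb₂ hQ12 hQ21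
      (integrable_zero _ _ _) (integrable_zero _ _ _) ?_ fun x => by simp
    simpa [Pi.zero_def] using h
  · obtain ⟨k, rfl⟩ := Nat.exists_eq_add_of_le' h1
    have h := (volterraPencil_eq_iff hp hq ((hint (ch k).1).const_mul (Complex.I * b₁))
      ((hint (ch k).2).const_mul (Complex.I * b₂)) (fun x => rfl) (fun x => rfl)).1 (hch k hj)
    exact SolvesSystem.solvesDirac hb₁ hb₂ hQ12 hQ21 (hint _) (hint _) h fun x => by simp

end RootFunctions

theorem Submodule.topologicalClosure_eq_top_of_forall_dual {E : Type*} [NormedAddCommGroup E]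
    [NormedSpace ℂ E] (s : Submodule ℂ E)
    (h : ∀ φ : StrongDual ℂ E, (∀ x ∈ s, φ x = 0) → φ = 0) : s.topologicalClosure = ⊤ := by
  have : IsClosed (s.topologicalClosure : Set E) := s.isClosed_topologicalClosure
  refine Submodule.eq_top_iff'.2 fun x => ?_
  rw [← Submodule.Quotient.mk_eq_zero]
  refine SeparatingDual.eq_zero_of_forall_dual_eq_zero (R := ℂ) fun φ => ?_
  have h0 := h (φ.comp s.topologicalClosure.mkQL) fun y hy => by
    have : (Submodule.Quotient.mk y : E ⧸ s.topologicalClosure) = 0 :=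
      (Submodule.Quotient.mk_eq_zero _).2 (s.le_topologicalClosure hy)
    change φ (Submodule.Quotient.mk y) = 0
    rw [this, map_zero]
  exact congrArg (fun ψ : StrongDual ℂ E => ψ x) h0

theorem exists_integral_representation {μ : Measure ℝ} (φ : StrongDual ℂ (Lp ℂ 2 μ)) :
    ∃ f : ℝ → ℂ, MemLp f 2 μ ∧ ∀ u : Lp ℂ 2 μ, φ u = ∫ t, f t * u t ∂μ := by
  set h := (InnerProductSpace.toDual ℂ (Lp ℂ 2 μ)).symm φ with hh
  refine ⟨fun t => starRingEnd ℂ (h t), (Lp.memLp h).star, fun u => ?_⟩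
  rw [← InnerProductSpace.toDual_symm_apply (𝕜 := ℂ), ← hh, L2.inner_def]
  simp [mul_comm]

theorem exists_integral_representation_prod {μ : Measure ℝ}
    (φ : StrongDual ℂ (Lp (ℂ × ℂ) 2 μ)) :
    ∃ f g : ℝ → ℂ, MemLp f 2 μ ∧ MemLp g 2 μ ∧
      ∀ w : Lp (ℂ × ℂ) 2 μ, φ w = (∫ t, f t * (w t).1 ∂μ) + ∫ t, g t * (w t).2 ∂μ := by
  set i₁ := (ContinuousLinearMap.inl ℂ ℂ ℂ).compLpL 2 μ
  set i₂ := (ContinuousLinearMap.inr ℂ ℂ ℂ).compLpL 2 μ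
  set π₁ := (ContinuousLinearMap.fst ℂ ℂ ℂ).compLpL 2 μ
  set π₂ := (ContinuousLinearMap.snd ℂ ℂ ℂ).compLpL 2 μ
  obtain ⟨f, hf, hφf⟩ := exists_integral_representation (φ.comp i₁)
  obtain ⟨g, hg, hφg⟩ := exists_integral_representation (φ.comp i₂)
  refine ⟨f, g, hf, hg, fun w => ?_⟩
  have h1 : π₁ w =ᵐ[μ] fun t => (w t).1 := (ContinuousLinearMap.fst ℂ ℂ ℂ).coeFn_compLp w
  have h2 : π₂ w =ᵐ[μ] fun t => (w t).2 := (ContinuousLinearMap.snd ℂ ℂ ℂ).coeFn_compLp w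
  have hw : w = i₁ (π₁ w) + i₂ (π₂ w) := by
    refine Lp.ext ?_
    filter_upwards [h1, h2, Lp.coeFn_add (i₁ (π₁ w)) (i₂ (π₂ w)),
      (ContinuousLinearMap.inl ℂ ℂ ℂ).coeFn_compLp (π₁ w),
      (ContinuousLinearMap.inr ℂ ℂ ℂ).coeFn_compLp (π₂ w)] with t h1 h2 h3 h4 h5
    have h4' : i₁ (π₁ w) t = ((w t).1, 0) := by rw [← h1]; exact h4
    have h5' : i₂ (π₂ w) t = (0, (w t).2) := by rw [← h2]; exact h5
    rw [h3, Pi.add_apply, h4', h5']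
    simp
  have e1 : φ (i₁ (π₁ w)) = ∫ t, f t * (w t).1 ∂μ :=
    (hφf (π₁ w)).trans (integral_congr_ae (h1.mono fun t ht => by simp only [ht]))
  have e2 : φ (i₂ (π₂ w)) = ∫ t, g t * (w t).2 ∂μ :=
    (hφg (π₂ w)).trans (integral_congr_ae (h2.mono fun t ht => by simp only [ht]))
  rw [← e1, ← e2, ← map_add, ← hw]

/-- Proposition: degenerate conditions, `Q` continuous at the endpoints. -/
theorem statement_6
    (b₁ b₂ : ℝ) (hb₁ : b₁ < 0) (hb₂ : 0 < b₂)
    (Q12 Q21 : ℝ → ℂ) (a : Fin 2 → Fin 4 → ℂ)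
    (hQ12L1 : MeasureTheory.IntegrableOn Q12 I01) (hQ21L1 : MeasureTheory.IntegrableOn Q21 I01)
    (R12 R21 : ℝ → ℂ)
    (h12 : Q12 =ᵐ[mu01] R12) (h21 : Q21 =ᵐ[mu01] R21)
    (hR12c0 : ContinuousWithinAt R12 I01 0) (hR12c1 : ContinuousWithinAt R12 I01 1)
    (hR21c0 : ContinuousWithinAt R21 I01 0) (hR21c1 : ContinuousWithinAt R21 I01 1)
    (hJ32 : Jdet a 2 1 = 0) (hJ42 : Jdet a 3 1 = 0) (hJ13 : Jdet a 0 2 = 0)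
    (hJ14 : Jdet a 0 3 ≠ 0)
    (hQ : R12 0 * R21 1 ≠ 0) :
    RootSystemComplete b₁ b₂ Q12 Q21 a := by
  obtain ⟨α, β, hαβ, hbc⟩ := exists_boundary_normal_form hJ32 hJ42 hJ13 hJ14
  have hfin : IsFiniteMeasure mu01 := ⟨by simp [mu01, I01]⟩
  refine Submodule.topologicalClosure_eq_top_of_forall_dual _ fun φ hφ => ?_
  obtain ⟨f, g, hf, hg, hφfg⟩ := exists_integral_representation_prod φ
  have hf1 : IntegrableOn f (Icc 0 1) := hf.integrable one_le_two
  have hg1 : IntegrableOn g (Icc 0 1) := hg.integrable one_le_two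
  have hI : Complex.I ≠ 0 := Complex.I_ne_zero
  have hb₁' : (b₁ : ℂ) ≠ 0 := by exact_mod_cast hb₁.ne
  have hb₂' : (b₂ : ℂ) ≠ 0 := by exact_mod_cast hb₂.ne'
  have hvan := vanishesOnChains_of_isRootFunction (α := α) (β := β) (a := a)
    (l := integralForm hf1 hg1) hb₁.ne hb₂.ne' hQ12L1 hQ21L1
    (hQ12L1.const_mul (-(Complex.I * b₁))) (hQ21L1.const_mul (-(Complex.I * b₂))) hbc fun Y hY => by
      set y : ℝ → ℂ × ℂ := fun x => (IccExtend zero_le_one Y.1 x, IccExtend zero_le_one Y.2 x)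
      have hy : Continuous y := (Y.1.continuous.Icc_extend').prodMk Y.2.continuous.Icc_extend'
      have hyL : MemLp y 2 mu01 := by
        refine MemLp.of_bound hy.aestronglyMeasurable ‖Y‖ (Eventually.of_forall fun x => ?_)
        exact max_le_max (Y.1.norm_coe_le_norm _) (Y.2.norm_coe_le_norm _)
      have h0 := (hφfg (hyL.toLp y)).symm.trans
        (hφ _ (Submodule.subset_span ⟨y, hY, hyL.coeFn_toLp⟩))
      rw [integralForm_apply, intervalIntegral.integral_of_le zero_le_one,
        intervalIntegral.integral_of_le zero_le_one, ← integral_Icc_eq_integral_Ioc,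
        ← integral_Icc_eq_integral_Ioc, ← h0]
      congr 1
      · exact integral_congr_ae (hyL.coeFn_toLp.mono fun t ht => by simp only [ht, y])
      · exact integral_congr_ae (hyL.coeFn_toLp.mono fun t ht => by simp only [ht, y])
  obtain ⟨hf0, hg0⟩ := ae_eq_zero_of_chains hb₁ hb₂ hαβ _ _ hf1 hg1
    (R := fun t => -(Complex.I * b₁) * R12 t) (S := fun t => -(Complex.I * b₂) * R21 t)
    (h12.mono fun t ht => by simp only [ht]) (hR12c0.const_mul _)
    (mul_ne_zero (neg_ne_zero.2 (mul_ne_zero hI hb₁')) (left_ne_zero_of_mul hQ))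
    (h21.mono fun t ht => by simp only [ht]) (hR21c1.const_mul _)
    (mul_ne_zero (neg_ne_zero.2 (mul_ne_zero hI hb₂')) (right_ne_zero_of_mul hQ)) hvan
  refine ContinuousLinearMap.ext fun w => ?_
  have h1 : ∫ t, f t * (w t).1 ∂mu01 = 0 :=
    integral_eq_zero_of_ae (hf0.mono fun t ht => by simp [ht])
  have h2 : ∫ t, g t * (w t).2 ∂mu01 = 0 :=
    integral_eq_zero_of_ae (hg0.mono fun t ht => by simp [ht])
  rw [hφfg, h1, h2, add_zero]
  rfl
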